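/- Let n ≥ 4k with k > 1. Then there is no rank two vector bundle E on P^n whose only nonzero intermediate cohomology modules are H^1_*(E), H^k_*(E), H^{n-k}_*(E), and H^{n-1}_*(E), with H^k_*(E) ≠ 0 — i.e., any rank two bundle E on P^n with H^i_*(E) = 0 for all i ∉ {1, k, n-k, n-1} (1 ≤ i ≤ n-1) must split. -/

import Mathlib

/-!
Background setup (the paper works on projective space `ℙⁿ` over a field `K`):
we encode a coherent sheaf on `ℙⁿ_K` by a module `M` over the homogeneous coordinate
ring `S = K[X₀,…,Xₙ]` (namely `M = Γ_*` of the sheaf), and the intermediate cohomology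
module `H^i_*(F) = ⊕_ν H^i(ℙⁿ, F(ν))` (for `i ≥ 1`) by the local cohomology module
`H^{i+1}_𝔪(M)` at the irrelevant maximal ideal `𝔪 = (X₀,…,Xₙ)`, to which it is
canonically isomorphic.
-/

open CategoryTheory TensorProduct

noncomputable section

/-- The homogeneous coordinate ring `S = K[X₀,…,Xₙ]` of `ℙⁿ`. -/
abbrev PolyS (K : Type) [Field K] (n : ℕ) : Type := MvPolynomial (Fin (n+1)) K

variable (K : Type) [Field K] (n : ℕ)

/-- The irrelevant maximal ideal `𝔪 = (X₀,…,Xₙ)` of `S`. -/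
def irrel : Ideal (PolyS K n) := Ideal.span (Set.range MvPolynomial.X)

/-- `H^i_*` of the sheaf on `ℙⁿ` associated to the `S`-module `M`, encoded (for `i ≥ 1`)
as the local cohomology module `H^{i+1}_𝔪(M)`. -/
def Hstar (i : ℕ) (M : Type) [AddCommGroup M] [Module (PolyS K n) M] :
    ModuleCat (PolyS K n) :=
  (localCohomology (irrel K n) (i+1)).obj (ModuleCat.of (PolyS K n) M)

/-- `M` is (the module of sections `Γ_*` of) an algebraic vector bundle on `ℙⁿ`:
finitely generated, depth `≥ 2` at `𝔪` (i.e. `H⁰_𝔪(M) = H¹_𝔪(M) = 0`, so `M = Γ_*(M̃)`),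
and locally free at every prime other than the irrelevant ideal. -/
structure IsBundleModule (M : Type) [AddCommGroup M] [Module (PolyS K n) M] : Prop where
  finite : Module.Finite (PolyS K n) M
  h0 : Subsingleton ((localCohomology (irrel K n) 0).obj (ModuleCat.of (PolyS K n) M))
  h1 : Subsingleton ((localCohomology (irrel K n) 1).obj (ModuleCat.of (PolyS K n) M))
  locFree : ∀ p : PrimeSpectrum (PolyS K n), p.asIdeal ≠ irrel K n →
    Module.Free (Localization.AtPrime p.asIdeal) (LocalizedModule p.asIdeal.primeCompl M)

/-- `M` represents a vector bundle of rank two on `ℙⁿ`. -/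
structure IsRankTwoBundleModule (M : Type) [AddCommGroup M] [Module (PolyS K n) M]
    extends IsBundleModule K n M : Prop where
  rank2 : ∀ p : PrimeSpectrum (PolyS K n), p.asIdeal ≠ irrel K n →
    Module.rank (Localization.AtPrime p.asIdeal) (LocalizedModule p.asIdeal.primeCompl M) = 2

/-- A finite length module which is moreover supported at the irrelevant ideal: the
(ungraded avatar of the) notion of a *graded* `S`-module of finite length. -/
def IsGradedFiniteLength (N : Type) [AddCommGroup N] [Module (PolyS K n) N] : Prop :=
  IsFiniteLength (PolyS K n) N ∧
    ∃ c : ℕ, (irrel K n) ^ c ≤ Module.annihilator (PolyS K n) N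

open CategoryTheory TensorProduct
noncomputable section
namespace QS
open Polynomial

/-- Equivalence of vectors under the general linear group. -/
def VEq {R ι : Type*} [CommRing R] [Fintype ι] [DecidableEq ι] (f g : ι → R) : Prop :=
  ∃ M N : Matrix ι ι R, M * N = 1 ∧ N * M = 1 ∧ M.mulVec f = g

section basic
variable {R S ι : Type*} [CommRing R] [CommRing S] [Fintype ι] [DecidableEq ι]

theorem VEq.refl (f : ι → R) : VEq f f := ⟨1, 1, by simp, by simp, by simp⟩

theorem VEq.symm {f g : ι → R} (h : VEq f g) : VEq g f := by
  obtain ⟨M, N, h1, h2, h3⟩ := h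
  exact ⟨N, M, h2, h1, by rw [← h3, Matrix.mulVec_mulVec, h2, Matrix.one_mulVec]⟩

theorem VEq.trans {f g h : ι → R} (h1 : VEq f g) (h2 : VEq g h) : VEq f h := by
  obtain ⟨M, N, a1, a2, a3⟩ := h1
  obtain ⟨M', N', b1, b2, b3⟩ := h2
  refine ⟨M' * M, N * N', ?_, ?_, ?_⟩
  · calc M' * M * (N * N') = M' * (M * N) * N' := by simp only [mul_assoc]
      _ = 1 := by rw [a1, mul_one, b1]
  · calc N * N' * (M' * M) = N * (N' * M') * M := by simp only [mul_assoc]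
      _ = 1 := by rw [b2, mul_one, a2]
  · rw [← Matrix.mulVec_mulVec, a3, b3]

theorem VEq.map {f g : ι → R} (h : VEq f g) (φ : R →+* S) :
    VEq (fun i => φ (f i)) (fun i => φ (g i)) := by
  obtain ⟨M, N, h1, h2, h3⟩ := h
  refine ⟨φ.mapMatrix M, φ.mapMatrix N, ?_, ?_, ?_⟩
  · rw [← map_mul, h1, map_one]
  · rw [← map_mul, h2, map_one]
  · ext i
    have := congrArg φ (congrFun h3 i)
    rw [← this]
    simp [Matrix.mulVec, dotProduct]

/-- The basic elementary move. -/
theorem VEq.move (f u v : ι → R) (h : v ⬝ᵥ u = 0) : VEq f (f + (v ⬝ᵥ f) • u) := by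
  have hz : Matrix.vecMulVec u v * Matrix.vecMulVec u v = 0 := by
    rw [Matrix.vecMulVec_mul_vecMulVec, h]; ext; simp [Matrix.vecMulVec]
  refine ⟨1 + Matrix.vecMulVec u v, 1 - Matrix.vecMulVec u v, ?_, ?_, ?_⟩
  · simp [mul_sub, add_mul, hz]
  · simp [sub_mul, mul_add, hz]
  · rw [Matrix.add_mulVec, Matrix.one_mulVec, Matrix.vecMulVec_mulVec]
    ext; simp [mul_comm]

def Unimod (f : ι → R) : Prop := ∃ g : ι → R, g ⬝ᵥ f = 1

theorem Unimod.of_veq {f f' : ι → R} (h : VEq f f') (hf : Unimod f) : Unimod f' := by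
  obtain ⟨M, N, h1, h2, h3⟩ := h
  obtain ⟨g, hg⟩ := hf
  refine ⟨Matrix.vecMul g N, ?_⟩
  rw [← h3, ← Matrix.dotProduct_mulVec, Matrix.mulVec_mulVec, h2, Matrix.one_mulVec, hg]

theorem Unimod.map {f : ι → R} (h : Unimod f) (φ : R →+* S) : Unimod (fun i => φ (f i)) := by
  obtain ⟨g, hg⟩ := h
  refine ⟨fun i => φ (g i), ?_⟩
  rw [← map_one φ, ← hg]; simp [dotProduct]

theorem veq_single_of_one (f : ι → R) (i : ι) (h : f i = 1) : VEq f (Pi.single i 1) := by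
  have := VEq.move f (Pi.single i 1 - f) (Pi.single i 1) (by simp [h])
  simpa [h] using this

theorem veq_single_single (i j : ι) : VEq (Pi.single i (1 : R)) (Pi.single j 1) := by
  by_cases hij : i = j
  · subst hij; exact VEq.refl _
  have := VEq.move (Pi.single i (1 : R)) (Pi.single j 1) (Pi.single i 1) (by
    simp [Pi.single_apply, hij])
  refine this.trans (veq_single_of_one _ j ?_)
  simp [Pi.single_apply, Ne.symm hij]

theorem veq_smul_unit (f : ι → R) (a b : R) (h : a * b = 1) : VEq f (a • f) :=
  ⟨Matrix.diagonal fun _ => a, Matrix.diagonal fun _ => b, by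
    rw [Matrix.diagonal_mul_diagonal, h, Matrix.diagonal_one], by
    rw [Matrix.diagonal_mul_diagonal, mul_comm, h, Matrix.diagonal_one], by
    ext i; simp [Matrix.mulVec_diagonal]⟩

theorem veq_single_of_unit (f : ι → R) (i : ι) (h : IsUnit (f i)) : VEq f (Pi.single i 1) := by
  obtain ⟨u, hu⟩ := h
  refine (veq_smul_unit f (↑u⁻¹) u (by simp)).trans (veq_single_of_one _ i ?_)
  simp [← hu]

end basic

section horrocks
variable {A : Type*} [CommRing A]

theorem exists_monic_lower (f g : A[X]) (d : ℕ) (hf : f.Monic) (hd : f.natDegree = d + 1)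
    (hg : g.natDegree ≤ d) (e : ℕ) (he : e ≤ d) (hu : IsUnit (g.coeff e)) :
    ∃ h ∈ Ideal.span {f, g}, h.natDegree ≤ d ∧ h.coeff d = 1 := by
  set I := Ideal.span {f, g} with hI
  have hfI : f ∈ I := Ideal.subset_span (by simp)
  have hgI : g ∈ I := Ideal.subset_span (by simp)
  have hfc : f.coeff (d + 1) = 1 := by rw [← hd]; exact hf
  have key : ∀ t : ℕ, ∀ q ∈ I, q.natDegree ≤ d → t ≤ d →
      ∃ h ∈ I, h.natDegree ≤ d ∧ h.coeff d = q.coeff (d - t) := by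
    intro t
    induction t with
    | zero => intro q hq hqd _; exact ⟨q, hq, hqd, by simp⟩
    | succ t ih =>
      intro q hq hqd ht
      set r := X * q - C (q.coeff d) * f with hr
      have hrI : r ∈ I := I.sub_mem (I.mul_mem_left _ hq) (I.mul_mem_left _ hfI)
      have hrd : r.natDegree ≤ d := by
        rw [natDegree_le_iff_coeff_eq_zero]
        intro N hN
        obtain ⟨N, rfl⟩ : ∃ N', N = N' + 1 := ⟨N - 1, by omega⟩
        rw [hr, coeff_sub, coeff_X_mul, coeff_C_mul]
        rcases Nat.lt_or_ge d N with h | h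
        · rw [coeff_eq_zero_of_natDegree_lt (by omega : q.natDegree < N),
            coeff_eq_zero_of_natDegree_lt (by omega : f.natDegree < N + 1)]; simp
        · have : N = d := by omega
          subst this; rw [hfc]; ring
      obtain ⟨h, hh, hhd, hhc⟩ := ih r hrI hrd (by omega)
      refine ⟨h + C (f.coeff (d - t)) * q, I.add_mem hh (I.mul_mem_left _ hq), ?_, ?_⟩
      · refine (natDegree_add_le _ _).trans (max_le hhd ((natDegree_C_mul_le _ _).trans hqd))
      · rw [coeff_add, hhc, coeff_C_mul, hr, coeff_sub, coeff_C_mul]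
        obtain ⟨s, hs⟩ : ∃ s, d - t = s + 1 := ⟨d - t - 1, by omega⟩
        rw [hs, coeff_X_mul, show d - (t + 1) = s by omega]; ring
  obtain ⟨h, hh, hhd, hhc⟩ := key (d - e) g hgI hg (by omega)
  obtain ⟨u, hu⟩ := hu
  refine ⟨C (↑u⁻¹) * h, I.mul_mem_left _ hh, (natDegree_C_mul_le _ _).trans hhd, ?_⟩
  rw [coeff_C_mul, hhc, show d - (d - e) = e by omega, ← hu]; simp

theorem horrocks_local [IsLocalRing A] {ι : Type*} [Fintype ι] [DecidableEq ι]
    (hι : 3 ≤ Fintype.card ι) (d : ℕ) : ∀ (f : ι → A[X]) (i : ι), Unimod f → (f i).Monic →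
    (f i).natDegree = d → ∃ j, VEq f (Pi.single j 1) := by
  induction d with
  | zero =>
    intro f i _ hm hd
    exact ⟨i, veq_single_of_one f i (hm.natDegree_eq_zero.1 hd)⟩
  | succ d ih =>
    intro f i hf hm hd
    -- reduce
    let u : ι → A[X] := fun j => if j = i then 0 else -(f j /ₘ f i)
    have h1 := VEq.move f u (Pi.single i 1) (by simp [u])
    set f' := f + (Pi.single i 1 ⬝ᵥ f) • u with hf'
    have hi' : f' i = f i := by simp [hf', u]
    have hj' : ∀ j, j ≠ i → (f' j).natDegree ≤ d := by
      intro j hj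
      have : f' j = f j %ₘ f i := by
        simp [hf', u, hj]
        rw [← sub_eq_add_neg, modByMonic_eq_sub_mul_div]
      rw [this]
      have := natDegree_modByMonic_lt (f j) hm (by rintro h; rw [h] at hd; simp at hd)
      omega
    have huf := Unimod.of_veq h1 hf
    suffices ∃ j, VEq f' (Pi.single j 1) by
      obtain ⟨j, hj⟩ := this; exact ⟨j, h1.trans hj⟩
    rw [← hi'] at hm hd
    clear_value f'
    clear h1 hf' hf hi'
    -- a unit coefficient
    have : ∃ j, j ≠ i ∧ ∃ e ≤ d, IsUnit ((f' j).coeff e) := by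
      by_contra hcon
      push Not at hcon
      obtain ⟨g, hg⟩ := huf
      let φ := mapRingHom (IsLocalRing.residue A)
      have h0 : ∀ j, j ≠ i → φ (f' j) = 0 := by
        intro j hj
        ext e
        simp only [φ, coe_mapRingHom, coeff_map, coeff_zero]
        rcases Nat.lt_or_ge d e with h | h
        · rw [coeff_eq_zero_of_natDegree_lt (lt_of_le_of_lt (hj' j hj) h), map_zero]
        · rw [IsLocalRing.residue_eq_zero_iff]
          exact hcon j hj e h
      have := congrArg φ hg
      rw [dotProduct, map_sum, Finset.sum_eq_single i (by
        intro j _ hj; rw [map_mul, h0 j hj, mul_zero]) (by simp), map_mul, map_one] at this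
      have hu : IsUnit (φ (f' i)) := IsUnit.of_mul_eq_one _ (by rwa [mul_comm] at this)
      have hmm : (φ (f' i)).Monic := hm.map _
      have := hmm.isUnit_iff.1 hu
      have h2 : (φ (f' i)).natDegree = d + 1 := by
        rw [← hd]; exact hm.natDegree_map _
      rw [this] at h2; simp at h2
    obtain ⟨j, hji, e, he, hue⟩ := this
    obtain ⟨l, hl⟩ : ∃ l : ι, l ∉ ({i, j} : Finset ι) := by
      by_contra hcon
      push Not at hcon
      have := Finset.card_le_card (fun x _ => hcon x : (Finset.univ : Finset ι) ⊆ {i, j})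
      have h2 := Finset.card_le_two (a := i) (b := j)
      rw [Finset.card_univ] at this; omega
    simp only [Finset.mem_insert, Finset.mem_singleton, not_or] at hl
    obtain ⟨h, hh, hhd, hhc⟩ := exists_monic_lower (f' i) (f' j) d hm hd (hj' j hji) e he hue
    obtain ⟨a, b, hab⟩ := Ideal.mem_span_pair.1 hh
    set c : A[X] := C (1 - (f' l).coeff d) with hc
    have h2 := VEq.move f' (Pi.single l 1) (Pi.single i (c * a) + Pi.single j (c * b)) (by
      simp [Pi.single_apply, hl])
    set f2 := f' + ((Pi.single i (c * a) + Pi.single j (c * b)) ⬝ᵥ f') • Pi.single l 1 with hf2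
    have hl2 : f2 l = f' l + c * h := by
      simp [hf2, add_dotProduct, ← hab]; ring
    have hdeg : (f2 l).natDegree ≤ d := by
      rw [hl2]
      exact (natDegree_add_le _ _).trans (max_le (hj' l hl.1) ((natDegree_C_mul_le _ _).trans hhd))
    have hcoef : (f2 l).coeff d = 1 := by
      rw [hl2, coeff_add, hc, coeff_C_mul, hhc]; ring
    have hmon : (f2 l).Monic := monic_of_natDegree_le_of_coeff_eq_one d hdeg hcoef
    have hnd : (f2 l).natDegree = d := by
      nontriviality A
      exact le_antisymm hdeg (le_natDegree_of_ne_zero (by rw [hcoef]; exact one_ne_zero))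
    obtain ⟨j', hj'⟩ := ih f2 l (Unimod.of_veq h2 huf) hmon hnd
    exact ⟨j', h2.trans hj'⟩

end horrocks
end QS
end

open CategoryTheory TensorProduct
noncomputable section
namespace QS
open Polynomial

section patch
variable {A : Type*} [CommRing A]

/-- `X ↦ X + c Y`. -/
def shiftHom (c : A) : A[X] →+* A[X][X] :=
  eval₂RingHom (C.comp C) (C X + C (C c) * X)

@[simp] theorem shiftHom_X (c : A) : shiftHom c X = C X + C (C c) * X := by simp [shiftHom]
@[simp] theorem shiftHom_C (c a : A) : shiftHom c (C a) = C (C a) := by simp [shiftHom]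

/-- general substitution `X ↦ u`, `Y ↦ v`. -/
def subst {B : Type*} [CommRing B] (φ : A →+* B) (u v : B) : A[X][X] →+* B :=
  eval₂RingHom (eval₂RingHom φ u) v

@[simp] theorem subst_CX {B : Type*} [CommRing B] (φ : A →+* B) (u v : B) :
  subst φ u v (C X) = u := by simp [subst]
@[simp] theorem subst_CC {B : Type*} [CommRing B] (φ : A →+* B) (u v : B) (a : A) :
  subst φ u v (C (C a)) = φ a := by simp [subst]
@[simp] theorem subst_X {B : Type*} [CommRing B] (φ : A →+* B) (u v : B) :
  subst φ u v X = v := by simp [subst]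

variable {ι : Type*} [Fintype ι] [DecidableEq ι]

def patchIdeal (f : ι → A[X]) : Ideal A where
  carrier := {c | VEq (fun i => C (f i)) (fun i => shiftHom c (f i))}
  zero_mem' := by
    have : ∀ p : A[X], shiftHom (0 : A) p = C p := by
      intro p
      have : shiftHom (0 : A) = C := by
        apply Polynomial.ringHom_ext <;> simp
      rw [this]
    simp only [Set.mem_setOf_eq, this]; exact VEq.refl _
  add_mem' := by
    intro c d hc hd
    have h := hd.map (subst (C.comp C) (C X + C (C c) * X) (X : A[X][X]))
    have e1 : ∀ p : A[X], subst (C.comp C) (C X + C (C c) * X) (X : A[X][X]) (C p)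
        = shiftHom c p := by
      intro p; simp [subst, shiftHom]
    have e2 : ∀ p : A[X], subst (C.comp C) (C X + C (C c) * X) (X : A[X][X]) (shiftHom d p)
        = shiftHom (c + d) p := by
      intro p
      rw [← RingHom.comp_apply]; congr 1
      apply Polynomial.ringHom_ext
      · intro a; simp
      · simp; ring
    simp only [e1, e2] at h
    exact VEq.trans hc h
  smul_mem' := by
    intro a c hc
    have h := VEq.map hc (subst (C.comp C) (C X) (C (C a) * X : A[X][X]))
    have e1 : ∀ p : A[X], subst (C.comp C) (C X) (C (C a) * X : A[X][X]) (C p) = C p := by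
      intro p
      rw [← RingHom.comp_apply]; congr 1
      apply Polynomial.ringHom_ext
      · intro a; simp
      · simp
    have e2 : ∀ p : A[X], subst (C.comp C) (C X) (C (C a) * X : A[X][X]) (shiftHom c p)
        = shiftHom (a * c) p := by
      intro p
      rw [← RingHom.comp_apply]; congr 1
      apply Polynomial.ringHom_ext
      · intro a; simp
      · simp; ring
    simp only [e1, e2] at h
    exact h

theorem veq_const_of_patchIdeal (f : ι → A[X]) (h : patchIdeal f = ⊤) :
    VEq (fun i => C ((f i).coeff 0)) f := by
  have h1 : (1 : A) ∈ patchIdeal f := by rw [h]; trivial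
  have := VEq.map (h1 : VEq _ _) (subst C 0 (X : A[X]))
  have e1 : ∀ p : A[X], subst C 0 (X : A[X]) (C p) = C (p.coeff 0) := by
    intro p
    simp [subst, ← coeff_zero_eq_eval_zero, ← Polynomial.eval₂_at_apply]
  have e2 : ∀ p : A[X], subst C 0 (X : A[X]) (shiftHom 1 p) = p := by
    intro p
    rw [← RingHom.comp_apply]
    conv_rhs => rw [← RingHom.id_apply p]
    congr 1
    apply Polynomial.ringHom_ext <;> simp
  simp only [e1, e2] at this
  exact this

/-- Denominator lemma. -/
theorem exists_denom (P : Submonoid A) (L : Type*) [CommRing L] [Algebra A L] [IsLocalization P L]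
    {κ : Type*} [Finite κ] (g : κ → L[X][X]) :
    ∃ s ∈ P, ∀ k, ∃ q : A[X][X], mapRingHom (mapRingHom (algebraMap A L)) q
      = C (C (algebraMap A L s)) * g k := by
  cases nonempty_fintype κ
  letI : Algebra A[X] L[X] := (mapRingHom (algebraMap A L)).toAlgebra
  letI : Algebra A[X][X] L[X][X] := (mapRingHom (algebraMap A[X] L[X])).toAlgebra
  haveI h1 : IsLocalization (P.map (C : A →+* A[X])) L[X] := Polynomial.isLocalization P L
  haveI h2 : IsLocalization ((P.map (C : A →+* A[X])).map (C : A[X] →+* A[X][X])) L[X][X] :=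
    Polynomial.isLocalization _ _
  obtain ⟨b, hb⟩ := IsLocalization.exist_integer_multiples_of_finite
    ((P.map (C : A →+* A[X])).map (C : A[X] →+* A[X][X])) g
  obtain ⟨b, s', ⟨s, hs, rfl⟩, rfl⟩ := b
  refine ⟨s, hs, fun k => ?_⟩
  obtain ⟨q, hq⟩ := hb k
  refine ⟨q, ?_⟩
  change algebraMap A[X][X] L[X][X] q = _
  rw [hq, Algebra.smul_def]
  congr 1
  change mapRingHom (mapRingHom (algebraMap A L)) (C (C s)) = _
  simp

set_option maxHeartbeats 2000000 in
theorem exists_mem_patchIdeal [IsDomain A] (f : ι → A[X]) (S : Submonoid A) (hS : S ≤ nonZeroDivisors A)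
    (L : Type*) [CommRing L] [Algebra A L] [IsLocalization S L]
    (hf : ∃ c : ι → L, VEq (fun i => C (c i))
      (fun i => (f i).map (algebraMap A L))) :
    ∃ s ∈ S, s ∈ patchIdeal f := by
  obtain ⟨c, M, N, h1, h2, h3⟩ := hf
  have hinj : Function.Injective (algebraMap A L) :=
    IsLocalization.injective L hS
  let ψ := mapRingHom (mapRingHom (algebraMap A L))
  have hψ : Function.Injective ψ := by
    apply Polynomial.map_injective
    exact Polynomial.map_injective _ hinj
  -- the matrices G, G'
  let σ : L[X] →+* L[X][X] := shiftHom 1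
  let G : Matrix ι ι L[X][X] := σ.mapMatrix M * (C : L[X] →+* _).mapMatrix N
  let G' : Matrix ι ι L[X][X] := (C : L[X] →+* _).mapMatrix M * σ.mapMatrix N
  have hG1 : G * G' = 1 := by
    calc G * G' = σ.mapMatrix M * ((C : L[X] →+* _).mapMatrix N * (C : L[X] →+* _).mapMatrix M)
          * σ.mapMatrix N := by simp only [G, G', mul_assoc]
      _ = 1 := by rw [← map_mul, h2, map_one, mul_one, ← map_mul, h1, map_one]
  have hG2 : G' * G = 1 := by
    calc G' * G = (C : L[X] →+* _).mapMatrix M * (σ.mapMatrix N * σ.mapMatrix M)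
          * (C : L[X] →+* _).mapMatrix N := by simp only [G, G', mul_assoc]
      _ = 1 := by rw [← map_mul, h2, map_one, mul_one, ← map_mul, h1, map_one]
  -- value at Y = 0
  let ε : L[X][X] →+* L[X] := evalRingHom 0
  have hεσ : ε.comp σ = RingHom.id _ := by
    apply Polynomial.ringHom_ext <;> simp [ε, σ]
  have hεC : ε.comp C = RingHom.id _ := by
    ext <;> simp [ε]
  have hmm : ∀ (P : Matrix ι ι L[X]), ε.mapMatrix (σ.mapMatrix P) = P := by
    intro P; refine Matrix.ext fun i j => ?_
    simpa using congrArg (fun h => h (P i j)) hεσ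
  have hmm' : ∀ (P : Matrix ι ι L[X]), ε.mapMatrix ((C : L[X] →+* _).mapMatrix P) = P := by
    intro P; refine Matrix.ext fun i j => ?_
    simpa using congrArg (fun h => h (P i j)) hεC
  have hε1 : ε.mapMatrix G = 1 := by
    simp only [G]; rw [map_mul, hmm, hmm', h1]
  have hε2 : ε.mapMatrix G' = 1 := by
    simp only [G']; rw [map_mul, hmm, hmm', h1]
  have hdiv : ∀ P : Matrix ι ι L[X][X], ε.mapMatrix P = 1 → ∃ Q : Matrix ι ι L[X][X],
      ∀ i j, P i j = (1 : Matrix ι ι L[X][X]) i j + X * Q i j := by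
    intro P hP
    refine ⟨Matrix.of fun i j => divX (P i j), fun i j => ?_⟩
    have h0 : (P i j).coeff 0 = (1 : Matrix ι ι L[X]) i j := by
      rw [← hP, coeff_zero_eq_eval_zero]; rfl
    have h1 : (1 : Matrix ι ι L[X][X]) i j = C ((P i j).coeff 0) := by
      rw [h0, Matrix.one_apply, Matrix.one_apply]; split_ifs <;> simp
    rw [h1, Matrix.of_apply, add_comm, mul_comm, divX_mul_X_add]
  obtain ⟨Q, hQ⟩ := hdiv G hε1
  obtain ⟨Q', hQ'⟩ := hdiv G' hε2
  obtain ⟨s, hs, hsq⟩ := exists_denom S L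
    (fun k : (ι × ι) ⊕ (ι × ι) => Sum.elim (fun k => Q k.1 k.2) (fun k => Q' k.1 k.2) k)
  choose q hq using hsq
  -- substitution Y ↦ s Y on both levels
  let τ : A[X][X] →+* A[X][X] := subst (C.comp C) (C X) (C (C s) * X)
  let τ' : L[X][X] →+* L[X][X] := subst (C.comp C) (C X) (C (C (algebraMap A L s)) * X)
  have hτ : ∀ x, ψ (τ x) = τ' (ψ x) := by
    intro x
    rw [← RingHom.comp_apply, ← RingHom.comp_apply]; congr 1
    apply Polynomial.ringHom_ext'
    · apply Polynomial.ringHom_ext <;> intros <;> simp [ψ, τ, τ']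
    · simp [ψ, τ, τ']
  let Nm : Matrix ι ι A[X][X] := Matrix.of fun i j => (1 : Matrix ι ι A[X][X]) i j + X * τ (q (Sum.inl (i, j)))
  let Nm' : Matrix ι ι A[X][X] := Matrix.of fun i j => (1 : Matrix ι ι A[X][X]) i j + X * τ (q (Sum.inr (i, j)))
  have h1map : ∀ i j, ψ ((1 : Matrix ι ι A[X][X]) i j) = (1 : Matrix ι ι L[X][X]) i j := by
    intro i j
    by_cases hij : i = j
    · subst hij; simp
    · simp [hij]
  have h1map' : ∀ i j, τ' ((1 : Matrix ι ι L[X][X]) i j) = (1 : Matrix ι ι L[X][X]) i j := by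
    intro i j
    by_cases hij : i = j
    · subst hij; simp
    · simp [hij]
  have hτCC : ∀ a, τ' (C (C a)) = C (C a) := by intro a; simp [τ']
  have hN : ψ.mapMatrix Nm = τ'.mapMatrix G := by
    refine Matrix.ext fun i j => ?_
    simp only [RingHom.mapMatrix_apply, Matrix.map_apply, Matrix.of_apply, Nm, hQ, map_add, map_mul, h1map, h1map',
      hτ]
    have := hq (Sum.inl (i, j))
    simp only [Sum.elim_inl] at this
    rw [show ψ (q (Sum.inl (i, j))) = _ from this, map_mul, hτCC]
    simp [ψ, τ']; ring
  have hN' : ψ.mapMatrix Nm' = τ'.mapMatrix G' := by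
    refine Matrix.ext fun i j => ?_
    simp only [RingHom.mapMatrix_apply, Matrix.map_apply, Matrix.of_apply, Nm', hQ', map_add, map_mul, h1map, h1map',
      hτ]
    have := hq (Sum.inr (i, j))
    simp only [Sum.elim_inr] at this
    rw [show ψ (q (Sum.inr (i, j))) = _ from this, map_mul, hτCC]
    simp [ψ, τ']; ring
  have hψM : Function.Injective (ψ.mapMatrix : Matrix ι ι A[X][X] →+* _) :=
    fun P Q h => by
      refine Matrix.ext fun i j => ?_
      exact hψ (congrFun (congrFun h i) j)
  have hvec : G.mulVec (fun i => C ((f i).map (algebraMap A L)))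
      = fun i => σ ((f i).map (algebraMap A L)) := by
    have hc : (fun i => C ((f i).map (algebraMap A L)))
        = ((C : L[X] →+* _).mapMatrix M).mulVec (fun i => C (C (c i))) := by
      ext i : 1
      rw [← congrFun h3 i]
      simp [Matrix.mulVec, dotProduct]
    have hc2 : (fun i => σ ((f i).map (algebraMap A L)))
        = (σ.mapMatrix M).mulVec (fun i => C (C (c i))) := by
      ext i : 1
      rw [← congrFun h3 i]
      simp [Matrix.mulVec, dotProduct, σ]
    have hGM : G * (C : L[X] →+* _).mapMatrix M = σ.mapMatrix M := by
      simp only [G]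
      rw [mul_assoc, ← map_mul, h2, map_one, mul_one]
    rw [hc, hc2, Matrix.mulVec_mulVec, hGM]
  refine ⟨s, hs, ?_⟩
  change VEq _ _
  refine ⟨Nm, Nm', ?_, ?_, ?_⟩
  · apply hψM; rw [map_mul, hN, hN', ← map_mul, hG1, map_one, map_one]
  · apply hψM; rw [map_mul, hN, hN', ← map_mul, hG2, map_one, map_one]
  · ext i : 1
    apply hψ
    have e : ψ (Nm.mulVec (fun i => C (f i)) i)
        = (ψ.mapMatrix Nm).mulVec (fun i => ψ (C (f i))) i := by
      simp [Matrix.mulVec, dotProduct]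
    rw [e, hN]
    have e2 : (fun i => ψ (C (f i))) = fun i => τ' (C ((f i).map (algebraMap A L))) := by
      ext i : 1
      have : τ'.comp C = C := by
        apply Polynomial.ringHom_ext <;> simp [τ']
      have h := congrArg (fun h => h ((f i).map (algebraMap A L))) this
      simp only [RingHom.comp_apply] at h
      rw [h]; simp [ψ]
    rw [e2]
    have e3 : (τ'.mapMatrix G).mulVec (fun i => τ' (C ((f i).map (algebraMap A L)))) i
        = τ' (G.mulVec (fun i => C ((f i).map (algebraMap A L))) i) := by
      simp [Matrix.mulVec, dotProduct]
    rw [e3, hvec]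
    have : (τ'.comp σ).comp (mapRingHom (algebraMap A L)) = ψ.comp (shiftHom s) := by
      apply Polynomial.ringHom_ext <;> intros <;> simp [τ', σ, ψ]
    exact congrArg (fun h => h (f i)) this

theorem veq_const_of_monic [IsDomain A] (hι : 3 ≤ Fintype.card ι) (f : ι → A[X]) (i : ι)
    (hf : Unimod f) (hm : (f i).Monic) : VEq (fun i => C ((f i).coeff 0)) f := by
  apply veq_const_of_patchIdeal
  by_contra hne
  obtain ⟨p, hp, hle⟩ := Ideal.exists_le_maximal _ hne
  haveI := hp.isPrime
  obtain ⟨s, hs, hs'⟩ := exists_mem_patchIdeal f p.primeCompl p.primeCompl_le_nonZeroDivisors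
    (Localization.AtPrime p) (by
    obtain ⟨j, hj⟩ := horrocks_local (A := Localization.AtPrime p) hι _
      (fun i => (mapRingHom (algebraMap A (Localization.AtPrime p))) (f i)) i
      (hf.map _) (hm.map _) rfl
    refine ⟨Pi.single j 1, ?_⟩
    have : (fun i => C ((Pi.single j 1 : ι → Localization.AtPrime p) i)) = Pi.single j 1 := by
      ext k : 1
      by_cases h : k = j
      · subst h; simp
      · simp [h]
    rw [this]
    exact hj.symm)
  exact hs (hle hs')

end patch
end QS
end

open CategoryTheory TensorProduct
noncomputable section
namespace QSN
open Polynomial MvPolynomial Ideal Nat RingHom List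
variable {k : Type*} [Field k] {n : ℕ} (f : MvPolynomial (Fin (n + 1)) k)
variable (v w : Fin (n + 1) →₀ ℕ)
variable {f v} in
lemma lt_up (vlt : ∀ i, v i < (2 + f.totalDegree)) : ∀ l ∈ ofFn v, l < (2 + f.totalDegree) := by
  grind


/-- We construct an algebra map `T1 f c` which maps `X_i` into `X_i + c • X_0 ^ r_i` when `i ≠ 0`
and `X_0` to `X_0`. -/
abbrev T1 (c : k) :
    MvPolynomial (Fin (n + 1)) k →ₐ[k] MvPolynomial (Fin (n + 1)) k :=
  aeval fun i ↦ if i = 0 then X 0 else X i + c • X 0 ^ (2 + f.totalDegree) ^ (Fin.val (i))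

lemma t1_comp_t1_neg (c : k) : (T1 f c).comp (T1 f (-c)) = AlgHom.id _ _ := by
  rw [comp_aeval, ← MvPolynomial.aeval_X_left]
  ext i v
  cases i using Fin.cases <;> simp

/-- `T1 f 1` leads to an algebra equiv `T f`. -/
abbrev T := AlgEquiv.ofAlgHom (T1 f 1) (T1 f (-1))
  (t1_comp_t1_neg f 1) (by simpa using t1_comp_t1_neg f (-1))

lemma sum_r_mul_ne (vlt : ∀ i, v i < (2 + f.totalDegree)) (wlt : ∀ i, w i < (2 + f.totalDegree)) (ne : v ≠ w) :
    ∑ x : Fin (n + 1), (2 + f.totalDegree) ^ (Fin.val (x)) * v x ≠ ∑ x : Fin (n + 1), (2 + f.totalDegree) ^ (Fin.val (x)) * w x := by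
  intro h
  refine ne <| Finsupp.ext <| congrFun <| ofFn_inj.mp ?_
  apply ofDigits_inj_of_len_eq (Nat.lt_add_right f.totalDegree one_lt_two)
    (by simp) (lt_up vlt) (lt_up wlt)
  simpa only [ofDigits_eq_sum_mapIdx, mapIdx_eq_ofFn, get_ofFn, length_ofFn,
    Fin.val_cast, mul_comm, sum_ofFn] using! h

lemma degreeOf_zero_t {a : k} (ha : a ≠ 0) : ((T f) (monomial v a)).degreeOf 0 =
    ∑ i : Fin (n + 1), ((2 + f.totalDegree) ^ (Fin.val (i))) * v i := by
  rw [← natDegree_finSuccEquiv, monomial_eq, Finsupp.prod_pow v fun a ↦ X a]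
  simp only [Fin.prod_univ_succ, Fin.sum_univ_succ, map_mul, map_prod, map_pow,
    AlgEquiv.ofAlgHom_apply, MvPolynomial.aeval_C, MvPolynomial.aeval_X, if_pos, Fin.succ_ne_zero,
    ite_false, one_smul, map_add, finSuccEquiv_X_zero, finSuccEquiv_X_succ, algebraMap_eq]
  have h (i : Fin n) :
      (Polynomial.C (X (R := k) i) + Polynomial.X ^ (2 + f.totalDegree) ^ (Fin.val (i.succ))) ^ v i.succ ≠ 0 :=
    pow_ne_zero (v i.succ) (leadingCoeff_ne_zero.mp <| by simp [add_comm, leadingCoeff_X_pow_add_C])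
  rw [natDegree_mul (by simp [ha]) (mul_ne_zero (by simp) (Finset.prod_ne_zero_iff.mpr
    (fun i _ ↦ h i))), natDegree_mul (by simp) (Finset.prod_ne_zero_iff.mpr (fun i _ ↦ h i)),
    natDegree_prod _ _ (fun i _ ↦ h i), natDegree_finSuccEquiv, degreeOf_C]
  simpa only [natDegree_pow, zero_add, natDegree_X, mul_one, Fin.val_zero, pow_zero, one_mul,
    add_right_inj] using Finset.sum_congr rfl (fun i _ ↦ by
    rw [add_comm (Polynomial.C _), natDegree_X_pow_add_C, mul_comm])

/-- `T` maps different monomials of `f` to polynomials with different degrees in `X_0`. -/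
lemma degreeOf_t_ne_of_ne (hv : v ∈ f.support) (hw : w ∈ f.support) (ne : v ≠ w) :
    (T f <| monomial v <| coeff v f).degreeOf 0 ≠
    (T f <| monomial w <| coeff w f).degreeOf 0 := by
  rw [degreeOf_zero_t _ _ <| mem_support_iff.mp hv, degreeOf_zero_t _ _ <| mem_support_iff.mp hw]
  refine sum_r_mul_ne f v w (fun i ↦ ?_) (fun i ↦ ?_) ne <;>
  exact lt_of_le_of_lt ((monomial_le_degreeOf i ‹_›).trans (degreeOf_le_totalDegree f i))
    (by lia)

lemma leadingCoeff_finSuccEquiv_t :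
    (finSuccEquiv k n ((T f) ((monomial v) (coeff v f)))).leadingCoeff =
    algebraMap k _ (coeff v f) := by
  rw [monomial_eq, Finsupp.prod_fintype]
  · simp only [map_mul, map_prod, leadingCoeff_mul, leadingCoeff_prod]
    rw [AlgEquiv.ofAlgHom_apply, algHom_C, algebraMap_eq, finSuccEquiv_apply,
      eval₂Hom_C, coe_comp]
    simp only [AlgEquiv.ofAlgHom_apply, Function.comp_apply, leadingCoeff_C, map_pow,
      leadingCoeff_pow, algebraMap_eq]
    have : ∀ j, ((finSuccEquiv k n) ((T1 f) 1 (X j))).leadingCoeff = 1 := fun j ↦ by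
      by_cases h : j = 0
      · simp [h, finSuccEquiv_apply]
      · simp only [aeval_eq_bind₁, bind₁_X_right, if_neg h, one_smul, map_add, map_pow]
        obtain ⟨i, rfl⟩ := Fin.exists_succ_eq.mpr h
        simp [finSuccEquiv_X_succ, finSuccEquiv_X_zero, add_comm]
    simp only [this, one_pow, Finset.prod_const_one, mul_one]
  exact fun i ↦ pow_zero _

/-- `T` maps `f` into some polynomial in `X_0` such that the leading coefficient is invertible. -/
lemma T_leadingcoeff_isUnit (fne : f ≠ 0) :
    IsUnit (finSuccEquiv k n (T f f)).leadingCoeff := by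
  obtain ⟨v, vin, vs⟩ := Finset.exists_max_image f.support
    (fun v ↦ (T f ((monomial v) (coeff v f))).degreeOf 0) (support_nonempty.mpr fne)
  set h := fun w ↦ (MvPolynomial.monomial w) (coeff w f)
  simp only [← natDegree_finSuccEquiv] at vs
  replace vs : ∀ x ∈ f.support \ {v}, (finSuccEquiv k n ((T f) (h x))).degree <
      (finSuccEquiv k n ((T f) (h v))).degree := by
    intro x hx
    obtain ⟨h1, h2⟩ := Finset.mem_sdiff.mp hx
    apply degree_lt_degree <| lt_of_le_of_ne (vs x h1) ?_
    simpa only [natDegree_finSuccEquiv]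
      using degreeOf_t_ne_of_ne f _ _ h1 vin <| ne_of_not_mem_cons h2
  have coeff : (finSuccEquiv k n ((T f) (h v + ∑ x ∈ f.support \ {v}, h x))).leadingCoeff =
      (finSuccEquiv k n ((T f) (h v))).leadingCoeff := by
    simp only [map_add, map_sum]
    rw [add_comm]
    apply leadingCoeff_add_of_degree_lt <| (lt_of_le_of_lt <| degree_sum_le _ _) ?_
    have h2 : h v ≠ 0 := by simpa [h] using mem_support_iff.mp vin
    replace h2 : (finSuccEquiv k n ((T f) (h v))) ≠ 0 := fun eq ↦ h2 <|
      by simpa only [map_eq_zero_iff _ (AlgEquiv.injective _)] using eq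
    exact (Finset.sup_lt_iff <| Ne.bot_lt (fun x ↦ h2 <| degree_eq_bot.mp x)).mpr vs
  nth_rw 2 [← f.support_sum_monomial_coeff]
  rw [Finset.sum_eq_add_sum_sdiff_singleton_of_mem vin h]
  rw [leadingCoeff_finSuccEquiv_t] at coeff
  simpa only [coeff, algebraMap_eq] using (mem_support_iff.mp vin).isUnit.map MvPolynomial.C


end QSN
end

open CategoryTheory TensorProduct
noncomputable section
namespace QS
open MvPolynomial

theorem unimod_smul_unit {R : Type*} [CommRing R] {ι : Type*} [Fintype ι] [DecidableEq ι]
    {f : ι → R} (u : Rˣ) (hf : Unimod f) : Unimod (u.1 • f) := by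
  obtain ⟨g, hg⟩ := hf
  refine ⟨(u⁻¹).1 • g, ?_⟩
  simp [hg]

theorem quillen_suslin_row (K : Type) [Field K] {ι : Type} [Fintype ι] [DecidableEq ι]
    (hι : 3 ≤ Fintype.card ι) (n : ℕ) : ∀ f : ι → MvPolynomial (Fin n) K, Unimod f →
      ∃ j, VEq f (Pi.single j 1) := by
  induction n with
  | zero =>
    intro f hf
    have : ∃ i, f i ≠ 0 := by
      by_contra h
      push Not at h
      obtain ⟨g, hg⟩ := hf
      simp [dotProduct, h] at hg
    obtain ⟨i, hi⟩ := this
    refine ⟨i, veq_single_of_unit f i ?_⟩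
    · have h1 : f i = C ((f i).coeff 0) := MvPolynomial.eq_C_of_isEmpty _
      rw [h1]
      apply IsUnit.map
      rw [isUnit_iff_ne_zero]
      intro h0
      rw [h0, map_zero] at h1
      exact hi h1
  | succ n ih =>
    intro f hf
    have : ∃ i, f i ≠ 0 := by
      by_contra h
      push Not at h
      obtain ⟨g, hg⟩ := hf
      simp [dotProduct, h] at hg
    obtain ⟨i, hi⟩ := this
    let Φ : MvPolynomial (Fin (n+1)) K ≃+* Polynomial (MvPolynomial (Fin n) K) :=
      (QSN.T (f i)).toRingEquiv.trans (finSuccEquiv K n).toRingEquiv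
    have hu : IsUnit (Φ (f i)).leadingCoeff := QSN.T_leadingcoeff_isUnit (f i) hi
    obtain ⟨u, hu⟩ := hu
    let c : (Polynomial (MvPolynomial (Fin n) K))ˣ := Units.map Polynomial.C.toMonoidHom u⁻¹
    let g : ι → Polynomial (MvPolynomial (Fin n) K) := c.1 • fun j => Φ (f j)
    have hg : Unimod g := unimod_smul_unit c (hf.map Φ.toRingHom)
    have hm : (g i).Monic := by
      have : g i = Polynomial.C (u⁻¹).1 * Φ (f i) := rfl
      rw [this]
      apply Polynomial.monic_C_mul_of_mul_leadingCoeff_eq_one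
      rw [← hu]; simp
    have h1 := veq_const_of_monic hι g i hg hm
    have hg0 : Unimod (fun i => (g i).coeff 0) := by
      have := hg.map Polynomial.constantCoeff
      exact this
    obtain ⟨j, hj⟩ := ih _ hg0
    have h2 : VEq (fun i => Polynomial.C ((g i).coeff 0)) (fun k => Polynomial.C (Pi.single (M := fun _ => MvPolynomial (Fin n) K) j 1 k)) :=
      hj.map Polynomial.C
    have h3 : VEq (fun j => Φ (f j)) g := veq_smul_unit _ c.1 (c⁻¹).1 c.mul_inv
    have h4 := (h3.trans h1.symm).trans h2
    have h5 := h4.map Φ.symm.toRingHom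
    refine ⟨j, ?_⟩
    convert h5 using 1
    · ext k : 1; simp
    · ext k : 1
      by_cases h : k = j
      · subst h; simp
      · simp [h]
end QS
end

open CategoryTheory TensorProduct
noncomputable section
namespace GD
open Polynomial

section ses
variable {A : Type} [CommRing A]

def co {N : Type} [AddCommGroup N] [Module A N] : A[X] ⊗[A] N ≃ₗ[A] (ℕ →₀ N) :=
  TensorProduct.equivFinsuppOfBasisLeft (Polynomial.basisMonomials A)

theorem co_tmul {N : Type} [AddCommGroup N] [Module A N] (p : A[X]) (n : N) (i : ℕ) :
    co (p ⊗ₜ[A] n) i = p.coeff i • n := by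
  simp only [co, TensorProduct.equivFinsuppOfBasisLeft_apply_tmul_apply]
  rfl

theorem co_X_succ {N : Type} [AddCommGroup N] [Module A N] (x : A[X] ⊗[A] N) (i : ℕ) :
    co ((X : A[X]) • x) (i+1) = co x i := by
  induction x with
  | zero => simp
  | add x y hx hy => rw [smul_add, LinearEquiv.map_add, LinearEquiv.map_add, Finsupp.add_apply, hx, hy]; rfl
  | tmul p n => rw [TensorProduct.smul_tmul', co_tmul, co_tmul]; simp

theorem co_X_zero {N : Type} [AddCommGroup N] [Module A N] (x : A[X] ⊗[A] N) :
    co ((X : A[X]) • x) 0 = 0 := by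
  induction x with
  | zero => simp
  | add x y hx hy => rw [smul_add, map_add, Finsupp.add_apply, hx, hy, add_zero]
  | tmul p n => rw [TensorProduct.smul_tmul', co_tmul]; simp

theorem co_baseChange {N N' : Type} [AddCommGroup N] [Module A N] [AddCommGroup N'] [Module A N']
    (φ : N →ₗ[A] N') (x : A[X] ⊗[A] N) (i : ℕ) :
    co (φ.baseChange A[X] x) i = φ (co x i) := by
  induction x with
  | zero => simp
  | add x y hx hy => rw [map_add, map_add, map_add, Finsupp.add_apply, Finsupp.add_apply, hx, hy, map_add]
  | tmul p n => rw [LinearMap.baseChange_tmul, co_tmul, co_tmul]; simp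

theorem co_sum {N : Type} [AddCommGroup N] [Module A N] (x : A[X] ⊗[A] N) (m : ℕ)
    (hm : ∀ i, m ≤ i → co x i = 0) : x = ∑ i ∈ Finset.range m, (X ^ i : A[X]) ⊗ₜ[A] co x i := by
  apply co.injective
  ext i
  rw [map_sum, Finsupp.finset_sum_apply]
  simp only [co_tmul, Polynomial.coeff_X_pow, ite_smul, one_smul, zero_smul]
  rw [Finset.sum_ite_eq]
  split_ifs with h
  · rfl
  · exact hm i (by simpa using h)

theorem co_bound {N : Type} [AddCommGroup N] [Module A N] (x : A[X] ⊗[A] N) :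
    ∃ m, ∀ i, m ≤ i → co x i = 0 := by
  refine ⟨(co x).support.sup id + 1, fun i hi => ?_⟩
  by_contra h
  have : i ≤ (co x).support.sup id := Finset.le_sup (f := id) (Finsupp.mem_support_iff.mpr h)
  omega

variable {N : Type} [AddCommGroup N] [Module A N] [Module A[X] N] [IsScalarTower A A[X] N]
  (N' N'' : Submodule A N) (hle : N' ≤ N'') (hX : ∀ x ∈ N', (X : A[X]) • x ∈ N'')

def mulX : N' →ₗ[A] N'' where
  toFun x := ⟨(X : A[X]) • x.1, hX _ x.2⟩
  map_add' x y := by ext; simp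
  map_smul' a x := by
    ext
    simp only [SetLike.val_smul, RingHom.id_apply]
    rw [smul_comm]

def sesF : A[X] ⊗[A] N' →ₗ[A[X]] A[X] ⊗[A] N'' :=
  (X : A[X]) • (Submodule.inclusion hle).baseChange A[X] - (mulX N' N'' hX).baseChange A[X]

def sesG : A[X] ⊗[A] N'' →ₗ[A[X]] N := (N''.subtype).liftBaseChange A[X]

theorem sesF_succ (x) (i : ℕ) : (co (sesF N' N'' hle hX x) (i+1) : N) = co x i - (X : A[X]) • (co x (i+1) : N) := by
  simp only [sesF, LinearMap.sub_apply, LinearMap.smul_apply, map_sub, Finsupp.sub_apply, co_X_succ, co_baseChange]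
  rfl

theorem sesF_zero (x) : (co (sesF N' N'' hle hX x) 0 : N) = - (X : A[X]) • (co x 0 : N) := by
  simp only [sesF, LinearMap.sub_apply, LinearMap.smul_apply, map_sub, Finsupp.sub_apply, co_X_zero, co_baseChange]
  simp [mulX]

theorem ses_inj : Function.Injective (sesF N' N'' hle hX) := by
  rw [← LinearMap.ker_eq_bot, LinearMap.ker_eq_bot']
  intro x hx
  obtain ⟨m, hm⟩ := co_bound x
  have h : ∀ k i, m ≤ i + k → co x i = 0 := by
    intro k
    induction k with
    | zero => exact fun i hi => hm i hi
    | succ k ih =>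
      intro i hi
      have h1 := sesF_succ N' N'' hle hX x i
      rw [ih (i+1) (by omega), hx] at h1
      simp at h1
      exact Subtype.ext h1.symm
  apply co.injective
  ext i : 1
  rw [h m i (by omega)]; simp

theorem ses_comp (x) : sesG N'' (sesF N' N'' hle hX x) = 0 := by
  induction x with
  | zero => simp
  | add x y hx hy => simp [hx, hy]
  | tmul p n =>
    simp [sesF, sesG, mulX, TensorProduct.smul_tmul', smul_smul, mul_comm]

theorem sesG_eq (x) (m : ℕ) (hm : ∀ i, m ≤ i → co x i = 0) :
    sesG N'' x = ∑ i ∈ Finset.range m, (X ^ i : A[X]) • (co x i : N) := by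
  conv_lhs => rw [co_sum x m hm]
  simp [sesG]

theorem ses_exact (hcond : ∀ (i : ℕ) (l : ℕ → N), (∀ j, l j ∈ N'') → ∀ y : N,
      (X ^ (i+1) : A[X]) • y = ∑ j ∈ Finset.range (i+1), (X ^ j : A[X]) • l j → y ∈ N') :
    Function.Exact (sesF N' N'' hle hX) (sesG N'') := by
  intro x
  constructor
  swap
  · rintro ⟨y, rfl⟩; exact ses_comp _ _ _ _ _
  intro hx
  obtain ⟨m, hm⟩ := co_bound x
  rw [sesG_eq N'' x m hm] at hx
  -- l'_i = ∑_{j} X^j co x (i+1+j)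
  let l' : ℕ → N := fun i => ∑ j ∈ Finset.range (m - (i+1)), (X ^ j : A[X]) • (co x (i+1+j) : N)
  have hl0 : ∀ i, m ≤ i → l' i = 0 := by
    intro i hi
    simp only [l']
    rw [show m - (i+1) = 0 by omega]; simp
  have hlmem : ∀ i, l' i ∈ N' := by
    intro i
    by_cases hi : m ≤ i
    · rw [hl0 i hi]; exact zero_mem _
    apply hcond i (fun j => - (co x j : N)) (fun j => neg_mem (co x j).2)
    have h1 : m = (i+1) + (m - (i+1)) := by omega
    rw [h1, Finset.sum_range_add] at hx
    simp only [l', Finset.smul_sum, smul_smul, ← pow_add, smul_neg, Finset.sum_neg_distrib]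
    rw [eq_neg_iff_add_eq_zero, add_comm]
    exact hx
  have hrec : ∀ i, l' i = (co x (i+1) : N) + (X : A[X]) • l' (i+1) := by
    intro i
    by_cases hi : m ≤ i + 1
    · rw [hl0 (i+1) hi, hm _ hi]
      simp only [l']
      rw [show m - (i+1) = 0 by omega]; simp
    · simp only [l']
      rw [show m - (i+1) = (m - (i+1+1)) + 1 by omega, Finset.sum_range_succ']
      simp only [Finset.smul_sum, smul_smul, ← pow_succ', pow_zero, one_smul, add_zero]
      rw [add_comm]
      congr 1
      apply Finset.sum_congr rfl
      intro j _
      rw [show i + 1 + (j+1) = i + 1 + 1 + j by ring]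
  have hX0 : (co x 0 : N) + (X : A[X]) • l' 0 = 0 := by
    by_cases hm0 : m = 0
    · rw [hl0 0 (by omega), hm 0 (by omega)]; simp
    · rw [show m = (m - (0+1)) + 1 by omega, Finset.sum_range_succ'] at hx
      simp only [l', Finset.smul_sum, smul_smul, ← pow_succ']
      rw [add_comm]
      rw [← hx]
      simp [add_comm]
  let v : ℕ →₀ N' := Finsupp.onFinset (Finset.range m) (fun i => ⟨l' i, hlmem i⟩) (by
    intro i hi
    by_contra h
    apply hi
    ext
    exact hl0 i (by simpa using h))
  refine ⟨co.symm v, ?_⟩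
  apply co.injective
  ext i : 2
  cases i with
  | zero =>
    rw [sesF_zero, LinearEquiv.apply_symm_apply, neg_smul, neg_eq_iff_eq_neg, ← add_eq_zero_iff_eq_neg, add_comm]
    exact hX0
  | succ i =>
    rw [sesF_succ, LinearEquiv.apply_symm_apply, sub_eq_iff_eq_add]
    exact hrec i

theorem ses_surj (hspan : Submodule.span A[X] (N'' : Set N) = ⊤) :
    Function.Surjective (sesG N'' : _ →ₗ[A[X]] N) := by
  rw [← LinearMap.range_eq_top, eq_top_iff, ← hspan, Submodule.span_le]
  intro x hx
  exact ⟨1 ⊗ₜ ⟨x, hx⟩, by simp [sesG]⟩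

end ses
end GD
end

open CategoryTheory TensorProduct
noncomputable section
namespace GD
open Polynomial

def Cl (b : Bool) (R : Type) [CommRing R] (F : Type) [AddCommGroup F] [Module R F] : Prop :=
  if b then Module.Finite R F ∧ Module.Free R F else Module.Projective R F

section cl
variable {b : Bool} {R : Type} [CommRing R] {F G : Type} [AddCommGroup F] [Module R F]
  [AddCommGroup G] [Module R G]

theorem Cl.projective (h : Cl b R F) : Module.Projective R F := by
  cases b
  · simpa [Cl] using h
  · simp [Cl] at h; obtain ⟨h1, h2⟩ := h; infer_instance

theorem Cl.prod (h : Cl b R F) (h' : Cl b R G) : Cl b R (F × G) := by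
  cases b
  · simp [Cl] at *; infer_instance
  · simp [Cl] at *; obtain ⟨h1, h2⟩ := h; obtain ⟨h3, h4⟩ := h'; exact ⟨inferInstance, inferInstance⟩

theorem Cl.punit : Cl b R PUnit := by
  cases b
  · simp [Cl]; infer_instance
  · simp [Cl]; exact ⟨inferInstance, inferInstance⟩

theorem Cl.equiv (e : F ≃ₗ[R] G) (h : Cl b R F) : Cl b R G := by
  cases b
  · simp [Cl] at *; exact Module.Projective.of_equiv e
  · simp [Cl] at *; obtain ⟨h1, h2⟩ := h; exact ⟨Module.Finite.equiv e, Module.Free.of_equiv e⟩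

theorem Cl.baseChange (B : Type) [CommRing B] [Algebra R B] (h : Cl b R F) : Cl b B (B ⊗[R] F) := by
  cases b
  · simp [Cl] at *; infer_instance
  · simp [Cl] at *; obtain ⟨h1, h2⟩ := h; exact ⟨inferInstance, inferInstance⟩

theorem Cl.ring {A : Type} [CommRing A] [Module A F] (e : R ≃+* A) (he : ∀ r (x : F), e r • x = r • x)
    (h : Cl b A F) : Cl b R F := by
  letI σ : RingHomInvPair (e : R →+* A) (e.symm : A →+* R) := RingHomInvPair.of_ringEquiv e
  letI σ' : RingHomInvPair (e.symm : A →+* R) (e : R →+* A) := RingHomInvPair.of_ringEquiv e.symm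
  let E : F ≃ₛₗ[(e.symm : A →+* R)] F :=
    { toFun := id, invFun := id, left_inv := fun _ => rfl, right_inv := fun _ => rfl,
      map_add' := fun _ _ => rfl
      map_smul' := fun a x => by
        have := he (e.symm a) x
        simp at this
        simpa using this }
  cases b
  · simp [Cl] at *
    exact Module.Projective.of_ringEquiv E
  · simp [Cl] at *; obtain ⟨h1, h2⟩ := h
    exact ⟨Module.Finite.of_surjective (E : F →ₛₗ[(e.symm : A →+* R)] F) E.surjective, Module.Free.of_ringEquiv E⟩
end cl

def Res (b : Bool) (R : Type) [CommRing R] : ℕ → ∀ (M : Type) [AddCommGroup M] [Module R M], Prop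
  | 0, M, _, _ => Cl b R M
  | r+1, M, _, _ => ∃ (N F : Type) (_ : AddCommGroup N) (_ : Module R N) (_ : AddCommGroup F)
      (_ : Module R F) (g : N →ₗ[R] F) (f : F →ₗ[R] M), Cl b R F ∧ Function.Injective g ∧
      Function.Exact g f ∧ Function.Surjective f ∧ Res b R r N

section res
variable {b : Bool} {R : Type} [CommRing R]

theorem Res.equiv {r : ℕ} {M N : Type} [AddCommGroup M] [Module R M] [AddCommGroup N] [Module R N]
    (e : M ≃ₗ[R] N) (h : Res b R r M) : Res b R r N := by
  cases r with
  | zero => exact Cl.equiv e h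
  | succ r =>
    obtain ⟨K, F, _, _, _, _, g, f, h1, h2, h3, h4, h5⟩ := h
    refine ⟨K, F, _, _, _, _, g, e.toLinearMap ∘ₗ f, h1, h2, ?_, e.surjective.comp h4, h5⟩
    intro x
    rw [← h3 x]
    simp

theorem Res.punit (r : ℕ) : Res b R r PUnit := by
  cases r with
  | zero => exact Cl.punit
  | succ r =>
    refine ⟨PUnit, PUnit, inferInstance, inferInstance, inferInstance, inferInstance,
      LinearMap.id, LinearMap.id, Cl.punit, fun _ _ _ => rfl, fun x => by simp [Subsingleton.elim x 0], fun _ => ⟨0, rfl⟩, Res.punit r⟩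

theorem Res.succ {r : ℕ} : ∀ {M : Type} [AddCommGroup M] [Module R M], Res b R r M → Res b R (r+1) M := by
  induction r with
  | zero =>
    intro M _ _ h
    refine ⟨PUnit, M, inferInstance, inferInstance, inferInstance, inferInstance,
      0, LinearMap.id, h, fun _ _ _ => rfl, fun x => ?_, fun x => ⟨x, rfl⟩, Res.punit 0⟩
    simp [eq_comm]
  | succ r ih =>
    intro M _ _ h
    obtain ⟨K, F, _, _, _, _, g, f, h1, h2, h3, h4, h5⟩ := h
    exact ⟨K, F, _, _, _, _, g, f, h1, h2, h3, h4, ih h5⟩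

theorem Res.le {r s : ℕ} (hrs : r ≤ s) {M : Type} [AddCommGroup M] [Module R M] (h : Res b R r M) :
    Res b R s M := by
  induction hrs with
  | refl => exact h
  | step _ ih => exact ih.succ

def kerEquiv {M N F : Type} [AddCommGroup M] [Module R M] [AddCommGroup N] [Module R N]
    [AddCommGroup F] [Module R F] (g : N →ₗ[R] F) (f : F →ₗ[R] M) (hg : Function.Injective g)
    (h : Function.Exact g f) : N ≃ₗ[R] LinearMap.ker f :=
  (LinearEquiv.ofInjective g hg).trans (LinearEquiv.ofEq _ _ (by ext x; exact (h x).symm))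

theorem res_succ_iff {r : ℕ} {M : Type} [AddCommGroup M] [Module R M] :
    Res b R (r+1) M ↔ ∃ (F : Type) (_ : AddCommGroup F) (_ : Module R F) (f : F →ₗ[R] M),
      Cl b R F ∧ Function.Surjective f ∧ Res b R r (LinearMap.ker f) := by
  constructor
  · rintro ⟨K, F, _, _, _, _, g, f, h1, h2, h3, h4, h5⟩
    exact ⟨F, _, _, f, h1, h4, h5.equiv (kerEquiv g f h2 h3)⟩
  · rintro ⟨F, _, _, f, h1, h4, h5⟩
    exact ⟨_, F, _, _, _, _, (LinearMap.ker f).subtype, f, h1, Subtype.val_injective, fun x => by simp, h4, h5⟩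

theorem split_equiv {M' M M'' : Type} [AddCommGroup M'] [Module R M'] [AddCommGroup M]
    [Module R M] [AddCommGroup M''] [Module R M''] (i : M' →ₗ[R] M) (p : M →ₗ[R] M'')
    (hi : Function.Injective i) (hip : Function.Exact i p) (hp : Function.Surjective p)
    [Module.Projective R M''] : Nonempty ((M' × M'') ≃ₗ[R] M) := by
  obtain ⟨s, hs⟩ := Module.projective_lifting_property p LinearMap.id hp
  refine ⟨LinearEquiv.ofBijective (LinearMap.coprod i s) ⟨?_, ?_⟩⟩
  · rw [← LinearMap.ker_eq_bot, LinearMap.ker_eq_bot']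
    rintro ⟨a, c⟩ h
    have h0 : i a + s c = 0 := by simpa using h
    have h1 : p (i a) + p (s c) = 0 := by rw [← map_add, h0, map_zero]
    rw [hip.apply_apply_eq_zero, zero_add] at h1
    have h2 : p (s c) = c := congrArg (fun f => f c) hs
    have hc : c = 0 := by rw [← h2, h1]
    subst hc
    rw [map_zero, add_zero] at h0
    have : a = 0 := hi (by rw [h0, map_zero])
    rw [this]; rfl
  · intro x
    have h2 : p (s (p x)) = p x := congrArg (fun f => f (p x)) hs
    obtain ⟨a, ha⟩ := (hip (x - s (p x))).mp (by rw [map_sub, h2, sub_self])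
    exact ⟨(a, p x), by simp [ha]⟩

theorem res_mid {r : ℕ} : ∀ {M' M M'' : Type} [AddCommGroup M'] [Module R M'] [AddCommGroup M]
    [Module R M] [AddCommGroup M''] [Module R M''] (i : M' →ₗ[R] M) (p : M →ₗ[R] M'')
    (_ : Function.Injective i) (_ : Function.Exact i p) (_ : Function.Surjective p)
    (_ : Res b R r M') (_ : Res b R r M''), Res b R r M := by
  induction r with
  | zero =>
    intro M' M M'' _ _ _ _ _ _ i p hi hip hp h' h''
    haveI := Cl.projective h''
    obtain ⟨e⟩ := split_equiv i p hi hip hp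
    exact Cl.equiv e (Cl.prod h' h'')
  | succ r ih =>
    intro M' M M'' _ _ _ _ _ _ i p hi hip hp h' h''
    rw [res_succ_iff] at *
    obtain ⟨F', _, _, f', a1, a2, a3⟩ := h'
    obtain ⟨F'', _, _, f'', b1, b2, b3⟩ := h''
    haveI := Cl.projective b1
    obtain ⟨φ, hφ⟩ := Module.projective_lifting_property p f'' hp
    have hφ' : ∀ x, p (φ x) = f'' x := fun x => congrArg (fun f => f x) hφ
    let f : F' × F'' →ₗ[R] M := LinearMap.coprod (i ∘ₗ f') φ
    have hf : ∀ a c, f (a, c) = i (f' a) + φ c := fun a c => by simp [f]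
    refine ⟨F' × F'', inferInstance, inferInstance, f, a1.prod b1, ?_, ?_⟩
    · intro x
      obtain ⟨c, hc⟩ := b2 (p x)
      obtain ⟨m, hm⟩ := (hip (x - φ c)).mp (by rw [map_sub, hφ', hc, sub_self])
      obtain ⟨a, ha⟩ := a2 m
      exact ⟨(a, c), by rw [hf, ha, hm]; abel⟩
    · let u : LinearMap.ker f' →ₗ[R] LinearMap.ker f :=
        ((LinearMap.inl R F' F'').comp (LinearMap.ker f').subtype).codRestrict _ (by
          rintro ⟨x, hx⟩
          have hx : f' x = 0 := hx
          simp [f, hx])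
      let v : LinearMap.ker f →ₗ[R] LinearMap.ker f'' :=
        ((LinearMap.snd R F' F'').comp (LinearMap.ker f).subtype).codRestrict _ (by
          rintro ⟨⟨x, y⟩, hx⟩
          have hx : f (x, y) = 0 := hx
          have h3 := congrArg p hx
          rw [hf, map_add, hip.apply_apply_eq_zero, zero_add, hφ', map_zero] at h3
          simpa using h3)
      refine ih u v ?_ ?_ ?_ a3 b3
      · intro x y hxy
        have : (u x).1.1 = (u y).1.1 := by rw [hxy]
        exact Subtype.ext this
      · rintro ⟨⟨x, y⟩, hx⟩
        have hx : f (x, y) = 0 := hx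
        constructor
        · intro h
          have h : y = 0 := congrArg Subtype.val h
          subst h
          rw [hf, map_zero, add_zero] at hx
          have : f' x = 0 := hi (by rw [hx, map_zero])
          exact ⟨⟨x, this⟩, rfl⟩
        · rintro ⟨z, hz⟩
          have : y = 0 := (congrArg (fun t => t.1.2) hz).symm
          subst this
          rfl
      · rintro ⟨y, hy⟩
        have hy : f'' y = 0 := hy
        obtain ⟨m, hm⟩ := (hip (φ y)).mp (by rw [hφ', hy])
        obtain ⟨a, ha⟩ := a2 m
        refine ⟨⟨(-a, y), ?_⟩, rfl⟩
        change f (-a, y) = 0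
        rw [hf, map_neg, map_neg, ha, hm]; simp

theorem res_quot {r : ℕ} {M' M M'' : Type} [AddCommGroup M'] [Module R M'] [AddCommGroup M]
    [Module R M] [AddCommGroup M''] [Module R M''] (i : M' →ₗ[R] M) (p : M →ₗ[R] M'')
    (hi : Function.Injective i) (hip : Function.Exact i p) (hp : Function.Surjective p)
    (h' : Res b R r M') (h : Res b R (r+1) M) : Res b R (r+1) M'' := by
  rw [res_succ_iff] at *
  obtain ⟨F, _, _, f, a1, a2, a3⟩ := h
  refine ⟨F, _, _, p ∘ₗ f, a1, hp.comp a2, ?_⟩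
  let e := kerEquiv i p hi hip
  let u : LinearMap.ker f →ₗ[R] LinearMap.ker (p ∘ₗ f) := Submodule.inclusion (by
    intro x hx
    have hx : f x = 0 := hx
    simp [hx])
  let v : LinearMap.ker (p ∘ₗ f) →ₗ[R] LinearMap.ker p :=
    (f ∘ₗ (LinearMap.ker (p ∘ₗ f)).subtype).codRestrict _ (fun x => x.2)
  refine res_mid u v (Submodule.inclusion_injective _) ?_ ?_ a3 (h'.equiv e)
  · rintro ⟨x, hx⟩
    constructor
    · intro h
      exact ⟨⟨x, congrArg Subtype.val h⟩, rfl⟩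
    · rintro ⟨z, hz⟩
      rw [← hz]
      exact Subtype.ext z.2
  · rintro ⟨y, hy⟩
    obtain ⟨x, rfl⟩ := a2 y
    exact ⟨⟨x, hy⟩, rfl⟩

theorem Res.baseChange (B : Type) [CommRing B] [Algebra R B] [Module.Flat R B] {r : ℕ} :
    ∀ {M : Type} [AddCommGroup M] [Module R M], Res b R r M → Res b B r (B ⊗[R] M) := by
  induction r with
  | zero => intro M _ _ h; exact Cl.baseChange B h
  | succ r ih =>
    intro M _ _ h
    obtain ⟨K, F, _, _, _, _, g, f, h1, h2, h3, h4, h5⟩ := h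
    refine ⟨B ⊗[R] K, B ⊗[R] F, inferInstance, inferInstance, inferInstance, inferInstance,
      g.baseChange B, f.baseChange B, h1.baseChange B, ?_, ?_, ?_, ih h5⟩
    · exact Module.Flat.lTensor_preserves_injective_linearMap (M := B) g h2
    · exact lTensor_exact B h3 h4
    · exact LinearMap.lTensor_surjective B h4

theorem Res.ring {A : Type} [CommRing A] (e : R ≃+* A) {r : ℕ} :
    ∀ {M : Type} [AddCommGroup M] [Module R M] [Module A M] (_ : ∀ r (x : M), e r • x = r • x),
      Res b A r M → Res b R r M := by
  induction r with
  | zero => intro M _ _ _ he h; exact Cl.ring e he h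
  | succ r ih =>
    intro M _ _ _ he h
    obtain ⟨K, F, _, _, _, _, g, f, h1, h2, h3, h4, h5⟩ := h
    letI : Module R K := Module.compHom K (e : R →+* A)
    letI : Module R F := Module.compHom F (e : R →+* A)
    refine ⟨K, F, inferInstance, inferInstance, inferInstance, inferInstance,
      { toFun := g, map_add' := map_add g, map_smul' := fun a x => g.map_smul (e a) x },
      { toFun := f, map_add' := map_add f, map_smul' := fun a x => (f.map_smul (e a) x).trans (he _ _) },
      h1.ring e (fun _ _ => rfl), h2, h3, h4, ih (fun _ _ => rfl) h5⟩

end res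
end GD
end

open CategoryTheory TensorProduct
noncomputable section
namespace GD
open Polynomial

/-- all modules have projective resolutions of length r -/
theorem pd_poly {A : Type} [CommRing A] {r : ℕ}
    (h : ∀ (N : Type) [AddCommGroup N] [Module A N], Res false A r N)
    (N : Type) [AddCommGroup N] [Module A[X] N] : Res false A[X] (r+1) N := by
  letI : Module A N := Module.compHom N (C : A →+* A[X])
  haveI : IsScalarTower A A[X] N := ⟨fun a p x => by
    rw [Polynomial.smul_eq_C_mul, mul_smul]; rfl⟩
  have h1 := (h (⊤ : Submodule A N)).baseChange A[X]
  refine res_quot (sesF ⊤ ⊤ le_rfl (fun _ _ => trivial)) (sesG ⊤) (ses_inj _ _ _ _)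
    (ses_exact _ _ _ _ (fun _ _ _ _ _ => trivial)) (ses_surj _ ?_) h1 h1.succ
  simp

section
variable {A : Type} [CommRing A] [IsNoetherianRing A] {m : ℕ} (L : Submodule A[X] (Fin m → A[X]))

def Ld (d : ℕ) : Submodule A L :=
  (Submodule.pi Set.univ (fun _ : Fin m => degreeLT A d)).comap ((L.subtype).restrictScalars A)

theorem mem_Ld (d : ℕ) (x : L) : x ∈ Ld L d ↔ ∀ j, x.1 j ∈ degreeLT A d := by
  simp [Ld, Submodule.mem_pi]

theorem Ld_finite (d : ℕ) : Module.Finite A (Ld L d) := by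
  haveI : Module.Finite A (degreeLT A d) := Module.Finite.equiv (degreeLTEquiv A d).symm
  let f : Ld L d →ₗ[A] (Fin m → degreeLT A d) :=
    { toFun := fun x j => ⟨x.1.1 j, (mem_Ld L d _).mp x.2 j⟩
      map_add' := fun _ _ => rfl
      map_smul' := fun _ _ => rfl }
  refine Module.Finite.of_injective f ?_
  intro x y h
  ext j : 3
  exact congrArg Subtype.val (congrFun h j)

theorem Ld_mono {d e : ℕ} (h : d ≤ e) : Ld L d ≤ Ld L e := by
  intro x hx
  rw [mem_Ld] at *
  exact fun j => degreeLT_mono h (hx j)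

theorem ffr_sub (h : ∀ (N : Type) [AddCommGroup N] [Module A N], Module.Finite A N → ∃ r, Res true A r N) :
    ∃ r, Res true A[X] r L := by
  -- pick d
  have hspan : ∃ d, Submodule.span A[X] (Ld L (d+1) : Set L) = ⊤ := by
    obtain ⟨s, hs⟩ := (inferInstance : Module.Finite A[X] L)
    refine ⟨s.sup (fun x => Finset.univ.sup fun j => (x.1 j).natDegree), ?_⟩
    rw [eq_top_iff, ← hs, Submodule.span_le]
    intro x hx
    apply Submodule.subset_span
    rw [SetLike.mem_coe, mem_Ld]
    intro j
    rw [mem_degreeLT]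
    have h1 : (x.1 j).natDegree ≤ Finset.univ.sup fun j => (x.1 j).natDegree :=
      Finset.le_sup (f := fun j => (x.1 j).natDegree) (Finset.mem_univ j)
    have h2 := Finset.le_sup (f := fun x : L => Finset.univ.sup fun j => (x.1 j).natDegree) hx
    refine lt_of_le_of_lt degree_le_natDegree ?_
    exact_mod_cast Nat.lt_succ_of_le (h1.trans h2)
  obtain ⟨d, hd⟩ := hspan
  obtain ⟨r1, h1⟩ := h (Ld L d) (Ld_finite L d)
  obtain ⟨r2, h2⟩ := h (Ld L (d+1)) (Ld_finite L (d+1))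
  refine ⟨max r1 r2 + 1, ?_⟩
  refine res_quot (sesF (Ld L d) (Ld L (d+1)) (Ld_mono L (by omega)) ?_) (sesG _) (ses_inj _ _ _ _)
    (ses_exact _ _ _ _ ?_) (ses_surj _ hd) ((h1.baseChange A[X]).le (le_max_left _ _))
    ((h2.baseChange A[X]).le ((le_max_right r1 r2).trans (Nat.le_succ _)))
  · intro x hx
    rw [mem_Ld] at *
    intro j
    have := hx j
    rw [mem_degreeLT, degree_lt_iff_coeff_zero] at *
    intro k hk
    obtain ⟨k, rfl⟩ : ∃ k', k = k' + 1 := ⟨k - 1, by omega⟩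
    have h3 : ((X : A[X]) • x).1 j = X * x.1 j := rfl
    rw [h3, coeff_X_mul]
    exact this k (by omega)
  · intro i l hl y hy
    rw [mem_Ld]
    intro j
    rw [mem_degreeLT, degree_lt_iff_coeff_zero]
    intro k hk
    have h4 := congrArg (fun z : L => (z.1 j).coeff (k + (i+1))) hy
    have h5 : ((X ^ (i+1) : A[X]) • y).1 j = X ^ (i+1) * y.1 j := rfl
    beta_reduce at h4
    rw [h5, coeff_X_pow_mul] at h4
    rw [h4]
    have h6 : (∑ q ∈ Finset.range (i+1), (X ^ q : A[X]) • l q : L).1 j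
        = ∑ q ∈ Finset.range (i+1), X ^ q * (l q).1 j := by
      simp
    rw [h6, finset_sum_coeff]
    apply Finset.sum_eq_zero
    intro q hq
    have hq : q < i + 1 := by simpa using hq
    obtain ⟨t, ht⟩ : ∃ t, k + (i+1) = t + q := ⟨k + (i+1) - q, by omega⟩
    rw [ht, coeff_X_pow_mul]
    have h7 := (mem_Ld L _ _).mp (hl q) j
    rw [mem_degreeLT, degree_lt_iff_coeff_zero] at h7
    exact h7 t (by omega)
end

theorem ffr_poly {A : Type} [CommRing A] [IsNoetherianRing A]
    (h : ∀ (N : Type) [AddCommGroup N] [Module A N], Module.Finite A N → ∃ r, Res true A r N)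
    (M : Type) [AddCommGroup M] [Module A[X] M] (hM : Module.Finite A[X] M) :
    ∃ r, Res true A[X] r M := by
  obtain ⟨m, f, hf⟩ := Module.Finite.exists_fin' A[X] M
  obtain ⟨r, hr⟩ := ffr_sub (LinearMap.ker f) h
  exact ⟨r+1, res_succ_iff.mpr ⟨_, _, _, f, ⟨inferInstance, inferInstance⟩, hf, hr⟩⟩

theorem ffr_mv (K : Type) [Field K] (n : ℕ) : ∀ (M : Type) [AddCommGroup M]
    [Module (MvPolynomial (Fin n) K) M], Module.Finite (MvPolynomial (Fin n) K) M →
    ∃ r, Res true (MvPolynomial (Fin n) K) r M := by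
  induction n with
  | zero =>
    intro M _ _ h
    letI : Module K M := Module.compHom M (MvPolynomial.isEmptyRingEquiv K (Fin 0)).symm.toRingHom
    have he : ∀ r (x : M), MvPolynomial.isEmptyRingEquiv K (Fin 0) r • x = r • x := by
      intro r x
      change (MvPolynomial.isEmptyRingEquiv K (Fin 0)).symm _ • x = _
      rw [RingEquiv.symm_apply_apply]
    refine ⟨0, Res.ring (MvPolynomial.isEmptyRingEquiv K (Fin 0)) he ⟨?_, inferInstance⟩⟩
    obtain ⟨s, hs⟩ := h
    refine ⟨s, ?_⟩
    rw [eq_top_iff]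
    intro x _
    have hx : x ∈ Submodule.span (MvPolynomial (Fin 0) K) (s : Set M) := by rw [hs]; trivial
    induction hx using Submodule.span_induction with
    | mem x h => exact Submodule.subset_span h
    | zero => exact zero_mem _
    | add x y _ _ hx hy => exact add_mem (hx trivial) (hy trivial)
    | smul a x _ hx => rw [← he]; exact Submodule.smul_mem _ _ (hx trivial)
  | succ n ih =>
    intro M _ _ h
    let e := (MvPolynomial.finSuccEquiv K n).toRingEquiv
    letI : Module (Polynomial (MvPolynomial (Fin n) K)) M := Module.compHom M e.symm.toRingHom
    have he : ∀ r (x : M), e r • x = r • x := by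
      intro r x
      change e.symm _ • x = _
      simp
    have hfin : Module.Finite (Polynomial (MvPolynomial (Fin n) K)) M := by
      obtain ⟨s, hs⟩ := h
      refine ⟨s, ?_⟩
      rw [eq_top_iff]
      intro x _
      have hx : x ∈ Submodule.span (MvPolynomial (Fin (n+1)) K) (s : Set M) := by rw [hs]; trivial
      induction hx using Submodule.span_induction with
      | mem x h => exact Submodule.subset_span h
      | zero => exact zero_mem _
      | add x y _ _ hx hy => exact add_mem (hx trivial) (hy trivial)
      | smul a x _ hx => rw [← he]; exact Submodule.smul_mem _ _ (hx trivial)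
    obtain ⟨r, hr⟩ := ffr_poly ih M hfin
    exact ⟨r, hr.ring e he⟩

theorem pd_mv (K : Type) [Field K] (n : ℕ) : ∀ (M : Type) [AddCommGroup M]
    [Module (MvPolynomial (Fin n) K) M], Res false (MvPolynomial (Fin n) K) n M := by
  induction n with
  | zero =>
    intro M _ _
    letI : Module K M := Module.compHom M (MvPolynomial.isEmptyRingEquiv K (Fin 0)).symm.toRingHom
    have he : ∀ r (x : M), MvPolynomial.isEmptyRingEquiv K (Fin 0) r • x = r • x := by
      intro r x
      change (MvPolynomial.isEmptyRingEquiv K (Fin 0)).symm _ • x = _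
      rw [RingEquiv.symm_apply_apply]
    refine Res.ring (MvPolynomial.isEmptyRingEquiv K (Fin 0)) he (?_ : Module.Projective _ _)
    infer_instance
  | succ n ih =>
    intro M _ _
    let e := (MvPolynomial.finSuccEquiv K n).toRingEquiv
    letI : Module (Polynomial (MvPolynomial (Fin n) K)) M := Module.compHom M e.symm.toRingHom
    have he : ∀ r (x : M), e r • x = r • x := by
      intro r x
      change e.symm _ • x = _
      simp
    exact (pd_poly ih M).ring e he

/-- finite projective modules with finite free resolutions are stably free -/
theorem stably_free {R : Type} [CommRing R] (r : ℕ) : ∀ (P : Type) [AddCommGroup P] [Module R P]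
    [Module.Projective R P], Res true R r P → ∃ a c : ℕ, Nonempty ((P × (Fin a → R)) ≃ₗ[R] (Fin c → R)) := by
  induction r with
  | zero =>
    intro P _ _ _ h
    obtain ⟨h1, h2⟩ := h
    haveI := h1; haveI := h2
    let e := (Module.Free.chooseBasis R P).equivFun
    exact ⟨0, Fintype.card (Module.Free.ChooseBasisIndex R P), ⟨LinearEquiv.prodUnique.trans
      (e.trans (LinearEquiv.funCongrLeft R R (Fintype.equivFin _).symm))⟩⟩
  | succ r ih =>
    intro P _ _ _ h
    rw [res_succ_iff] at h
    obtain ⟨F, _, _, f, ⟨h1, h2⟩, h3, h4⟩ := h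
    haveI := h1; haveI := h2
    obtain ⟨e⟩ := split_equiv (LinearMap.ker f).subtype f Subtype.val_injective (fun x => by simp) h3
    haveI : Module.Projective R (LinearMap.ker f × P) := Module.Projective.of_equiv e.symm
    haveI : Module.Projective R (LinearMap.ker f) :=
      Module.Projective.of_split (LinearMap.inl R (LinearMap.ker f) P) (LinearMap.fst R _ _) (by ext; simp)
    obtain ⟨a, c, ⟨e'⟩⟩ := ih (LinearMap.ker f) h4
    let b := (Module.Free.chooseBasis R F).equivFun.trans
      (LinearEquiv.funCongrLeft R R (Fintype.equivFin (Module.Free.ChooseBasisIndex R F)).symm)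
    refine ⟨c, Fintype.card (Module.Free.ChooseBasisIndex R F) + a, ⟨?_⟩⟩
    let e2 : (P × LinearMap.ker f) ≃ₗ[R] _ := ((LinearEquiv.prodComm R P _).trans e).trans b
    let e3 : (P × (Fin c → R)) ≃ₗ[R] (P × (LinearMap.ker f × (Fin a → R))) :=
      (LinearEquiv.refl R P).prodCongr e'.symm
    let e4 : (P × (LinearMap.ker f × (Fin a → R))) ≃ₗ[R] ((P × LinearMap.ker f) × (Fin a → R)) :=
      (LinearEquiv.prodAssoc R _ _ _).symm
    let e5 := e2.prodCongr (LinearEquiv.refl R (Fin a → R))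
    exact ((e3.trans e4).trans e5).trans ((LinearEquiv.sumArrowLequivProdArrow _ _ R R).symm.trans
      (LinearEquiv.funCongrLeft R R finSumFinEquiv.symm))

theorem stably_free_mv (K : Type) [Field K] (n : ℕ) (P : Type) [AddCommGroup P]
    [Module (MvPolynomial (Fin n) K) P] [Module.Finite (MvPolynomial (Fin n) K) P]
    [Module.Projective (MvPolynomial (Fin n) K) P] :
    ∃ a c : ℕ, Nonempty ((P × (Fin a → MvPolynomial (Fin n) K)) ≃ₗ[MvPolynomial (Fin n) K] (Fin c → MvPolynomial (Fin n) K)) := by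
  obtain ⟨r, hr⟩ := ffr_mv K n P inferInstance
  exact stably_free r P hr

theorem pdlt_of_res {R : Type} [CommRing R] (r : ℕ) : ∀ (M : Type) [AddCommGroup M] [Module R M],
    Res false R r M → HasProjectiveDimensionLT (ModuleCat.of R M) (r+1) := by
  induction r with
  | zero =>
    intro M _ _ h
    haveI : Module.Projective R M := h.projective
    haveI : Projective (ModuleCat.of R M) := (IsProjective.iff_projective M).mp this
    infer_instance
  | succ r ih =>
    intro M _ _ h
    rw [res_succ_iff] at h
    obtain ⟨F, _, _, f, h1, h3, h4⟩ := h
    have hse : (ModuleCat.shortComplexOfCompEqZero (LinearMap.ker f).subtype f (by ext x; exact x.2)).ShortExact :=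
      { exact := ModuleCat.shortComplex_exact _ (LinearMap.exact_subtype_ker_map f)
        mono_f := (ModuleCat.mono_iff_injective _).mpr Subtype.val_injective
        epi_g := (ModuleCat.epi_iff_surjective _).mpr h3 }
    haveI : Module.Projective R F := h1.projective
    have : Projective (ModuleCat.of R F) := (IsProjective.iff_projective F).mp this
    haveI : HasProjectiveDimensionLT (ModuleCat.of R F) 1 := inferInstance
    exact hse.hasProjectiveDimensionLT_X₃ (r+1) (ih _ h4) (hasProjectiveDimensionLT_of_ge _ 1 _ (by omega))

theorem pdlt_mv (K : Type) [Field K] (n : ℕ) (M : Type) [AddCommGroup M]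
    [Module (MvPolynomial (Fin n) K) M] : HasProjectiveDimensionLT (ModuleCat.of (MvPolynomial (Fin n) K) M) (n+1) :=
  pdlt_of_res n M (pd_mv K n M)
end GD
end

open CategoryTheory TensorProduct
noncomputable section
namespace QS

theorem cancel_one (K : Type) [Field K] (n c : ℕ) (hc : 3 ≤ c) (P : Type) [AddCommGroup P]
    [Module (MvPolynomial (Fin n) K) P]
    (φ : (P × MvPolynomial (Fin n) K) ≃ₗ[MvPolynomial (Fin n) K] (Fin c → MvPolynomial (Fin n) K)) :
    Nonempty (P ≃ₗ[MvPolynomial (Fin n) K] (Fin (c-1) → MvPolynomial (Fin n) K)) := by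
  set R := MvPolynomial (Fin n) K
  have hu : Unimod (φ (0, 1)) := by
    let g : (Fin c → R) →ₗ[R] R := LinearMap.snd R P R ∘ₗ φ.symm.toLinearMap
    refine ⟨fun i => g (Pi.single i 1), ?_⟩
    have h1 : g (φ (0,1)) = 1 := by simp [g]
    refine Eq.trans ?_ h1
    refine Eq.trans ?_ (LinearMap.pi_apply_eq_sum_univ g (φ (0,1))).symm
    apply Finset.sum_congr rfl
    intro i _
    have h2 : (Pi.single i 1 : Fin c → R) = fun j => if i = j then 1 else 0 := by
      funext j
      simp [Pi.single_apply, eq_comm]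
    rw [smul_eq_mul, mul_comm]
    exact congrArg (fun t => φ (0,1) i * g t) h2
  obtain ⟨j, M, N, h1, h2, h3⟩ := quillen_suslin_row K (by simpa using hc) n _ hu
  let E : (Fin c → R) ≃ₗ[R] (Fin c → R) := LinearEquiv.ofLinear M.mulVecLin N.mulVecLin
    (by rw [← Matrix.mulVecLin_mul, h1, Matrix.mulVecLin_one])
    (by rw [← Matrix.mulVecLin_mul, h2, Matrix.mulVecLin_one])
  let ψ := φ.trans E
  have hψ : ∀ r : R, ψ (0, r) = Pi.single j r := by
    intro r
    have : ((0 : P), r) = r • ((0 : P), (1 : R)) := by simp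
    rw [this, map_smul]
    change r • M.mulVec (φ (0,1)) = _
    rw [h3]
    rw [← Pi.single_smul]
    simp
  let f : P →ₗ[R] ({k : Fin c // k ≠ j} → R) :=
    (LinearMap.funLeft R R (Subtype.val)) ∘ₗ ψ.toLinearMap ∘ₗ LinearMap.inl R P R
  have hf : ∀ p k, f p k = ψ (p, 0) k.1 := fun p k => rfl
  have hbij : Function.Bijective f := by
    constructor
    · rw [← LinearMap.ker_eq_bot, LinearMap.ker_eq_bot']
      intro p hp
      have : ψ (p, 0) = ψ (0, ψ (p, 0) j) := by
        rw [hψ]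
        ext1 k
        by_cases hk : k = j
        · subst hk; simp
        · rw [Pi.single_eq_of_ne hk]
          exact congrFun hp ⟨k, hk⟩
      exact congrArg Prod.fst (ψ.injective this)
    · intro w
      let w' : Fin c → R := fun k => if h : k ≠ j then w ⟨k, h⟩ else 0
      obtain ⟨⟨p, r⟩, hpr⟩ := ψ.surjective w'
      refine ⟨p, ?_⟩
      ext1 k
      rw [hf]
      have h4 : (p, r) = (p, 0) + (0, r) := by simp
      rw [h4, map_add, hψ] at hpr
      have h5 := congrFun hpr k.1
      rw [Pi.add_apply, Pi.single_eq_of_ne k.2, add_zero] at h5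
      rw [h5]
      simp only [w']
      rw [dif_pos k.2]
  have hcard : Fintype.card {k : Fin c // k ≠ j} = c - 1 := by
    rw [Fintype.card_subtype_compl, Fintype.card_fin, Fintype.card_subtype_eq]
  exact ⟨(LinearEquiv.ofBijective f hbij).trans
    (LinearEquiv.funCongrLeft R R (Fintype.equivFinOfCardEq hcard).symm)⟩

theorem free_of_stable (K : Type) [Field K] (n : ℕ) (P : Type) [AddCommGroup P]
    [Module (MvPolynomial (Fin n) K) P] (a : ℕ) : ∀ c, a + 2 ≤ c →
    ((P × (Fin a → MvPolynomial (Fin n) K)) ≃ₗ[MvPolynomial (Fin n) K] (Fin c → MvPolynomial (Fin n) K)) →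
    Module.Free (MvPolynomial (Fin n) K) P := by
  induction a with
  | zero =>
    intro c _ e
    exact Module.Free.of_equiv (e.symm.trans LinearEquiv.prodUnique)
  | succ a ih =>
    intro c hc e
    let R := MvPolynomial (Fin n) K
    let e1 : ((P × (Fin a → R)) × R) ≃ₗ[R] (P × ((Fin a → R) × R)) := LinearEquiv.prodAssoc R _ _ _
    let e2 : ((Fin a → R) × R) ≃ₗ[R] (Fin (a+1) → R) :=
      (LinearEquiv.prodComm R _ _).trans (Fin.consLinearEquiv R (fun _ : Fin (a+1) => R))
    obtain ⟨e3⟩ := cancel_one K n c (by omega) (P × (Fin a → R))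
      ((e1.trans ((LinearEquiv.refl R P).prodCongr e2)).trans e)
    exact ih (c-1) (by omega) e3

theorem projective_free (K : Type) [Field K] (n : ℕ) (P : Type) [AddCommGroup P]
    [Module (MvPolynomial (Fin n) K) P] [Module.Finite (MvPolynomial (Fin n) K) P]
    [Module.Projective (MvPolynomial (Fin n) K) P]
    (v : (Fin 2 → MvPolynomial (Fin n) K) →ₗ[MvPolynomial (Fin n) K] P) (hv : Function.Injective v) :
    Module.Free (MvPolynomial (Fin n) K) P := by
  obtain ⟨a, c, ⟨e⟩⟩ := GD.stably_free_mv K n P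
  let R := MvPolynomial (Fin n) K
  refine free_of_stable K n P a c ?_ e
  let f : ((Fin 2 → R) × (Fin a → R)) →ₗ[R] (Fin c → R) :=
    e.toLinearMap ∘ₗ (v.prodMap LinearMap.id)
  have hf : Function.Injective f := by
    apply e.injective.comp
    exact Function.Injective.prodMap hv Function.injective_id
  have := LinearMap.finrank_le_finrank_of_injective hf
  simp at this
  omega
end QS
end

open CategoryTheory TensorProduct
noncomputable section
namespace EX
open Abelian

variable {R : Type} [CommRing R]
variable {A B C A' B' C' N N' W W' : Type}
  [AddCommGroup A] [Module R A] [AddCommGroup B] [Module R B] [AddCommGroup C] [Module R C]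
  [AddCommGroup A'] [Module R A'] [AddCommGroup B'] [Module R B'] [AddCommGroup C'] [Module R C']
  [AddCommGroup N] [Module R N] [AddCommGroup N'] [Module R N']
  [AddCommGroup W] [Module R W] [AddCommGroup W'] [Module R W']

variable (R) in
/-- unbundled Ext -/
abbrev EX (M N : Type) [AddCommGroup M] [Module R M] [AddCommGroup N] [Module R N] (i : ℕ) : Type :=
  Abelian.Ext.{0} (ModuleCat.of R M) (ModuleCat.of R N) i

variable (R) in
/-- vanishing of Ext -/
def EZ (M N : Type) [AddCommGroup M] [Module R M] [AddCommGroup N] [Module R N] (i : ℕ) : Prop :=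
  ∀ x : EX R M N i, x = 0

/-- short exact sequences -/
structure SES (f : A →ₗ[R] B) (g : B →ₗ[R] C) : Prop where
  inj : Function.Injective f
  exact : Function.Exact f g
  surj : Function.Surjective g

theorem SES.comp {f : A →ₗ[R] B} {g : B →ₗ[R] C} (h : SES f g) : g ∘ₗ f = 0 :=
  h.exact.linearMap_comp_eq_zero

/-- the short complex of a short exact sequence -/
abbrev SES.sc {f : A →ₗ[R] B} {g : B →ₗ[R] C} (h : SES f g) : ShortComplex (ModuleCat.{0} R) :=
  ModuleCat.shortComplexOfCompEqZero f g h.comp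

theorem SES.short {f : A →ₗ[R] B} {g : B →ₗ[R] C} (h : SES f g) : h.sc.ShortExact :=
  { exact := ModuleCat.shortComplex_exact _ h.exact
    mono_f := (ModuleCat.mono_iff_injective _).mpr h.inj
    epi_g := (ModuleCat.epi_iff_surjective _).mpr h.surj }

/-- pullback in the first variable -/
def pull {i : ℕ} (f : A →ₗ[R] B) (x : EX R B N i) : EX R A N i :=
  (Ext.mk₀ (ModuleCat.ofHom f)).comp x (zero_add i)

/-- pushforward in the second variable -/
def push {i : ℕ} (f : A →ₗ[R] B) (x : EX R N A i) : EX R N B i :=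
  x.comp (Ext.mk₀ (ModuleCat.ofHom f)) (add_zero i)

theorem pull_pull {i : ℕ} (f : A →ₗ[R] B) (g : B →ₗ[R] C) (x : EX R C N i) :
    pull f (pull g x) = pull (g ∘ₗ f) x := by
  simp [pull, Ext.mk₀_comp_mk₀_assoc]

theorem push_push {i : ℕ} (f : A →ₗ[R] B) (g : B →ₗ[R] C) (x : EX R N A i) :
    push g (push f x) = push (g ∘ₗ f) x := by
  simp [push, Ext.comp_assoc_of_second_deg_zero]

theorem pull_id {i : ℕ} (x : EX R A N i) : pull LinearMap.id x = x := by
  simp [pull]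

theorem push_id {i : ℕ} (x : EX R N A i) : push LinearMap.id x = x := by
  simp [push]

@[simp] theorem pull_zero {i : ℕ} (f : A →ₗ[R] B) : pull f (0 : EX R B N i) = 0 := by
  simp [pull]

@[simp] theorem push_zero {i : ℕ} (f : A →ₗ[R] B) : push f (0 : EX R N A i) = 0 := by
  simp [push]

theorem zero_pull {i : ℕ} (x : EX R B N i) : pull (0 : A →ₗ[R] B) x = 0 := by
  have : (Ext.mk₀ (ModuleCat.ofHom (0 : A →ₗ[R] B))) = 0 := Ext.mk₀_zero _ _
  simp [pull, this]

theorem zero_push {i : ℕ} (x : EX R N A i) : push (0 : A →ₗ[R] B) x = 0 := by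
  have : (Ext.mk₀ (ModuleCat.ofHom (0 : A →ₗ[R] B))) = 0 := Ext.mk₀_zero _ _
  simp [push, this]

theorem pull_add {i : ℕ} (f : A →ₗ[R] B) (x y : EX R B N i) :
    pull f (x + y) = pull f x + pull f y := by
  simp [pull]

theorem pull_sub {i : ℕ} (f : A →ₗ[R] B) (x y : EX R B N i) :
    pull f (x - y) = pull f x - pull f y := by
  simp [pull, sub_eq_add_neg]

theorem push_sub {i : ℕ} (f : A →ₗ[R] B) (x y : EX R N A i) :
    push f (x - y) = push f x - push f y := by
  simp [push, sub_eq_add_neg]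

theorem add_push {i : ℕ} (f g : A →ₗ[R] B) (x : EX R N A i) :
    push (f + g) x = push f x + push g x := by
  have : (Ext.mk₀ (ModuleCat.ofHom (f + g))) = Ext.mk₀ (ModuleCat.ofHom f) + Ext.mk₀ (ModuleCat.ofHom g) :=
    Ext.mk₀_add _ _
  rw [push, this, Ext.comp_add]; rfl

theorem sum_push {i : ℕ} {ι : Type} (s : Finset ι) (f : ι → (A →ₗ[R] B)) (x : EX R N A i) :
    push (∑ j ∈ s, f j) x = ∑ j ∈ s, push (f j) x := by
  classical
  induction s using Finset.induction_on with
  | empty => simp [zero_push]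
  | insert a s ha ih => rw [Finset.sum_insert ha, Finset.sum_insert ha, add_push, ih]

theorem pull_push {i : ℕ} (f : A →ₗ[R] B) (g : N →ₗ[R] N') (x : EX R B N i) :
    pull f (push g x) = push g (pull f x) := by
  simp [pull, push, Ext.comp_assoc_of_third_deg_zero]

/-- contravariant connecting map -/
def delta {i : ℕ} {f : A →ₗ[R] B} {g : B →ₗ[R] C} (h : SES f g) (x : EX R A N i) : EX R C N (i+1) :=
  h.short.extClass.comp (show Ext h.sc.X₁ (ModuleCat.of R N) i from x) (add_comm 1 i)

/-- covariant connecting map -/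
def cdelta {i : ℕ} {f : A →ₗ[R] B} {g : B →ₗ[R] C} (h : SES f g) (x : EX R N C i) : EX R N A (i+1) :=
  Ext.comp (show Ext (ModuleCat.of R N) h.sc.X₃ i from x) h.short.extClass rfl

section
variable {f : A →ₗ[R] B} {g : B →ₗ[R] C} (h : SES f g)

@[simp] theorem delta_zero {i : ℕ} : delta h (0 : EX R A N i) = 0 := by
  simp [delta]

@[simp] theorem cdelta_zero {i : ℕ} : cdelta h (0 : EX R N C i) = 0 := by
  simp [cdelta]

theorem delta_sub {i : ℕ} (x y : EX R A N i) : delta h (x - y) = delta h x - delta h y := by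
  simp [delta, sub_eq_add_neg]

theorem cdelta_sub {i : ℕ} (x y : EX R N C i) : cdelta h (x - y) = cdelta h x - cdelta h y := by
  simp [cdelta, sub_eq_add_neg]

theorem ct1 {i : ℕ} (x : EX R A N i) (hx : delta h x = 0) : ∃ y : EX R B N i, pull f y = x :=
  Ext.contravariant_sequence_exact₁ h.short _ x (add_comm 1 i) hx

theorem ct2 {f : A →ₗ[R] B} {g : B →ₗ[R] C} (h : SES f g) {i : ℕ} (x : EX R B N i) (hx : pull f x = 0) : ∃ y : EX R C N i, pull g y = x :=
  Ext.contravariant_sequence_exact₂ h.short _ x hx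

theorem ct3 {i : ℕ} (x : EX R C N (i+1)) (hx : pull g x = 0) : ∃ y : EX R A N i, delta h y = x :=
  Ext.contravariant_sequence_exact₃ h.short _ x hx (add_comm 1 i)

theorem cv1 {i : ℕ} (x : EX R N A (i+1)) (hx : push f x = 0) : ∃ y : EX R N C i, cdelta h y = x :=
  Ext.covariant_sequence_exact₁ _ h.short x hx rfl

theorem cv2 {f : A →ₗ[R] B} {g : B →ₗ[R] C} (h : SES f g) {i : ℕ} (x : EX R N B i) (hx : push g x = 0) : ∃ y : EX R N A i, push f y = x :=
  Ext.covariant_sequence_exact₂ _ h.short x hx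

theorem cv3 {i : ℕ} (x : EX R N C i) (hx : cdelta h x = 0) : ∃ y : EX R N B i, push g y = x :=
  Ext.covariant_sequence_exact₃ _ h.short x rfl hx

theorem delta_pull {i : ℕ} (x : EX R B N i) : delta h (pull f x) = 0 := by
  exact h.short.extClass_comp_assoc _

theorem pull_delta {i : ℕ} (x : EX R A N i) : pull g (delta h x) = 0 := by
  exact h.short.comp_extClass_assoc _ _

theorem pull_pull_zero {f : A →ₗ[R] B} {g : B →ₗ[R] C} (h : SES f g) {i : ℕ} (x : EX R C N i) : pull f (pull g x) = 0 := by
  rw [pull_pull, h.comp, zero_pull]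

theorem pull_cdelta {i : ℕ} (u : N' →ₗ[R] N) (x : EX R N C i) :
    pull u (cdelta h x) = cdelta h (pull u x) := by
  unfold pull cdelta
  exact (Ext.comp_assoc _ _ _ _ _ (by omega)).symm

theorem delta_nat {f' : A' →ₗ[R] B'} {g' : B' →ₗ[R] C'} (h' : SES f' g')
    (α : A →ₗ[R] A') (β : B →ₗ[R] B') (γ : C →ₗ[R] C') (h1 : f' ∘ₗ α = β ∘ₗ f) (h2 : g' ∘ₗ β = γ ∘ₗ g)
    {i : ℕ} (x : EX R A' N i) : delta h (pull α x) = pull γ (delta h' x) := by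
  let φ : h.sc ⟶ h'.sc :=
    { τ₁ := ModuleCat.ofHom α
      τ₂ := ModuleCat.ofHom β
      τ₃ := ModuleCat.ofHom γ
      comm₁₂ := by
        apply ModuleCat.hom_ext
        exact h1
      comm₂₃ := by
        apply ModuleCat.hom_ext
        exact h2 }
  have key := ShortComplex.ShortExact.extClass_naturality h.short h'.short φ
  unfold delta pull
  have e1 := Ext.comp_assoc (h.short.extClass) (Ext.mk₀ φ.τ₁) (show Ext h'.sc.X₁ (ModuleCat.of R N) i from x)
    (add_zero 1) (zero_add i) (show 1 + 0 + i = i + 1 by omega)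
  refine e1.symm.trans ?_
  rw [key]
  exact Ext.comp_assoc _ _ _ _ _ (by omega)
end

/-! vanishing lemmas -/
section
variable {f : A →ₗ[R] B} {g : B →ₗ[R] C}

theorem EZ.of_surj_inj {i : ℕ} (h : EZ R B N i) (u : A →ₗ[R] B) (v : B →ₗ[R] A) (huv : v ∘ₗ u = LinearMap.id) :
    EZ R A N i := by
  intro x
  have : pull u (pull v x) = x := by rw [pull_pull, huv, pull_id]
  rw [← this, h (pull v x), pull_zero]

theorem EZ.of_equiv {i : ℕ} (h : EZ R B N i) (e : A ≃ₗ[R] B) : EZ R A N i :=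
  h.of_surj_inj e.toLinearMap e.symm.toLinearMap (by ext x; simp)

theorem EZ.of_equiv_right {i : ℕ} (h : EZ R N B i) (e : A ≃ₗ[R] B) : EZ R N A i := by
  intro x
  have : push e.symm.toLinearMap (push e.toLinearMap x) = x := by
    rw [push_push]
    have : e.symm.toLinearMap ∘ₗ e.toLinearMap = LinearMap.id := by ext x; simp
    rw [this, push_id]
  rw [← this, h (push _ x), push_zero]

theorem SES.ez_mid (h : SES f g) {i : ℕ} (hA : EZ R A N i) (hC : EZ R C N i) : EZ R B N i := by
  intro x
  obtain ⟨y, rfl⟩ := ct2 h x (hA _)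
  rw [hC y, pull_zero]

theorem SES.ez_right (h : SES f g) {i : ℕ} (hA : EZ R A N i) (hB : EZ R B N (i+1)) : EZ R C N (i+1) := by
  intro x
  obtain ⟨y, rfl⟩ := ct3 h x (hB _)
  rw [hA y, delta_zero]

theorem SES.ez_left (h : SES f g) {i : ℕ} (hB : EZ R B N i) (hC : EZ R C N (i+1)) : EZ R A N i := by
  intro x
  obtain ⟨y, rfl⟩ := ct1 h x (hC _)
  rw [hB y, pull_zero]

theorem SES.ez_right_zero (h : SES f g) (hB : EZ R B N 0) : EZ R C N 0 := by
  intro x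
  obtain ⟨u, rfl⟩ := (Ext.mk₀_bijective _ _).2 x
  have h0 : pull g (Ext.mk₀ u) = (0 : EX R B N 0) := hB _
  have h1 : Ext.mk₀ (ModuleCat.ofHom g ≫ u) = 0 := by
    rw [← Ext.mk₀_comp_mk₀]; exact h0
  rw [Ext.mk₀_eq_zero_iff] at h1
  rw [Ext.mk₀_eq_zero_iff]
  have : Epi (ModuleCat.ofHom g) := (ModuleCat.epi_iff_surjective _).mpr h.surj
  exact (cancel_epi (ModuleCat.ofHom g)).mp (by rw [h1, Limits.comp_zero])

theorem SES.ezc_mid (h : SES f g) {i : ℕ} (hA : EZ R W A i) (hC : EZ R W C i) : EZ R W B i := by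
  intro x
  obtain ⟨y, rfl⟩ := cv2 h x (hC _)
  rw [hA y, push_zero]

theorem SES.ezc_left (h : SES f g) {i : ℕ} (hC : EZ R W C i) (hB : EZ R W B (i+1)) : EZ R W A (i+1) := by
  intro x
  obtain ⟨y, rfl⟩ := cv1 h x (hB _)
  rw [hC y, cdelta_zero]

theorem SES.ezc_right (h : SES f g) {i : ℕ} (hB : EZ R W B i) (hA : EZ R W A (i+1)) : EZ R W C i := by
  intro x
  obtain ⟨y, rfl⟩ := cv3 h x (hA _)
  rw [hB y, push_zero]

theorem SES.ezc_left_zero (h : SES f g) (hB : EZ R W B 0) : EZ R W A 0 := by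
  intro x
  obtain ⟨u, rfl⟩ := (Ext.mk₀_bijective _ _).2 x
  have h0 : push f (Ext.mk₀ u) = (0 : EX R W B 0) := hB _
  have h1 : Ext.mk₀ (u ≫ ModuleCat.ofHom f) = 0 := by
    rw [← Ext.mk₀_comp_mk₀]; exact h0
  rw [Ext.mk₀_eq_zero_iff] at h1
  rw [Ext.mk₀_eq_zero_iff]
  have : Mono (ModuleCat.ofHom f) := (ModuleCat.mono_iff_injective _).mpr h.inj
  exact (cancel_mono (ModuleCat.ofHom f)).mp (by rw [h1, Limits.zero_comp])

theorem ez_proj (P : Type) [AddCommGroup P] [Module R P] [hP : Module.Projective R P] (i : ℕ) :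
    EZ R P N (i+1) := by
  intro x
  haveI : Projective (ModuleCat.of R P) := (IsProjective.iff_projective P).mp hP
  exact Ext.eq_zero_of_projective x

theorem ez_of_pd (M : Type) [AddCommGroup M] [Module R M] (n : ℕ)
    [HasProjectiveDimensionLT (ModuleCat.of R M) n] (i : ℕ) (hi : n ≤ i) : EZ R M N i := by
  intro x
  exact Ext.eq_zero_of_hasProjectiveDimensionLT x n hi

/-- Degree zero. -/
theorem hom_zero_of_ez (h : EZ R A B 0) (u : A →ₗ[R] B) : u = 0 := by
  have := h (Ext.mk₀ (ModuleCat.ofHom u))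
  rw [Ext.mk₀_eq_zero_iff] at this
  exact congrArg ModuleCat.Hom.hom this

theorem ez_zero_iff : EZ R A B 0 ↔ ∀ u : A →ₗ[R] B, u = 0 := by
  refine ⟨hom_zero_of_ez, fun h x => ?_⟩
  obtain ⟨u, rfl⟩ := (Ext.mk₀_bijective _ _).2 x
  rw [Ext.mk₀_eq_zero_iff]
  apply ModuleCat.hom_ext
  exact h u.hom

theorem ez_of_subsingleton [Subsingleton A] (i : ℕ) : EZ R A N i := by
  intro x
  rw [← pull_id x, Subsingleton.elim (LinearMap.id : A →ₗ[R] A) 0, zero_pull]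

/-- standard sequences -/
theorem ses_ker (g : B →ₗ[R] C) (hg : Function.Surjective g) : SES (LinearMap.ker g).subtype g :=
  ⟨Subtype.val_injective, by rw [LinearMap.exact_iff]; simp, hg⟩

theorem ses_ker_range (g : B →ₗ[R] C) : SES (LinearMap.ker g).subtype g.rangeRestrict :=
  ⟨Subtype.val_injective, by rw [LinearMap.exact_iff]; simp, g.surjective_rangeRestrict⟩

theorem ses_mkQ (P : Submodule R B) : SES P.subtype P.mkQ :=
  ⟨Subtype.val_injective, by rw [LinearMap.exact_iff]; simp, P.mkQ_surjective⟩
end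

end EX
end

open CategoryTheory TensorProduct
noncomputable section
namespace EX
open Abelian

variable {R : Type} [CommRing R] (m : Ideal R) (n : ℕ)
variable {A B C N F W W' : Type}
  [AddCommGroup A] [Module R A] [AddCommGroup B] [Module R B] [AddCommGroup C] [Module R C]
  [AddCommGroup N] [Module R N] [AddCommGroup F] [Module R F]
  [AddCommGroup W] [Module R W] [AddCommGroup W'] [Module R W']

variable (W) in
/-- locally torsion away from `m` -/
def LTo : Prop := ∀ p : Ideal R, p.IsPrime → p ≠ m → ∃ a, a ∉ p ∧ ∀ w : W, a • w = 0

variable {m}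
theorem LTo.of_inj (h : LTo m W) (f : W' →ₗ[R] W) (hf : Function.Injective f) : LTo m W' := by
  intro p hp hpm
  obtain ⟨a, ha, h1⟩ := h p hp hpm
  exact ⟨a, ha, fun w => hf (by rw [map_smul, h1, map_zero])⟩

theorem LTo.of_surj (h : LTo m W) (f : W →ₗ[R] W') (hf : Function.Surjective f) : LTo m W' := by
  intro p hp hpm
  obtain ⟨a, ha, h1⟩ := h p hp hpm
  refine ⟨a, ha, fun w => ?_⟩
  obtain ⟨w, rfl⟩ := hf w
  rw [← map_smul, h1, map_zero]

theorem LTo.pow [IsNoetherianRing R] [Module.Finite R W] (h : LTo m W) :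
    ∃ c : ℕ, ∀ a ∈ m ^ c, ∀ w : W, a • w = 0 := by
  have : m ≤ (Module.annihilator R W).radical := by
    rw [Ideal.radical_eq_sInf]
    apply le_sInf
    rintro p ⟨hp, hpp⟩
    by_contra hle
    obtain ⟨a, ha, h1⟩ := h p hpp (fun e => hle (e ▸ le_rfl))
    exact ha (hp (Module.mem_annihilator.mpr h1))
  obtain ⟨c, hc⟩ := Ideal.exists_pow_le_of_le_radical_of_fg this (IsNoetherian.noetherian _)
  exact ⟨c, fun a ha w => Module.mem_annihilator.mp (hc ha) w⟩

theorem LTo.of_pow (c : ℕ) (h : ∀ a ∈ m ^ c, ∀ w : W, a • w = 0) (hm : m.IsMaximal) : LTo m W := by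
  intro p hp hpm
  have : ¬ (m ^ c ≤ p) := fun hle => by
    have := Ideal.IsPrime.le_of_pow_le hle
    exact hpm (hm.eq_of_le hp.ne_top this).symm
  obtain ⟨a, ha, hap⟩ := Set.not_subset.mp this
  exact ⟨a, hap, h a ha⟩

variable (m) in
/-- Ext of torsion modules into the ring vanishes -/
class HT : Prop where
  max : m.IsMaximal
  ext : ∀ (W : Type) [AddCommGroup W] [Module R W] [Module.Finite R W], LTo m W →
    ∀ i ≤ n, EZ R W R i

variable {n}
theorem LTo.ez [h : HT m n] [Module.Finite R W] (hW : LTo m W) (P : Type) [AddCommGroup P] [Module R P]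
    [Module.Finite R P] [Module.Projective R P] {i : ℕ} (hi : i ≤ n) : EZ R W P i := by
  intro x
  obtain ⟨c, f, g, hf, hg, hfg⟩ := Module.Finite.exists_comp_eq_id_of_projective R P
  have e1 : push g x = 0 := by
    have e2 : (LinearMap.id : (Fin c → R) →ₗ[R] _) =
        ∑ j, (LinearMap.single R (fun _ => R) j ∘ₗ LinearMap.proj j) := by
      refine LinearMap.ext fun y => ?_
      funext k
      simp [Finset.sum_apply, Pi.single_apply]
    rw [← push_id (push g x), e2, sum_push]
    apply Finset.sum_eq_zero
    intro j _
    rw [← push_push, h.ext W hW i hi (push _ (push g x)), push_zero]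
  rw [← push_id x, ← hfg, ← push_push, e1, push_zero]

variable (m) in
/-- isomorphism away from `m` -/
def UI (θ : A →ₗ[R] B) : Prop := ∀ p : Ideal R, p.IsPrime → p ≠ m → ∃ a, a ∉ p ∧
  (∀ x, θ x = 0 → a • x = 0) ∧ ∀ y, ∃ x, θ x = a • y

theorem UI.ker {θ : A →ₗ[R] B} (h : UI m θ) : LTo m (LinearMap.ker θ) := by
  intro p hp hpm
  obtain ⟨a, ha, h1, h2⟩ := h p hp hpm
  exact ⟨a, ha, fun w => Subtype.ext (h1 w.1 w.2)⟩

theorem UI.coker {θ : A →ₗ[R] B} (h : UI m θ) : LTo m (B ⧸ LinearMap.range θ) := by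
  intro p hp hpm
  obtain ⟨a, ha, h1, h2⟩ := h p hp hpm
  refine ⟨a, ha, fun w => ?_⟩
  obtain ⟨w, rfl⟩ := Submodule.mkQ_surjective _ w
  obtain ⟨x, hx⟩ := h2 w
  rw [← map_smul, ← hx]
  simp

theorem UI.inj [IsNoetherianRing R] [HT m n] [Module.Finite R A] [Module.Finite R B]
    {θ : A →ₗ[R] B} (h : UI m θ) {i : ℕ} (hi : i ≤ n) (x : EX R B R i)
    (hx : pull θ x = 0) : x = 0 := by
  have e : θ = (LinearMap.range θ).subtype ∘ₗ θ.rangeRestrict := rfl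
  rw [e, ← pull_pull] at hx
  have h1 : pull (LinearMap.range θ).subtype x = 0 := by
    generalize pull (LinearMap.range θ).subtype x = y at hx
    cases i with
    | zero =>
      obtain ⟨u, rfl⟩ := (Ext.mk₀_bijective _ _).2 y
      have h1 : Ext.mk₀ (ModuleCat.ofHom θ.rangeRestrict ≫ u) = 0 := by
        rw [← Ext.mk₀_comp_mk₀]; exact hx
      rw [Ext.mk₀_eq_zero_iff] at h1
      rw [Ext.mk₀_eq_zero_iff]
      have : Epi (ModuleCat.ofHom θ.rangeRestrict) :=
        (ModuleCat.epi_iff_surjective _).mpr θ.surjective_rangeRestrict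
      exact (cancel_epi (ModuleCat.ofHom θ.rangeRestrict)).mp (by rw [h1, Limits.comp_zero])
    | succ i =>
      obtain ⟨z, rfl⟩ := ct3 (ses_ker_range θ) y hx
      rw [h.ker.ez (n := n) R (i := i) (by omega) z, delta_zero]
  obtain ⟨z, rfl⟩ := ct2 (ses_mkQ _) x h1
  rw [h.coker.ez R hi z, pull_zero]

theorem UI.ez_right [IsNoetherianRing R] [HT m n] [Module.Finite R A] [Module.Finite R B]
    {θ : A →ₗ[R] B} (h : UI m θ) {i : ℕ} (hi : i ≤ n) (hA : EZ R A R i) : EZ R B R i :=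
  fun x => h.inj hi x (hA _)

theorem UI.ez_left [IsNoetherianRing R] [HT m n] [Module.Finite R A] [Module.Finite R B]
    {θ : A →ₗ[R] B} (h : UI m θ) {i : ℕ} (hi : i + 1 ≤ n) (hB : EZ R B R i) : EZ R A R i :=
  (ses_ker_range θ).ez_mid (h.ker.ez (n := n) R (by omega)) ((ses_mkQ _).ez_left hB (h.coker.ez R hi))

theorem UI.of_inv {θ : A →ₗ[R] B}
    (h : ∀ p : Ideal R, p.IsPrime → p ≠ m → ∃ a, a ∉ p ∧ ∃ θ' : B →ₗ[R] A,
      (∀ x, θ' (θ x) = a • x) ∧ ∀ y, θ (θ' y) = a • y) : UI m θ := by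
  intro p hp hpm
  obtain ⟨a, ha, θ', h1, h2⟩ := h p hp hpm
  exact ⟨a, ha, fun x hx => by rw [← h1, hx, map_zero], fun y => ⟨θ' y, h2 y⟩⟩

variable (m A F) in
/-- locally isomorphic to F away from m -/
def Loc : Prop := ∀ p : Ideal R, p.IsPrime → p ≠ m → ∃ a, a ∉ p ∧
  ∃ (u : A →ₗ[R] F) (v : F →ₗ[R] A), (∀ x, v (u x) = a • x) ∧ ∀ y, u (v y) = a • y

/-- division of a functional -/
theorem div_functional [IsDomain R] (l : A →ₗ[R] R) (π : R) (hπ : π ≠ 0) (h : ∀ x, π ∣ l x) :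
    ∃ l' : A →ₗ[R] R, ∀ x, l x = π * l' x := by
  choose q hq using h
  refine ⟨{ toFun := q, map_add' := fun x y => ?_, map_smul' := fun r x => ?_ }, hq⟩
  · apply mul_left_cancel₀ hπ
    rw [← hq, map_add, hq, hq, mul_add]
  · apply mul_left_cancel₀ hπ
    rw [← hq, map_smul, hq]
    simp; ring

theorem Loc.ez_one [IsNoetherianRing R] [IsDomain R] [UniqueFactorizationMonoid R] [HT m n]
    [Module.Finite R A] (hm0 : m ≠ ⊥) (h : Loc m A R) {i : ℕ} (hi : i + 2 ≤ n) : EZ R A R (i+1) := by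
  obtain ⟨a, ha, u, v, huv, hvu⟩ := h ⊥ Ideal.isPrime_bot (Ne.symm hm0)
  have ha0 : a ≠ 0 := by simpa using ha
  -- choose l with maximal range
  obtain ⟨J, ⟨l, hl0, rfl⟩, hmax⟩ := set_has_maximal_iff_noetherian.mpr (inferInstance : IsNoetherian R R)
    {J : Ideal R | ∃ l : A →ₗ[R] R, l ≠ 0 ∧ LinearMap.range l = J}
    ⟨_, u, fun h0 => by
      have := hvu 1
      rw [h0] at this
      simp at this
      exact ha0 this.symm, rfl⟩
  have hJ : ∀ p : Ideal R, p.IsPrime → p ≠ m → ¬ (LinearMap.range l ≤ p) := by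
    intro p hp hpm hle
    obtain ⟨a, ha, u, v, huv, hvu⟩ := h p hp hpm
    have ha0 : a ≠ 0 := fun h => ha (h ▸ p.zero_mem)
    have key : ∀ x, a * l x = u x * l (v 1) := by
      intro x
      rw [← smul_eq_mul, ← map_smul, ← huv]
      have : u x = u x • (1 : R) := by simp
      conv_lhs => rw [this]
      rw [map_smul, map_smul, smul_eq_mul]
    have hg0 : l (v 1) ≠ 0 := by
      intro h0
      apply hl0
      ext x
      have := key x
      rw [h0, mul_zero] at this
      simpa [ha0] using this
    have hgp : l (v 1) ∈ p := hle ⟨_, rfl⟩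
    obtain ⟨π, hπp, hπ, hdvd⟩ : ∃ π ∈ p, Prime π ∧ π ∣ l (v 1) := by
      obtain ⟨f, hf, hfa⟩ := UniqueFactorizationMonoid.exists_prime_factors (l (v 1)) hg0
      have : f.prod ∈ p := by
        obtain ⟨w, hw⟩ := hfa.symm
        rw [← hw]; exact p.mul_mem_right _ hgp
      obtain ⟨π, hπf, hπp⟩ := (Ideal.IsPrime.multiset_prod_mem_iff_exists_mem hp f).mp this
      exact ⟨π, hπp, hf _ hπf, (Multiset.dvd_prod hπf).trans hfa.dvd⟩
    have hd : ∀ x, π ∣ l x := by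
      intro x
      have : π ∣ a * l x := by rw [key]; exact hdvd.mul_left _
      rcases hπ.dvd_or_dvd this with h1 | h1
      · exact absurd (p.mem_of_dvd h1 hπp) ha
      · exact h1
    obtain ⟨l', hl'⟩ := div_functional l π hπ.ne_zero hd
    have hlt : LinearMap.range l < LinearMap.range l' := by
      refine lt_of_le_of_ne ?_ ?_
      · rintro _ ⟨x, rfl⟩
        exact ⟨π • x, by rw [map_smul, hl', smul_eq_mul]⟩
      · intro heq
        have h3 : LinearMap.range l ≤ Ideal.span {π} • LinearMap.range l := by
          rintro _ ⟨x, rfl⟩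
          rw [hl']
          refine Submodule.smul_mem_smul (Ideal.mem_span_singleton_self π) ?_
          rw [heq]; exact ⟨x, rfl⟩
        obtain ⟨r, hr1, hr2⟩ := Submodule.exists_sub_one_mem_and_smul_eq_zero_of_fg_of_le_smul
          (Ideal.span {π}) (LinearMap.range l) (IsNoetherian.noetherian _) h3
        have : r * l (v 1) = 0 := hr2 _ ⟨_, rfl⟩
        have hr0 : r = 0 := by simpa [hg0] using this
        rw [hr0, zero_sub, Ideal.neg_mem_iff, Ideal.mem_span_singleton] at hr1
        exact hπ.not_unit (isUnit_of_dvd_one hr1)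
    refine hmax _ ⟨l', ?_, rfl⟩ hlt
    intro h0
    apply hl0
    ext x
    rw [hl', h0]; simp
  have hUI : UI m l := by
    intro p hp hpm
    obtain ⟨b, ⟨x0, hx0⟩, hbp⟩ := Set.not_subset.mp (hJ p hp hpm)
    obtain ⟨a', ha', u', v', huv', hvu'⟩ := h p hp hpm
    refine ⟨a' * b, fun hh => (hp.mem_or_mem hh).elim ha' hbp, ?_, ?_⟩
    · intro x hx
      -- l x = 0 implies a' x = 0
      have h1 : l (v' 1) ≠ 0 := by
        intro h0
        have ha0' : a' ≠ 0 := fun h => ha' (h ▸ p.zero_mem)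
        apply hl0
        ext y
        have e1 : a' * l y = 0 := by
          rw [← smul_eq_mul, ← map_smul, ← huv']
          have : u' y = u' y • (1 : R) := by simp
          rw [this, map_smul, map_smul, h0, smul_zero]
        simpa [ha0'] using e1
      have h2 : u' x * l (v' 1) = 0 := by
        have : u' x • (1:R) = u' x := by simp
        rw [← smul_eq_mul, ← map_smul, ← map_smul, this, huv', map_smul, hx, smul_zero]
      have h3 : u' x = 0 := by simpa [h1] using h2
      rw [mul_comm, mul_smul, ← huv', h3, map_zero, smul_zero]
    · intro y
      refine ⟨(a' * y) • x0, ?_⟩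
      rw [map_smul, hx0, smul_eq_mul, smul_eq_mul]; ring
  exact hUI.ez_left hi (ez_proj R i)

end EX
end

open CategoryTheory TensorProduct
noncomputable section
namespace EX
open Abelian

variable {R : Type} [CommRing R] {m : Ideal R} {n : ℕ}
variable {X : Type} [AddCommGroup X] [Module R X]

variable (R X) in
/-- a bounded complex on a single module with projectors -/
structure GC (L : ℕ) where
  d : X →ₗ[R] X
  π : ℕ → X →ₗ[R] X
  dd : ∀ x, d (d x) = 0
  ππ : ∀ i j x, π i (π j x) = if i = j then π i x else 0
  sum : ∀ x, ∑ i ∈ Finset.range (L+1), π i x = x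
  dπ : ∀ i x, d (π (i+1) x) = π i (d x)
  dπ0 : ∀ x, d (π 0 x) = 0

namespace GC
variable {L : ℕ} (G : GC R X L)

theorem big (i : ℕ) (hi : L < i) (x : X) : G.π i x = 0 := by
  rw [← G.sum x, map_sum]
  apply Finset.sum_eq_zero
  intro j hj
  rw [G.ππ, if_neg]
  simp at hj; omega

/-- degree j part -/
def Xd (j : ℕ) : Submodule R X := LinearMap.range (G.π j)

theorem mem_Xd {j : ℕ} {x : X} : x ∈ G.Xd j ↔ G.π j x = x := by
  constructor
  · rintro ⟨y, rfl⟩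
    rw [G.ππ, if_pos rfl]
  · intro h; exact ⟨x, h⟩

theorem π_ne {i j : ℕ} (hij : i ≠ j) {x : X} (hx : G.π j x = x) : G.π i x = 0 := by
  rw [← hx, G.ππ, if_neg hij]

/-- cycles -/
def Z (j : ℕ) : Submodule R X := G.Xd j ⊓ LinearMap.ker G.d
/-- boundaries -/
def Bd (j : ℕ) : Submodule R X := (G.Xd (j+1)).map G.d

theorem mem_Z {j : ℕ} {x : X} : x ∈ G.Z j ↔ G.π j x = x ∧ G.d x = 0 := by
  rw [Z, Submodule.mem_inf, mem_Xd, LinearMap.mem_ker]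

theorem mem_Bd {j : ℕ} {x : X} : x ∈ G.Bd j ↔ ∃ y, G.π (j+1) y = y ∧ G.d y = x := by
  simp only [Bd, Submodule.mem_map, mem_Xd]

theorem d_mem {j : ℕ} {y : X} (hy : G.π (j+1) y = y) : G.π j (G.d y) = G.d y := by
  rw [← G.dπ, hy]

theorem mem_Bd_of {j : ℕ} {x y : X} (hx : G.π j x = x) (h : G.d y = x) : x ∈ G.Bd j := by
  rw [mem_Bd]
  refine ⟨G.π (j+1) y, by rw [G.ππ, if_pos rfl], ?_⟩
  rw [G.dπ, h, hx]

theorem Bd_le_Z (j : ℕ) : G.Bd j ≤ G.Z j := by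
  intro x hx
  obtain ⟨y, hy, rfl⟩ := G.mem_Bd.mp hx
  rw [mem_Z]
  exact ⟨G.d_mem hy, G.dd y⟩

theorem Z_le_Xd (j : ℕ) : G.Z j ≤ G.Xd j := inf_le_left

/-- homology -/
abbrev H (j : ℕ) : Type := (G.Z j) ⧸ (G.Bd j).comap (G.Z j).subtype

/-- homology class -/
abbrev cls (j : ℕ) : G.Z j →ₗ[R] G.H j := ((G.Bd j).comap (G.Z j).subtype).mkQ

theorem cls_surj (j : ℕ) : Function.Surjective (G.cls j) := Submodule.mkQ_surjective _

theorem cls_eq_zero {j : ℕ} {x : G.Z j} : G.cls j x = 0 ↔ x.1 ∈ G.Bd j := by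
  rw [Submodule.mkQ_apply, Submodule.Quotient.mk_eq_zero]; rfl

/-- the differential from degree j+1 to boundaries -/
def dB (j : ℕ) : G.Xd (j+1) →ₗ[R] G.Bd j :=
  LinearMap.restrict G.d (fun x hx => Submodule.mem_map_of_mem hx)

theorem ses_ZXB (j : ℕ) : SES (Submodule.inclusion (G.Z_le_Xd (j+1))) (G.dB j) := by
  refine ⟨Submodule.inclusion_injective _, ?_, ?_⟩
  · intro x
    constructor
    · intro hx
      exact ⟨⟨x.1, ⟨x.2, congrArg Subtype.val hx⟩⟩, rfl⟩
    · rintro ⟨y, rfl⟩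
      exact Subtype.ext y.2.2
  · rintro ⟨x, hx⟩
    obtain ⟨y, hy, rfl⟩ := hx
    exact ⟨⟨y, hy⟩, rfl⟩

theorem ses_BZH (j : ℕ) : SES (Submodule.inclusion (G.Bd_le_Z j)) (G.cls j) := by
  refine ⟨Submodule.inclusion_injective _, ?_, G.cls_surj j⟩
  intro x
  rw [cls_eq_zero]
  constructor
  · intro hx; exact ⟨⟨x.1, hx⟩, rfl⟩
  · rintro ⟨y, rfl⟩; exact y.2

instance proj_Xd [Module.Projective R X] (j : ℕ) : Module.Projective R (G.Xd j) :=
  Module.Projective.of_split (G.Xd j).subtype (G.π j).rangeRestrict (by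
    refine LinearMap.ext fun x => Subtype.ext ?_
    exact G.mem_Xd.mp x.2)

/-- local contraction data -/
structure HD (c : ℕ) (a : R) where
  s : X →ₗ[R] X
  e : X →ₗ[R] X
  sπ : ∀ i x, s (G.π i x) = G.π (i+1) (s x)
  hom : ∀ x, G.d (s x) + s (G.d x) = a • x - e x
  eπ : ∀ x, e (G.π c x) = e x
  πe : ∀ x, G.π c (e x) = e x
  de : ∀ x, G.d (e x) = 0
  ed : ∀ x, e (G.d x) = 0

variable (m) in
/-- contractible away from m and from degree c -/
def Data (c : ℕ) : Prop := ∀ p : Ideal R, p.IsPrime → p ≠ m → ∃ a, a ∉ p ∧ Nonempty (G.HD c a)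

variable {G} {c : ℕ}

theorem HD.e_ne {a : R} (h : G.HD c a) {j : ℕ} (hj : j ≠ c) {x : X} (hx : G.π j x = x) : h.e x = 0 := by
  rw [← h.eπ, G.π_ne hj.symm hx, map_zero]

theorem Data.H_tors (h : G.Data m c) {j : ℕ} (hj : j ≠ c) : LTo m (G.H j) := by
  intro p hp hpm
  obtain ⟨a, ha, ⟨D⟩⟩ := h p hp hpm
  refine ⟨a, ha, fun w => ?_⟩
  obtain ⟨z, rfl⟩ := G.cls_surj j w
  rw [← map_smul, cls_eq_zero]
  obtain ⟨hz1, hz2⟩ := G.mem_Z.mp z.2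
  have := D.hom z.1
  rw [hz2, map_zero, add_zero, D.e_ne hj hz1, sub_zero] at this
  exact G.mem_Bd_of (by rw [Submodule.coe_smul, map_smul, hz1]) this

theorem Z_zero (G : GC R X L) : G.Z 0 = G.Xd 0 := by
  apply le_antisymm (G.Z_le_Xd 0)
  intro x hx
  rw [mem_Z]
  have h1 := G.mem_Xd.mp hx
  exact ⟨h1, by rw [← h1, G.dπ0]⟩

theorem Bd_big (G : GC R X L) {j : ℕ} (hj : L ≤ j) : G.Bd j = ⊥ := by
  rw [eq_bot_iff]
  intro x hx
  obtain ⟨y, hy, rfl⟩ := G.mem_Bd.mp hx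
  rw [← hy, G.big _ (by omega), map_zero]
  exact Submodule.zero_mem _

variable [IsNoetherianRing R] [HT m n] [Module.Finite R X] [Module.Projective R X]

theorem ez_Bd_aux (G : GC R X L) (j0 : ℕ) (h : ∀ i, j0 < i → G.Z i = G.Bd i)
    {W : Type} [AddCommGroup W] [Module R W] [Module.Finite R W] (hW : LTo m W) (r : ℕ) :
    ∀ i q, j0 ≤ i → L ≤ i + r → q + r ≤ n → EZ R W (G.Bd i) q := by
  induction r with
  | zero =>
    intro i q _ hi _ x
    have := G.Bd_big (j := i) (by omega)
    have : Subsingleton (G.Bd i) := by rw [this]; infer_instance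
    rw [← push_id x, Subsingleton.elim (LinearMap.id : G.Bd i →ₗ[R] _) 0, zero_push]
  | succ r ih =>
    intro i q hji hi hq
    refine (G.ses_ZXB i).ezc_right (hW.ez (n := n) _ (by omega)) ?_
    rw [h (i+1) (by omega)]
    exact ih (i+1) (q+1) (by omega) (by omega) (by omega)

theorem Z_big (G : GC R X L) {j : ℕ} (hj : L < j) : G.Z j = G.Bd j := by
  apply le_antisymm _ (G.Bd_le_Z j)
  intro x hx
  rw [← (G.mem_Z.mp hx).1, G.big j (by omega)]
  exact Submodule.zero_mem _

theorem Data.acyc (h : G.Data m c) (hL : L ≤ n) (r : ℕ) : ∀ j, c < j → L < j + r → G.Z j = G.Bd j := by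
  induction r with
  | zero =>
    intro j _ hj
    exact G.Z_big (by omega)
  | succ r ih =>
    intro j hcj hj
    by_cases hLj : L < j
    · exact G.Z_big hLj
    have hT := h.H_tors (j := j) (by omega)
    have e1 : EZ R (G.H j) (G.Bd j) 1 :=
      G.ez_Bd_aux j (fun i hi => ih i (by omega) (by omega)) hT (n := n) (n - 1) j 1 le_rfl (by omega) (by omega)
    have e2 : EZ R (G.H j) (G.Z j) 0 := by
      rw [ez_zero_iff]
      intro u
      have h3 : (G.Z j).subtype ∘ₗ u = 0 := hom_zero_of_ez (hT.ez (n := n) X (by omega)) _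
      refine LinearMap.ext fun x => Subtype.ext ?_
      exact LinearMap.congr_fun h3 x
    have e3 : EZ R (G.H j) (G.H j) 0 := (G.ses_BZH j).ezc_right e2 e1
    have e4 := hom_zero_of_ez e3 LinearMap.id
    apply le_antisymm _ (G.Bd_le_Z j)
    intro x hx
    exact (G.cls_eq_zero (x := ⟨x, hx⟩)).mp (LinearMap.congr_fun e4 _)

theorem Data.Z_eq (h : G.Data m c) (hL : L ≤ n) {j : ℕ} (hj : c < j) : G.Z j = G.Bd j :=
  h.acyc hL (L+1) j hj (by omega)

theorem Data.ez_Z (h : G.Data m c) (i : ℕ) : ∀ q, i ≤ c → q + i + 2 ≤ n → EZ R (G.Z i) R (q+1) := by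
  induction i with
  | zero =>
    intro q _ _
    rw [Z_zero]
    exact ez_proj _ _
  | succ i ih =>
    intro q hic hq
    refine (G.ses_ZXB i).ez_left (ez_proj _ _) ?_
    exact (G.ses_BZH i).ez_left (ih (q+1) (by omega) (by omega))
      ((h.H_tors (j := i) (by omega)).ez (n := n) R (by omega))

theorem Data.ez_Bd (h : G.Data m c) (hL : L ≤ n) (r : ℕ) : ∀ j q, c ≤ j → L ≤ j + r → r ≤ q + 1 →
    EZ R (G.Bd j) R (q+1) := by
  induction r with
  | zero =>
    intro j q _ hj _
    have : Subsingleton (G.Bd j) := by rw [G.Bd_big (by omega)]; infer_instance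
    exact ez_of_subsingleton _
  | succ r ih =>
    intro j q hcj hj hr
    refine (G.ses_ZXB j).ez_right ?_ (ez_proj _ _)
    rw [h.Z_eq hL (by omega : c < j + 1)]
    cases q with
    | zero =>
      have : Subsingleton (G.Bd (j+1)) := by rw [G.Bd_big (by omega)]; infer_instance
      exact ez_of_subsingleton _
    | succ q => exact ih (j+1) q (by omega) (by omega) (by omega)

/-- chain endomorphisms -/
structure Hom (G : GC R X L) where
  f : X →ₗ[R] X
  fd : ∀ x, f (G.d x) = G.d (f x)
  fπ : ∀ i x, f (G.π i x) = G.π i (f x)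

namespace Hom
variable (f : G.Hom)

theorem map_X {j : ℕ} : ∀ x ∈ G.Xd j, f.f x ∈ G.Xd j := by
  intro x hx
  rw [mem_Xd] at *
  rw [← f.fπ, hx]

theorem map_Z {j : ℕ} : ∀ x ∈ G.Z j, f.f x ∈ G.Z j := by
  intro x hx
  rw [mem_Z] at *
  rw [← f.fπ, hx.1, ← f.fd, hx.2, map_zero]; exact ⟨rfl, rfl⟩

theorem map_Bd {j : ℕ} : ∀ x ∈ G.Bd j, f.f x ∈ G.Bd j := by
  rintro x ⟨y, hy, rfl⟩
  exact ⟨f.f y, f.map_X y hy, (f.fd y).symm⟩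

/-- action on degree j -/
def fX (j : ℕ) : G.Xd j →ₗ[R] G.Xd j := f.f.restrict f.map_X
/-- action on cycles -/
def fZ (j : ℕ) : G.Z j →ₗ[R] G.Z j := f.f.restrict f.map_Z
/-- action on boundaries -/
def fB (j : ℕ) : G.Bd j →ₗ[R] G.Bd j := f.f.restrict f.map_Bd
/-- action on homology -/
def fH (j : ℕ) : G.H j →ₗ[R] G.H j :=
  Submodule.mapQ _ _ (f.fZ j) (fun x hx => f.map_Bd x.1 hx)
end Hom

theorem Data.nat_step (h : G.Data m c) (hL : L ≤ n) (f : G.Hom) {j q : ℕ} (hj : c < j + 1)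
    (hf : ∀ y : EX R (G.Bd j) R (q+2), pull (f.fB j) y = 0) (y : EX R (G.Bd (j+1)) R (q+1)) :
    pull (f.fB (j+1)) y = 0 := by
  have e := h.Z_eq hL hj
  have hS : SES (Submodule.inclusion ((G.Bd_le_Z (j+1)).trans (G.Z_le_Xd (j+1)))) (G.dB j) := by
    have := G.ses_ZXB j
    refine ⟨Submodule.inclusion_injective _, ?_, this.surj⟩
    intro x
    rw [this.exact x]
    constructor
    · rintro ⟨z, rfl⟩; exact ⟨⟨z.1, e.le z.2⟩, rfl⟩
    · rintro ⟨z, rfl⟩; exact ⟨⟨z.1, e.ge z.2⟩, rfl⟩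
  have h1 : delta hS (pull (f.fB (j+1)) y) = 0 := by
    rw [delta_nat hS hS (f.fB (j+1)) (f.fX (j+1)) (f.fB j) rfl, hf]
    refine LinearMap.ext fun x => Subtype.ext ?_
    exact (f.fd x.1).symm
  obtain ⟨z, hz⟩ := ct1 hS _ h1
  rw [← hz, ez_proj _ q z, pull_zero]

theorem Data.nat_B (h : G.Data m c) (hL : L ≤ n) (f : G.Hom) {i : ℕ} (hi : i + c + 2 ≤ n)
    (hf : ∀ y : EX R (G.H c) R (i+2), pull (f.fH c) y = 0) (r : ℕ) : ∀ q, q + r = i → 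
    ∀ y : EX R (G.Bd (c+r)) R (q+1), pull (f.fB (c+r)) y = 0 := by
  induction r with
  | zero =>
    rintro q rfl y
    have h1 : delta (G.ses_BZH c) (pull (f.fB c) y) = 0 := by
      rw [delta_nat (G.ses_BZH c) (G.ses_BZH c) (f.fB c) (f.fZ c) (f.fH c) rfl rfl, hf]
    obtain ⟨z, hz⟩ := ct1 (G.ses_BZH c) _ h1
    exact hz.symm.trans (by rw [h.ez_Z c q le_rfl (by omega) z, pull_zero])
  | succ r ih =>
    intro q hq y
    exact h.nat_step hL f (j := c + r) (q := q) (by omega) (ih (q+1) (by omega)) y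

theorem Data.nat_ext (h : G.Data m c) (hL : L ≤ n) (f : G.Hom) {i : ℕ} (hi : i + c + 2 ≤ n)
    (hf : ∀ y : EX R (G.H c) R (i+2), pull (f.fH c) y = 0)
    (b : X →ₗ[R] R) (hb : ∀ x, b (G.π (c+i+2) x) = b x) (hbd : ∀ x, b (G.d x) = 0) :
    ∃ b' : X →ₗ[R] R, (∀ x, b' (G.π (c+i+1) x) = b' x) ∧ ∀ x, b (f.f x) = b' (G.d x) := by
  have hB := h.nat_B hL f hi hf i 0 (by omega)
  -- factor b
  obtain ⟨β, hβ⟩ : ∃ β : G.Bd (c+i+1) →ₗ[R] R, ∀ x : G.Xd (c+i+2), β (G.dB (c+i+1) x) = b x := by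
    have hsur := (G.ses_ZXB (c+i+1)).surj
    let b0 : G.Xd (c+i+2) →ₗ[R] R := b ∘ₗ (G.Xd (c+i+2)).subtype
    have hk : LinearMap.ker (G.dB (c+i+1)) ≤ LinearMap.ker b0 := by
      intro x hx
      have hx' : x.1 ∈ G.Z (c+i+2) := ⟨x.2, congrArg Subtype.val hx⟩
      rw [h.Z_eq hL (by omega)] at hx'
      obtain ⟨y, hy, hyx⟩ := G.mem_Bd.mp hx'
      change b x.1 = 0
      rw [← hyx, hbd]
    refine ⟨(LinearMap.ker (G.dB (c+i+1))).liftQ b0 hk ∘ₗ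
      ((G.dB (c+i+1)).quotKerEquivOfSurjective hsur).symm.toLinearMap, fun x => ?_⟩
    have : ((G.dB (c+i+1)).quotKerEquivOfSurjective hsur).symm (G.dB (c+i+1) x) = Submodule.Quotient.mk x := by
      rw [LinearEquiv.symm_apply_eq]; rfl
    change (LinearMap.ker (G.dB (c+i+1))).liftQ b0 hk (((G.dB (c+i+1)).quotKerEquivOfSurjective hsur).symm (G.dB (c+i+1) x)) = _
    rw [this]; rfl
  have e := h.Z_eq hL (show c < c+i+1 by omega)
  have hS : SES (Submodule.inclusion ((G.Bd_le_Z (c+i+1)).trans (G.Z_le_Xd (c+i+1)))) (G.dB (c+i)) := by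
    have := G.ses_ZXB (c+i)
    refine ⟨Submodule.inclusion_injective _, ?_, this.surj⟩
    intro x
    rw [this.exact x]
    constructor
    · rintro ⟨z, rfl⟩; exact ⟨⟨z.1, e.le z.2⟩, rfl⟩
    · rintro ⟨z, rfl⟩; exact ⟨⟨z.1, e.ge z.2⟩, rfl⟩
  let y : EX R (G.Bd (c+i+1)) R 0 := Ext.mk₀ (ModuleCat.ofHom β)
  have h1 : delta hS (pull (f.fB (c+i+1)) y) = 0 := by
    rw [delta_nat hS hS (f.fB (c+i+1)) (f.fX (c+i+1)) (f.fB (c+i)) rfl, hB]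
    refine LinearMap.ext fun x => Subtype.ext ?_
    exact (f.fd x.1).symm
  obtain ⟨z, hz⟩ := ct1 hS _ h1
  obtain ⟨u, rfl⟩ := (Ext.mk₀_bijective _ _).2 z
  have h2 : ModuleCat.ofHom (Submodule.inclusion ((G.Bd_le_Z (c+i+1)).trans (G.Z_le_Xd (c+i+1)))) ≫ u =
      ModuleCat.ofHom (f.fB (c+i+1)) ≫ ModuleCat.ofHom β := by
    apply (Ext.mk₀_bijective _ _).1
    rw [← Ext.mk₀_comp_mk₀, ← Ext.mk₀_comp_mk₀]
    exact hz
  have h3 : ∀ w : G.Bd (c+i+1), u.hom ⟨w.1, ((G.Bd_le_Z (c+i+1)).trans (G.Z_le_Xd (c+i+1))) w.2⟩ = β (f.fB _ w) := by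
    intro w
    exact LinearMap.congr_fun (congrArg ModuleCat.Hom.hom h2) w
  refine ⟨u.hom ∘ₗ (G.π (c+i+1)).rangeRestrict, ?_, ?_⟩
  · intro x
    change u.hom ((G.π (c+i+1)).rangeRestrict _) = u.hom ((G.π (c+i+1)).rangeRestrict _)
    congr 1
    apply Subtype.ext
    change G.π _ (G.π _ x) = _
    rw [G.ππ, if_pos rfl]; rfl
  · intro x
    have hx : G.π (c+i+2) (G.π (c+i+2) x) = G.π (c+i+2) x := by rw [G.ππ, if_pos rfl]
    let x' : G.Xd (c+i+2) := ⟨G.π (c+i+2) x, ⟨x, rfl⟩⟩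
    have h4 := h3 (G.dB (c+i+1) x')
    have h5 : f.fB (c+i+1) (G.dB (c+i+1) x') = G.dB (c+i+1) (f.fX _ x') :=
      Subtype.ext (f.fd x'.1)
    rw [h5, hβ] at h4
    have h6 : b (f.fX (c+i+2) x').1 = b (f.f x) := by
      change b (f.f (G.π (c+i+2) x)) = _
      rw [f.fπ, hb]
    rw [← h6]
    refine h4.symm.trans ?_
    change _ = u.hom ((G.π (c+i+1)).rangeRestrict (G.d x))
    congr 1
    apply Subtype.ext
    change G.d (G.π (c+i+2) x) = G.π (c+i+1) (G.d x)
    rw [← G.dπ]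

end GC
end EX
end

open CategoryTheory TensorProduct
noncomputable section
namespace EX
namespace GC

variable {R : Type} [CommRing R] {m : Ideal R} {n : ℕ}
variable {X : Type} [AddCommGroup X] [Module R X] {L : ℕ} (G : GC R X L)

theorem ext_π {F : Type} [AddCommGroup F] [Module R F] {f g : X →ₗ[R] F}
    (h : ∀ p x, G.π p x = x → f x = g x) (x : X) : f x = g x := by
  rw [← G.sum x, map_sum, map_sum]
  exact Finset.sum_congr rfl fun p _ => h p _ (by rw [G.ππ, if_pos rfl])

theorem ext_tens {F : Type} [AddCommGroup F] [Module R F] {f g : X ⊗[R] X →ₗ[R] F}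
    (h : ∀ p q x y, G.π p x = x → G.π q y = y → f (x ⊗ₜ y) = g (x ⊗ₜ y)) (t : X ⊗[R] X) : f t = g t := by
  have : f = g := by
    apply TensorProduct.ext
    refine LinearMap.ext fun x => LinearMap.ext fun y => ?_
    refine G.ext_π (f := (TensorProduct.mk R X X).compr₂ f x) (g := (TensorProduct.mk R X X).compr₂ g x) ?_ y
    intro q y hy
    refine G.ext_π (f := ((TensorProduct.mk R X X).compr₂ f).flip y)
      (g := ((TensorProduct.mk R X X).compr₂ g).flip y) ?_ x
    intro p x hx
    exact h p q x y hx hy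
  rw [this]

theorem π_hom {p : ℕ} {x : X} (hx : G.π p x = x) (i : ℕ) : G.π i x = if i = p then x else 0 := by
  split_ifs with h
  · rw [h, hx]
  · exact G.π_ne h hx

theorem d_zero_of {x : X} (hx : G.π 0 x = x) : G.d x = 0 := by rw [← hx, G.dπ0]

/-- projection to the odd part -/
def ε : X →ₗ[R] X := ∑ p ∈ (Finset.range (L+1)).filter Odd, G.π p

theorem ε_hom {p : ℕ} {x : X} (hx : G.π p x = x) : G.ε x = if Odd p then x else 0 := by
  rw [ε, LinearMap.sum_apply]
  simp only [G.π_hom hx]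
  rw [Finset.sum_ite_eq']
  simp only [Finset.mem_filter, Finset.mem_range]
  by_cases hp : p < L + 1
  · simp [hp]
  · have : x = 0 := by rw [← hx, G.big p (by omega)]
    simp [this]

/-- sign -/
def sg : X →ₗ[R] X := LinearMap.id - (2 : R) • G.ε

theorem sg_hom {p : ℕ} {x : X} (hx : G.π p x = x) : G.sg x = if Odd p then -x else x := by
  simp only [sg, LinearMap.sub_apply, LinearMap.smul_apply, LinearMap.id_apply, G.ε_hom hx]
  split_ifs
  · rw [two_smul]; abel
  · simp

theorem sg_d (x : X) : G.sg (G.d x) = - G.d (G.sg x) := by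
  refine G.ext_π (f := G.sg ∘ₗ G.d) (g := - (G.d ∘ₗ G.sg)) ?_ x
  intro p x hx
  simp only [LinearMap.comp_apply, LinearMap.neg_apply]
  rcases p with _ | p
  · rw [G.sg_hom hx, G.d_zero_of hx]; simp [G.d_zero_of hx]
  · rw [G.sg_hom hx, G.sg_hom (G.d_mem hx)]
    by_cases h : Odd p <;> simp [Nat.odd_add_one, h]

theorem sg_sg (x : X) : G.sg (G.sg x) = x := by
  refine G.ext_π (f := G.sg ∘ₗ G.sg) (g := LinearMap.id) ?_ x
  intro p x hx
  simp only [LinearMap.comp_apply, LinearMap.id_apply]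
  rw [G.sg_hom hx]
  split_ifs with h
  · rw [map_neg, G.sg_hom hx, if_pos h, neg_neg]
  · rw [G.sg_hom hx, if_neg h]

/-- tensor differential -/
def dT : X ⊗[R] X →ₗ[R] X ⊗[R] X :=
  TensorProduct.map G.d LinearMap.id + TensorProduct.map G.sg G.d

theorem dT_tmul (x y : X) : G.dT (x ⊗ₜ y) = G.d x ⊗ₜ y + G.sg x ⊗ₜ G.d y := by
  simp [dT]

/-- tensor projectors -/
def πT (j : ℕ) : X ⊗[R] X →ₗ[R] X ⊗[R] X :=
  ∑ pq ∈ Finset.HasAntidiagonal.antidiagonal j, TensorProduct.map (G.π pq.1) (G.π pq.2)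

theorem πT_tmul {p q : ℕ} {x y : X} (hx : G.π p x = x) (hy : G.π q y = y) (j : ℕ) :
    G.πT j (x ⊗ₜ y) = if p + q = j then x ⊗ₜ y else 0 := by
  rw [πT, LinearMap.sum_apply]
  have : ∀ pq ∈ Finset.HasAntidiagonal.antidiagonal j, TensorProduct.map (G.π pq.1) (G.π pq.2) (x ⊗ₜ[R] y) =
      if pq = (p, q) then x ⊗ₜ y else 0 := by
    rintro ⟨a, b⟩ _
    rw [TensorProduct.map_tmul, G.π_hom hx, G.π_hom hy]
    simp only [Prod.mk.injEq]
    by_cases h1 : a = p <;> by_cases h2 : b = q <;> simp [h1, h2]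
  rw [Finset.sum_congr rfl this, Finset.sum_ite_eq']
  simp

theorem πT_of {j : ℕ} {p q : ℕ} {x y : X} (hx : G.π p x = x) (hy : G.π q y = y) (h : p + q = j) :
    G.πT j (x ⊗ₜ y) = x ⊗ₜ y := by rw [G.πT_tmul hx hy, if_pos h]

theorem sg_mem {p : ℕ} {x : X} (hx : G.π p x = x) : G.π p (G.sg x) = G.sg x := by
  rw [G.sg_hom hx]
  split_ifs
  · rw [map_neg, hx]
  · exact hx

/-- the tensor square -/
def tens : GC R (X ⊗[R] X) (2 * L) where
  d := G.dT
  π := G.πT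
  dd := by
    intro t
    refine TensorProduct.induction_on t (by simp) ?_ (fun a b ha hb => by simp [ha, hb])
    intro x y
    simp only [dT_tmul, map_add, G.dd, TensorProduct.zero_tmul, TensorProduct.tmul_zero, sg_d,
      TensorProduct.neg_tmul]
    simp
  ππ := by
    intro i j t
    by_cases hij : i = j
    · subst hij
      simp only [if_true]
      refine G.ext_tens (f := G.πT i ∘ₗ G.πT i) (g := G.πT i) ?_ t
      intro p q x y hx hy
      rw [LinearMap.comp_apply, G.πT_tmul hx hy]
      split_ifs with h
      · rw [G.πT_tmul hx hy, if_pos h]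
      · simp
    · rw [if_neg hij]
      refine G.ext_tens (f := G.πT i ∘ₗ G.πT j) (g := 0) ?_ t
      intro p q x y hx hy
      rw [LinearMap.comp_apply, G.πT_tmul hx hy]
      split_ifs with h
      · rw [G.πT_tmul hx hy, if_neg (by omega)]; simp
      · simp
  sum := by
    intro t
    have : ∀ t, (∑ i ∈ Finset.range (2*L+1), G.πT i) t = LinearMap.id (R := R) t := by
      refine G.ext_tens ?_
      intro p q x y hx hy
      rw [LinearMap.sum_apply]
      simp only [G.πT_tmul hx hy, LinearMap.id_apply]
      rw [Finset.sum_ite_eq]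
      split_ifs with h
      · rfl
      · simp at h
        by_cases hp : L < p
        · rw [← hx, G.big p hp]; simp
        · rw [← hy, G.big q (by omega)]; simp
    have := this t
    rwa [LinearMap.sum_apply] at this
  dπ := by
    intro i t
    refine G.ext_tens (f := G.dT ∘ₗ G.πT (i+1)) (g := G.πT i ∘ₗ G.dT) ?_ t
    intro p q x y hx hy
    rw [LinearMap.comp_apply, LinearMap.comp_apply, G.πT_tmul hx hy, dT_tmul, map_add]
    have h1 : G.πT i (G.d x ⊗ₜ y) = if p + q = i + 1 then G.d x ⊗ₜ y else 0 := by
      rcases p with _ | p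
      · rw [G.d_zero_of hx]; simp
      · rw [G.πT_tmul (G.d_mem hx) hy]
        congr 1
        simp only [eq_iff_iff]; omega
    have h2 : G.πT i (G.sg x ⊗ₜ G.d y) = if p + q = i + 1 then G.sg x ⊗ₜ G.d y else 0 := by
      rcases q with _ | q
      · rw [G.d_zero_of hy]; simp
      · rw [G.πT_tmul (G.sg_mem hx) (G.d_mem hy)]
        congr 1
        simp only [eq_iff_iff]; omega
    rw [h1, h2]
    split_ifs
    · rw [dT_tmul]
    · simp
  dπ0 := by
    intro t
    refine G.ext_tens (f := G.dT ∘ₗ G.πT 0) (g := 0) ?_ t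
    intro p q x y hx hy
    rw [LinearMap.comp_apply, G.πT_tmul hx hy]
    split_ifs with h
    · obtain ⟨rfl, rfl⟩ : p = 0 ∧ q = 0 := by omega
      rw [dT_tmul, G.d_zero_of hx, G.d_zero_of hy]; simp
    · simp

variable {G} {c : ℕ}

theorem HD.s_mem {a : R} (D : G.HD c a) {p : ℕ} {x : X} (hx : G.π p x = x) :
    G.π (p+1) (D.s x) = D.s x := by rw [← D.sπ, hx]

theorem HD.s_sg {a : R} (D : G.HD c a) (x : X) : G.sg (D.s x) = - D.s (G.sg x) := by
  refine G.ext_π (f := G.sg ∘ₗ D.s) (g := - (D.s ∘ₗ G.sg)) ?_ x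
  intro p x hx
  simp only [LinearMap.comp_apply, LinearMap.neg_apply]
  rw [G.sg_hom hx, G.sg_hom (D.s_mem hx)]
  by_cases h : Odd p <;> simp [Nat.odd_add_one, h]

theorem HD.e_sg {a : R} (D : G.HD c a) (x : X) : D.e (G.sg x) = if Odd c then - D.e x else D.e x := by
  have : ∀ x, (D.e ∘ₗ G.sg) x = (if Odd c then - D.e else D.e) x := by
    refine G.ext_π ?_
    intro p x hx
    simp only [LinearMap.comp_apply]
    rw [G.sg_hom hx]
    by_cases hpc : p = c
    · subst hpc
      split_ifs <;> simp
    · have h1 := D.e_ne hpc hx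
      split_ifs <;> simp [h1]
  have h2 := this x
  rw [LinearMap.comp_apply] at h2
  rw [h2]
  split_ifs <;> rfl

theorem HD.sg_e_sg {a : R} (D : G.HD c a) (x : X) : G.sg (D.e (G.sg x)) = D.e x := by
  rw [D.e_sg, ]
  split_ifs with h
  · rw [map_neg, G.sg_hom (D.πe x), if_pos h, neg_neg]
  · rw [G.sg_hom (D.πe x), if_neg h]

/-- tensor data -/
def HD.tens {a : R} (D : G.HD c a) : G.tens.HD (2*c) (a*a) where
  s := a • TensorProduct.map D.s LinearMap.id + TensorProduct.map (D.e ∘ₗ G.sg) D.s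
  e := TensorProduct.map D.e D.e
  sπ := by
    intro i t
    refine G.ext_tens (f := (a • TensorProduct.map D.s LinearMap.id + TensorProduct.map (D.e ∘ₗ G.sg) D.s) ∘ₗ G.πT i)
      (g := G.πT (i+1) ∘ₗ (a • TensorProduct.map D.s LinearMap.id + TensorProduct.map (D.e ∘ₗ G.sg) D.s)) ?_ t
    intro p q x y hx hy
    simp only [LinearMap.comp_apply, LinearMap.add_apply, LinearMap.smul_apply, map_add, map_smul,
      TensorProduct.map_tmul, LinearMap.id_apply]
    rw [G.πT_tmul (D.s_mem hx) hy, G.πT_tmul hx hy]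
    by_cases hp : p = c
    · subst hp
      rw [G.πT_tmul (D.πe (G.sg x)) (D.s_mem hy)]
      by_cases h : p + q = i
      · rw [if_pos h, if_pos (by omega), if_pos (by omega)]
        simp
      · rw [if_neg h, if_neg (by omega), if_neg (by omega)]
        simp
    · have h1 := D.e_ne hp (G.sg_mem hx)
      rw [h1]
      by_cases h : p + q = i
      · rw [if_pos h, if_pos (by omega)]
        simp [h1]
      · rw [if_neg h, if_neg (by omega)]
        simp
  hom := by
    intro t
    change G.dT _ + (a • TensorProduct.map D.s LinearMap.id + TensorProduct.map (D.e ∘ₗ G.sg) D.s : X ⊗[R] X →ₗ[R] X ⊗[R] X) (G.dT t) = _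
    refine TensorProduct.induction_on t (by simp) ?_ ?_
    · intro x y
      have hx := D.hom x
      have hy := D.hom y
      have hx' : G.d (D.s x) = a • x - D.e x - D.s (G.d x) := by rw [← hx]; abel
      have hy' : G.d (D.s y) = a • y - D.e y - D.s (G.d y) := by rw [← hy]; abel
      have h3 : D.e (G.sg (G.d x)) = 0 := by
        rw [G.sg_d, map_neg, D.ed, neg_zero]
      simp only [LinearMap.add_apply, LinearMap.smul_apply, map_add, map_smul,
        TensorProduct.map_tmul, LinearMap.id_apply, LinearMap.comp_apply, dT_tmul, D.de, h3, sg_sg,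
        D.sg_e_sg, D.s_sg, hx', hy']
      simp only [TensorProduct.sub_tmul, TensorProduct.tmul_sub, TensorProduct.neg_tmul, TensorProduct.zero_tmul,
        TensorProduct.smul_tmul', TensorProduct.tmul_smul, smul_add, smul_sub, smul_neg, mul_smul]
      abel
    · intro t t' h h'
      rw [map_add, map_add, map_add, map_add, map_add, smul_add, add_sub_add_comm, ← h, ← h']
      abel
  eπ := by
    intro t
    refine G.ext_tens (f := TensorProduct.map D.e D.e ∘ₗ G.πT (2*c)) (g := TensorProduct.map D.e D.e) ?_ t
    intro p q x y hx hy
    rw [LinearMap.comp_apply, G.πT_tmul hx hy]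
    split_ifs with h
    · rfl
    · by_cases hp : p = c
      · rw [TensorProduct.map_tmul, D.e_ne (by omega : q ≠ c) hy]; simp
      · rw [TensorProduct.map_tmul, D.e_ne hp hx]; simp
  πe := by
    intro t
    change G.πT (2*c) _ = _
    refine TensorProduct.induction_on t (by simp) ?_ (fun a b ha hb => by rw [map_add, map_add, ha, hb])
    intro x y
    rw [TensorProduct.map_tmul, G.πT_of (D.πe x) (D.πe y) (by omega)]
  de := by
    intro t
    change G.dT _ = _
    refine TensorProduct.induction_on t (by simp) ?_ (fun a b ha hb => by rw [map_add, map_add, ha, hb, add_zero])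
    intro x y
    rw [TensorProduct.map_tmul, dT_tmul, D.de, D.de]; simp
  ed := by
    intro t
    change TensorProduct.map D.e D.e (G.dT t) = 0
    refine TensorProduct.induction_on t (by simp) ?_ (fun a b ha hb => by rw [map_add, map_add, ha, hb, add_zero])
    intro x y
    rw [dT_tmul, map_add, TensorProduct.map_tmul, TensorProduct.map_tmul, D.ed, D.ed]; simp

theorem Data.tens (h : G.Data m c) : G.tens.Data m (2*c) := by
  intro p hp hpm
  obtain ⟨a, ha, ⟨D⟩⟩ := h p hp hpm
  exact ⟨a*a, fun hh => (hp.mem_or_mem hh).elim ha ha, ⟨D.tens⟩⟩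

variable (G)
/-- signed swap -/
def τ : X ⊗[R] X →ₗ[R] X ⊗[R] X :=
  (TensorProduct.comm R X X).toLinearMap ∘ₗ (LinearMap.id - (2:R) • TensorProduct.map G.ε G.ε)

theorem τ_tmul {p q : ℕ} {x y : X} (hx : G.π p x = x) (hy : G.π q y = y) :
    G.τ (x ⊗ₜ y) = if Odd p ∧ Odd q then - (y ⊗ₜ x) else y ⊗ₜ x := by
  simp only [τ, LinearMap.comp_apply, LinearMap.sub_apply, LinearMap.smul_apply, LinearMap.id_apply,
    TensorProduct.map_tmul, G.ε_hom hx, G.ε_hom hy]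
  by_cases h1 : Odd p <;> by_cases h2 : Odd q <;> simp [h1, h2]
  rw [two_smul]; abel

theorem τ_d (t : X ⊗[R] X) : G.τ (G.dT t) = G.dT (G.τ t) := by
  refine G.ext_tens (f := G.τ ∘ₗ G.dT) (g := G.dT ∘ₗ G.τ) ?_ t
  intro p q x y hx hy
  simp only [LinearMap.comp_apply, dT_tmul, map_add]
  have h1 : G.τ (G.d x ⊗ₜ y) = if ¬ Odd p ∧ Odd q then - (y ⊗ₜ G.d x) else y ⊗ₜ G.d x := by
    rcases p with _ | p
    · rw [G.d_zero_of hx]; simp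
    · rw [G.τ_tmul (G.d_mem hx) hy]; simp [Nat.odd_add_one]
  have h2 : G.τ (G.sg x ⊗ₜ G.d y) = if Odd p ∧ ¬ Odd q then - (G.d y ⊗ₜ G.sg x) else G.d y ⊗ₜ G.sg x := by
    rcases q with _ | q
    · rw [G.d_zero_of hy]; simp
    · rw [G.τ_tmul (G.sg_mem hx) (G.d_mem hy)]; simp [Nat.odd_add_one]
  rw [h1, h2, G.τ_tmul hx hy, G.sg_hom hx]
  by_cases h3 : Odd p <;> by_cases h4 : Odd q <;>
    simp [h3, h4, dT_tmul, G.sg_hom hy, TensorProduct.neg_tmul, TensorProduct.tmul_neg] <;> abel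

/-- `1 - u τ` as a chain endomorphism -/
def fτ (u : R) : G.tens.Hom where
  f := LinearMap.id - u • G.τ
  fd := by
    intro t
    change (LinearMap.id - u • G.τ : X ⊗[R] X →ₗ[R] X ⊗[R] X) (G.dT t) = G.dT ((LinearMap.id - u • G.τ : X ⊗[R] X →ₗ[R] X ⊗[R] X) t)
    simp [τ_d]
  fπ := by
    intro i t
    refine G.ext_tens (f := (LinearMap.id - u • G.τ) ∘ₗ G.πT i) (g := G.πT i ∘ₗ (LinearMap.id - u • G.τ)) ?_ t
    intro p q x y hx hy
    have h1 : G.πT i (y ⊗ₜ x) = if p + q = i then y ⊗ₜ x else 0 := by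
      rw [G.πT_tmul hy hx, add_comm]
    simp only [LinearMap.comp_apply, LinearMap.sub_apply, LinearMap.smul_apply, LinearMap.id_apply,
      map_sub, map_smul, G.τ_tmul hx hy, G.πT_tmul hx hy]
    by_cases h : p + q = i
    · rw [if_pos h] at h1 ⊢
      rw [G.τ_tmul hx hy]
      split_ifs <;> simp [h1]
    · rw [if_neg h] at h1 ⊢
      split_ifs <;> simp [h1]

end GC
end EX
end

open CategoryTheory TensorProduct
noncomputable section
namespace EX

section Lam
variable {R : Type} [CommRing R] {m : Ideal R} {n : ℕ}
variable (H : Type) [AddCommGroup H] [Module R H]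

variable (R) in
/-- second exterior power as a quotient of the tensor square -/
abbrev Lam : Type := (H ⊗[R] H) ⧸ Submodule.span R (Set.range fun x : H => x ⊗ₜ[R] x)

variable (R) in
/-- projection -/
abbrev Lam.pr : H ⊗[R] H →ₗ[R] Lam R H := Submodule.mkQ _

variable (R) in
/-- antisymmetrisation -/
def Lam.κ : Lam R H →ₗ[R] H ⊗[R] H :=
  Submodule.liftQ _ (LinearMap.id - (TensorProduct.comm R H H).toLinearMap) (by
    rw [Submodule.span_le]
    rintro _ ⟨x, rfl⟩
    simp)

theorem Lam.κ_pr (t : H ⊗[R] H) : Lam.κ R H (Lam.pr R H t) = t - TensorProduct.comm R H H t := rfl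

variable {H}
theorem Lam.self (x : H) : Lam.pr R H (x ⊗ₜ x) = 0 := by
  rw [Submodule.mkQ_apply, Submodule.Quotient.mk_eq_zero]
  exact Submodule.subset_span ⟨x, rfl⟩

theorem Lam.anti (x y : H) : Lam.pr R H (y ⊗ₜ x) = - Lam.pr R H (x ⊗ₜ y) := by
  have := Lam.self (R := R) (x + y)
  rw [TensorProduct.add_tmul, TensorProduct.tmul_add, TensorProduct.tmul_add, map_add, map_add, map_add,
    Lam.self, Lam.self, zero_add, add_zero] at this
  rw [add_comm] at this
  exact eq_neg_of_add_eq_zero_left this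

/-- determinant form -/
def detForm (u : H →ₗ[R] (Fin 2 → R)) : H ⊗[R] H →ₗ[R] R :=
  LinearMap.mul' R R ∘ₗ TensorProduct.map (LinearMap.proj 0 ∘ₗ u) (LinearMap.proj 1 ∘ₗ u) -
  LinearMap.mul' R R ∘ₗ TensorProduct.map (LinearMap.proj 1 ∘ₗ u) (LinearMap.proj 0 ∘ₗ u)

theorem detForm_tmul (u : H →ₗ[R] (Fin 2 → R)) (x y : H) :
    detForm u (x ⊗ₜ y) = u x 0 * u y 1 - u x 1 * u y 0 := by
  simp [detForm]

theorem v_expand (v : (Fin 2 → R) →ₗ[R] H) (w : Fin 2 → R) :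
    v w = w 0 • v (Pi.single 0 1) + w 1 • v (Pi.single 1 1) := by
  rw [← map_smul, ← map_smul, ← map_add]
  congr 1
  funext i
  fin_cases i <;> simp

theorem Loc.lam (h : Loc m H (Fin 2 → R)) : Loc m (Lam R H) R := by
  intro p hp hpm
  obtain ⟨a, ha, u, v, h1, h2⟩ := h p hp hpm
  refine ⟨a*a, fun hh => (hp.mem_or_mem hh).elim ha ha,
    Submodule.liftQ _ (detForm u) ?_, LinearMap.toSpanSingleton R _ (Lam.pr R H (v (Pi.single 0 1) ⊗ₜ v (Pi.single 1 1))), ?_, ?_⟩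
  · rw [Submodule.span_le]
    rintro _ ⟨x, rfl⟩
    simp only [SetLike.mem_coe, LinearMap.mem_ker, detForm_tmul]
    ring
  · intro t
    obtain ⟨t, rfl⟩ := Submodule.mkQ_surjective _ t
    change LinearMap.toSpanSingleton R _ (Lam.pr R H (v (Pi.single 0 1) ⊗ₜ v (Pi.single 1 1))) (detForm u t) = (a*a) • Lam.pr R H t
    refine TensorProduct.induction_on t (by simp) ?_ (fun a b ha hb => by simp only [map_add, ha, hb, smul_add])
    intro x y
    rw [LinearMap.toSpanSingleton_apply, detForm_tmul]
    have e1 : (a * a) • Lam.pr R H (x ⊗ₜ y) = Lam.pr R H (v (u x) ⊗ₜ v (u y)) := by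
      rw [h1, h1, TensorProduct.smul_tmul_smul, map_smul]
    rw [e1, v_expand v (u x), v_expand v (u y)]
    simp only [TensorProduct.add_tmul, TensorProduct.tmul_add, TensorProduct.smul_tmul_smul, map_add, map_smul,
      Lam.self, Lam.anti (v (Pi.single 0 1)) (v (Pi.single 1 1))]
    simp only [smul_zero, zero_add, add_zero, smul_neg, sub_smul, sub_eq_add_neg]
    rw [add_smul, neg_smul, add_comm]
  · intro y
    rw [LinearMap.toSpanSingleton_apply, map_smul]
    change y • detForm u (v (Pi.single 0 1) ⊗ₜ v (Pi.single 1 1)) = _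
    rw [detForm_tmul, h2, h2]
    simp
    ring
end Lam

namespace GC

variable {R : Type} [CommRing R] {m : Ideal R} {n : ℕ}
variable {X : Type} [AddCommGroup X] [Module R X] {L : ℕ} {G : GC R X L} {c : ℕ}

theorem HD.e_Z {a : R} (D : G.HD c a) (x : X) : D.e x ∈ G.Z c := G.mem_Z.mpr ⟨D.πe x, D.de x⟩

/-- e with values in homology -/
def HD.eb {a : R} (D : G.HD c a) : X →ₗ[R] G.H c := G.cls c ∘ₗ D.e.codRestrict (G.Z c) D.e_Z

theorem HD.eb_apply {a : R} (D : G.HD c a) (x : X) : D.eb x = G.cls c ⟨D.e x, D.e_Z x⟩ := rfl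

theorem HD.eb_d {a : R} (D : G.HD c a) (x : X) : D.eb (G.d x) = 0 := by
  rw [HD.eb_apply, cls_eq_zero]
  change D.e (G.d x) ∈ _
  rw [D.ed]; exact Submodule.zero_mem _

theorem HD.eb_Z {a : R} (D : G.HD c a) (z : G.Z c) : D.eb z = a • G.cls c z := by
  rw [HD.eb_apply, ← sub_eq_zero, ← map_smul, ← map_sub, cls_eq_zero]
  have h1 := D.hom z.1
  obtain ⟨hz1, hz2⟩ := G.mem_Z.mp z.2
  rw [hz2, map_zero, add_zero] at h1
  rw [← Submodule.neg_mem_iff]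
  refine G.mem_Bd_of (y := D.s z.1) ?_ ?_
  · simp only [Submodule.coe_sub, map_neg, map_sub, Submodule.coe_smul, map_smul, hz1, D.πe]
  · rw [h1]; simp

variable (G) in
/-- Künneth on cycles -/
def μ0 (c : ℕ) : G.Z c →ₗ[R] G.Z c →ₗ[R] G.tens.H (2*c) :=
  LinearMap.mk₂ R (fun x y => G.tens.cls (2*c) ⟨x.1 ⊗ₜ y.1, by
      obtain ⟨hx, hx'⟩ := G.mem_Z.mp x.2
      obtain ⟨hy, hy'⟩ := G.mem_Z.mp y.2
      rw [mem_Z]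
      refine ⟨G.πT_of hx hy (by omega), ?_⟩
      change G.dT _ = 0
      rw [dT_tmul, hx', hy']; simp⟩)
    (fun x x' y => by rw [← map_add]; congr 1; exact Subtype.ext (TensorProduct.add_tmul _ _ _))
    (fun r x y => by rw [← map_smul]; congr 1)
    (fun x y y' => by rw [← map_add]; congr 1; exact Subtype.ext (TensorProduct.tmul_add _ _ _))
    (fun r x y => by rw [← map_smul]; congr 1; exact Subtype.ext (TensorProduct.tmul_smul _ _ _))

theorem μ0_apply (x y : G.Z c) (h) : G.μ0 c x y = G.tens.cls (2*c) ⟨x.1 ⊗ₜ y.1, h⟩ := rfl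

theorem μ0_left (x y : G.Z c) (hx : x.1 ∈ G.Bd c) : G.μ0 c x y = 0 := by
  have h : x.1 ⊗ₜ[R] y.1 ∈ G.tens.Z (2*c) := by
    obtain ⟨hx, hx'⟩ := G.mem_Z.mp x.2
    obtain ⟨hy, hy'⟩ := G.mem_Z.mp y.2
    rw [mem_Z]
    refine ⟨G.πT_of hx hy (by omega), ?_⟩
    change G.dT _ = 0
    rw [dT_tmul, hx', hy']; simp
  rw [μ0_apply x y h, cls_eq_zero]
  obtain ⟨w, hw, hwx⟩ := G.mem_Bd.mp hx
  obtain ⟨hy, hy'⟩ := G.mem_Z.mp y.2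
  refine G.tens.mem_Bd_of (y := w ⊗ₜ y.1) (G.tens.mem_Z.mp h).1 ?_
  change G.dT _ = _
  rw [dT_tmul, hy', hwx]; simp

theorem μ0_right (x y : G.Z c) (hy0 : y.1 ∈ G.Bd c) : G.μ0 c x y = 0 := by
  have h : x.1 ⊗ₜ[R] y.1 ∈ G.tens.Z (2*c) := by
    obtain ⟨hx, hx'⟩ := G.mem_Z.mp x.2
    obtain ⟨hy, hy'⟩ := G.mem_Z.mp y.2
    rw [mem_Z]
    refine ⟨G.πT_of hx hy (by omega), ?_⟩
    change G.dT _ = 0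
    rw [dT_tmul, hx', hy']; simp
  rw [μ0_apply x y h, cls_eq_zero]
  obtain ⟨w, hw, hwy⟩ := G.mem_Bd.mp hy0
  obtain ⟨hx, hx'⟩ := G.mem_Z.mp x.2
  refine G.tens.mem_Bd_of (y := G.sg x.1 ⊗ₜ w) (G.tens.mem_Z.mp h).1 ?_
  change G.dT _ = _
  have : G.d (G.sg x.1) = 0 := by
    have := G.sg_d x.1
    rw [hx', map_zero] at this
    exact neg_eq_zero.mp this.symm
  rw [dT_tmul, this, hwy, G.sg_sg]; simp

variable (G) in
/-- Künneth map -/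
def μ (c : ℕ) : G.H c ⊗[R] G.H c →ₗ[R] G.tens.H (2*c) :=
  TensorProduct.lift
    (Submodule.liftQ _ (Submodule.liftQ ((G.Bd c).comap (G.Z c).subtype) (G.μ0 c).flip (by
      intro y hy
      refine LinearMap.ext fun x => μ0_right x y hy)).flip (by
      intro x hx
      refine LinearMap.ext fun y => ?_
      obtain ⟨y, rfl⟩ := G.cls_surj c y
      exact μ0_left x y hx))

theorem μ_cls (x y : G.Z c) : G.μ c (G.cls c x ⊗ₜ G.cls c y) = G.μ0 c x y := rfl

theorem μ_eb {a : R} (D : G.HD c a) (t : X ⊗[R] X) :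
    G.μ c (TensorProduct.map D.eb D.eb t) = D.tens.eb t := by
  refine TensorProduct.induction_on t (by simp) ?_ (fun a b ha hb => by simp only [map_add, ha, hb])
  intro x y
  rfl

theorem HD.μ_inv {a : R} (D : G.HD c a) : ∃ ν : G.tens.H (2*c) →ₗ[R] G.H c ⊗[R] G.H c,
    (∀ x, ν (G.μ c x) = (a*a) • x) ∧ ∀ y, G.μ c (ν y) = (a*a) • y := by
  refine ⟨Submodule.liftQ _ (TensorProduct.map D.eb D.eb ∘ₗ (G.tens.Z (2*c)).subtype) ?_, ?_, ?_⟩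
  · intro x hx
    obtain ⟨w, hw, hwx⟩ := G.tens.mem_Bd.mp hx
    change TensorProduct.map D.eb D.eb x.1 = 0
    rw [Submodule.subtype_apply] at hwx
    rw [← hwx]
    change TensorProduct.map D.eb D.eb (G.dT w) = 0
    refine TensorProduct.induction_on w (by simp) ?_ (fun a b ha hb => by simp only [map_add, ha, hb, add_zero])
    intro x y
    rw [dT_tmul, map_add, TensorProduct.map_tmul, TensorProduct.map_tmul, D.eb_d, D.eb_d]; simp
  · intro t
    refine TensorProduct.induction_on t (by simp) ?_ (fun a b ha hb => by simp only [map_add, ha, hb, smul_add])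
    intro x y
    obtain ⟨x, rfl⟩ := G.cls_surj c x
    obtain ⟨y, rfl⟩ := G.cls_surj c y
    change TensorProduct.map D.eb D.eb (x.1 ⊗ₜ y.1) = _
    rw [TensorProduct.map_tmul, D.eb_Z, D.eb_Z, TensorProduct.smul_tmul_smul]
  · intro y
    obtain ⟨y, rfl⟩ := G.tens.cls_surj _ y
    change G.μ c (TensorProduct.map D.eb D.eb y.1) = _
    rw [μ_eb, D.tens.eb_Z]

theorem Data.μ_UI (h : G.Data m c) : UI m (G.μ c) := by
  apply UI.of_inv
  intro p hp hpm
  obtain ⟨a, ha, ⟨D⟩⟩ := h p hp hpm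
  exact ⟨a*a, fun hh => (hp.mem_or_mem hh).elim ha ha, D.μ_inv⟩

/-- the sign -/
def sgn (R : Type) [CommRing R] (c : ℕ) : R := if Odd c then -1 else 1

theorem fτ_μ [IsNoetherianRing R] [Module.Finite R X] [Module.Projective R X] (t : G.H c ⊗[R] G.H c) : (G.fτ (sgn R c)).fH (2*c) (G.μ c t) =
    G.μ c (Lam.κ R _ (Lam.pr R _ t)) := by
  rw [Lam.κ_pr]
  refine TensorProduct.induction_on t (by simp) ?_ (fun a b ha hb => by simp only [map_add, ha, hb, map_sub]; abel)
  intro x y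
  obtain ⟨x, rfl⟩ := G.cls_surj c x
  obtain ⟨y, rfl⟩ := G.cls_surj c y
  rw [TensorProduct.comm_tmul, map_sub, μ_cls, μ_cls]
  have hx := (G.mem_Z.mp x.2).1
  have hy := (G.mem_Z.mp y.2).1
  change G.tens.cls (2*c) _ = G.tens.cls (2*c) _ - G.tens.cls (2*c) _
  rw [← map_sub]
  congr 1
  apply Subtype.ext
  change (LinearMap.id - sgn R c • G.τ : X ⊗[R] X →ₗ[R] X ⊗[R] X) (x.1 ⊗ₜ y.1) = x.1 ⊗ₜ y.1 - y.1 ⊗ₜ x.1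
  rw [LinearMap.sub_apply, LinearMap.smul_apply, G.τ_tmul hx hy, sgn]
  by_cases h : Odd c <;> simp [h]

variable [IsNoetherianRing R] [IsDomain R] [UniqueFactorizationMonoid R] [HT m n]
  [Module.Finite R X] [Module.Projective R X]

theorem Data.skew (h : G.Data m c) (hm0 : m ≠ ⊥) (hH : Loc m (G.H c) (Fin 2 → R)) {i : ℕ} (hi : i + 2 ≤ n)
    (y : EX R (G.tens.H (2*c)) R (i+1)) : pull ((G.fτ (sgn R c)).fH (2*c)) y = 0 := by
  apply h.μ_UI.inj (n := n) (by omega)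
  rw [pull_pull]
  have : (G.fτ (sgn R c)).fH (2*c) ∘ₗ G.μ c = G.μ c ∘ₗ Lam.κ R _ ∘ₗ Lam.pr R _ := 
    LinearMap.ext fun t => fτ_μ t
  rw [this, ← pull_pull, ← pull_pull, hH.lam.ez_one (n := n) hm0 hi (pull _ (pull _ y)), pull_zero]

end GC
end EX
end

open CategoryTheory TensorProduct
noncomputable section
namespace EX
namespace GC
section bc
variable {R : Type} [CommRing R]
variable {X : Type} [AddCommGroup X] [Module R X] {L : ℕ} (G : GC R X L) {c : ℕ}
variable (A : Type) [CommRing A] [Algebra R A]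

/-- base change -/
def bc : GC A (A ⊗[R] X) L where
  d := G.d.baseChange A
  π := fun i => (G.π i).baseChange A
  dd := by
    intro t
    refine TensorProduct.induction_on t (by simp) ?_ (fun a b ha hb => by simp only [map_add, ha, hb, add_zero])
    intro x y; simp [G.dd]
  ππ := by
    intro i j t
    refine TensorProduct.induction_on t (by simp) ?_ (fun a b ha hb => by
      simp only [map_add, ha, hb]; split_ifs <;> simp)
    intro x y
    simp only [LinearMap.baseChange_tmul, G.ππ]
    split_ifs <;> simp
  sum := by
    intro t
    refine TensorProduct.induction_on t (by simp) ?_ (fun a b ha hb => by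
      simp only [map_add, Finset.sum_add_distrib, ha, hb])
    intro x y
    simp only [LinearMap.baseChange_tmul]
    rw [← TensorProduct.tmul_sum, G.sum]
  dπ := by
    intro i t
    refine TensorProduct.induction_on t (by simp) ?_ (fun a b ha hb => by simp only [map_add, ha, hb])
    intro x y; simp [G.dπ]
  dπ0 := by
    intro t
    refine TensorProduct.induction_on t (by simp) ?_ (fun a b ha hb => by simp only [map_add, ha, hb, add_zero])
    intro x y; simp [G.dπ0]

variable {G}
/-- base change of data -/
def HD.bc {a : R} (D : G.HD c a) : (G.bc A).HD c (algebraMap R A a) where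
  s := D.s.baseChange A
  e := D.e.baseChange A
  sπ := by
    intro i t
    change D.s.baseChange A ((G.π i).baseChange A t) = (G.π (i+1)).baseChange A (D.s.baseChange A t)
    refine TensorProduct.induction_on t (by simp) ?_ (fun a b ha hb => by simp only [map_add, ha, hb])
    intro x y; simp [D.sπ]
  hom := by
    intro t
    change G.d.baseChange A (D.s.baseChange A t) + D.s.baseChange A (G.d.baseChange A t) = _
    refine TensorProduct.induction_on t (by simp) ?_ (fun a b ha hb => by
      simp only [map_add, smul_add]
      rw [add_sub_add_comm, ← ha, ← hb]; abel)
    intro x y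
    simp only [LinearMap.baseChange_tmul]
    rw [← TensorProduct.tmul_add, D.hom, TensorProduct.tmul_sub, TensorProduct.tmul_smul, algebraMap_smul]
  eπ := by
    intro t
    change D.e.baseChange A ((G.π c).baseChange A t) = _
    refine TensorProduct.induction_on t (by simp) ?_ (fun a b ha hb => by simp only [map_add, ha, hb])
    intro x y; simp [D.eπ]
  πe := by
    intro t
    change (G.π c).baseChange A (D.e.baseChange A t) = _
    refine TensorProduct.induction_on t (by simp) ?_ (fun a b ha hb => by simp only [map_add, ha, hb])
    intro x y; simp [D.πe]
  de := by
    intro t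
    change G.d.baseChange A (D.e.baseChange A t) = _
    refine TensorProduct.induction_on t (by simp) ?_ (fun a b ha hb => by simp only [map_add, ha, hb, add_zero])
    intro x y; simp [D.de]
  ed := by
    intro t
    change D.e.baseChange A (G.d.baseChange A t) = _
    refine TensorProduct.induction_on t (by simp) ?_ (fun a b ha hb => by simp only [map_add, ha, hb, add_zero])
    intro x y; simp [D.ed]

theorem bc_mem_Z (z : G.Z c) : (1 : A) ⊗ₜ[R] z.1 ∈ (G.bc A).Z c := by
  obtain ⟨h1, h2⟩ := G.mem_Z.mp z.2
  rw [mem_Z]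
  change (G.π c).baseChange A _ = _ ∧ G.d.baseChange A _ = 0
  simp [h1, h2]

/-- cycles to base-changed homology -/
def φ0 (c : ℕ) : G.Z c →ₗ[R] (G.bc A).H c where
  toFun z := (G.bc A).cls c ⟨1 ⊗ₜ z.1, bc_mem_Z A z⟩
  map_add' x y := by rw [← map_add]; congr 1; exact Subtype.ext (TensorProduct.tmul_add _ _ _)
  map_smul' r x := by
    refine congrArg ((G.bc A).cls c) (a₁ := ⟨1 ⊗ₜ (r • x).1, bc_mem_Z A (r • x)⟩) (a₂ := r • ⟨1 ⊗ₜ x.1, bc_mem_Z A x⟩) (Subtype.ext ?_)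
    exact TensorProduct.tmul_smul r (1 : A) x.1

/-- comparison of homologies -/
def φ (c : ℕ) : A ⊗[R] G.H c →ₗ[A] (G.bc A).H c :=
  LinearMap.liftBaseChange A (Submodule.liftQ _ (φ0 A c) (by
    intro z hz
    obtain ⟨w, hw, hwz⟩ := G.mem_Bd.mp hz
    change (G.bc A).cls c ⟨1 ⊗ₜ z.1, bc_mem_Z A z⟩ = 0
    rw [cls_eq_zero]
    refine (G.bc A).mem_Bd_of (y := 1 ⊗ₜ w) ((G.bc A).mem_Z.mp (bc_mem_Z A z)).1 ?_
    change G.d.baseChange A _ = _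
    rw [LinearMap.baseChange_tmul, hwz]; rfl))

theorem φ_tmul (a : A) (z : G.Z c) : φ A c (a ⊗ₜ G.cls c z) = a • (G.bc A).cls c ⟨1 ⊗ₜ z.1, bc_mem_Z A z⟩ := by
  rw [φ, LinearMap.liftBaseChange_tmul]; rfl

theorem φ_eb {a : R} (D : G.HD c a) (t : A ⊗[R] X) : φ A c (D.eb.baseChange A t) = (D.bc A).eb t := by
  refine TensorProduct.induction_on t (by simp) ?_ (fun a b ha hb => by simp only [map_add, ha, hb])
  intro r x
  rw [LinearMap.baseChange_tmul, D.eb_apply, φ_tmul, ← map_smul, HD.eb_apply]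
  congr 1
  apply Subtype.ext
  change r • ((1:A) ⊗ₜ[R] D.e x) = D.e.baseChange A (r ⊗ₜ x)
  rw [LinearMap.baseChange_tmul, TensorProduct.smul_tmul', smul_eq_mul, mul_one]

theorem HD.φ_inv {a : R} (D : G.HD c a) : ∃ ν : (G.bc A).H c →ₗ[A] A ⊗[R] G.H c,
    (∀ x, ν (φ A c x) = (algebraMap R A a) • x) ∧ ∀ y, φ A c (ν y) = (algebraMap R A a) • y := by
  refine ⟨Submodule.liftQ _ (D.eb.baseChange A ∘ₗ ((G.bc A).Z c).subtype) ?_, ?_, ?_⟩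
  · intro x hx
    obtain ⟨w, hw, hwx⟩ := (G.bc A).mem_Bd.mp hx
    change D.eb.baseChange A x.1 = 0
    rw [Submodule.subtype_apply] at hwx
    rw [← hwx]
    change D.eb.baseChange A (G.d.baseChange A w) = 0
    refine TensorProduct.induction_on w (by simp) ?_ (fun a b ha hb => by simp only [map_add, ha, hb, add_zero])
    intro x y
    simp [D.eb_d]
  · intro t
    refine TensorProduct.induction_on t (by simp) ?_ (fun a b ha hb => by simp only [map_add, ha, hb, smul_add])
    intro r y
    obtain ⟨y, rfl⟩ := G.cls_surj c y
    rw [φ_tmul, map_smul]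
    change r • D.eb.baseChange A ((1:A) ⊗ₜ y.1) = _
    rw [LinearMap.baseChange_tmul, D.eb_Z, TensorProduct.tmul_smul, TensorProduct.smul_tmul', TensorProduct.smul_tmul',
      TensorProduct.smul_tmul']
    congr 1
    rw [Algebra.smul_def]
    simp [Algebra.smul_def, mul_comm]
  · intro y
    obtain ⟨y, rfl⟩ := (G.bc A).cls_surj _ y
    change φ A c (D.eb.baseChange A y.1) = _
    rw [φ_eb, (D.bc A).eb_Z]
end bc
end GC

section Fr
variable (R : Type) [CommRing R] 
/-- target of Frobenius -/
def Fr : Type := R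
instance : CommRing (Fr R) := inferInstanceAs (CommRing R)
instance [IsNoetherianRing R] : IsNoetherianRing (Fr R) := inferInstanceAs (IsNoetherianRing R)
instance [CharP R 2] : Algebra R (Fr R) :=
  RingHom.toAlgebra (show R →+* R from frobenius R 2)

theorem Fr.algebraMap_eq [CharP R 2] (a : R) : algebraMap R (Fr R) a = (show Fr R from (a * a : R)) := by
  change frobenius R 2 a = _
  rw [frobenius_def]; exact pow_two a

variable [CharP R 2] (H : Type) [AddCommGroup H] [Module R H]
/-- Frobenius twist -/
def FT : Type := Fr R ⊗[R] H
instance : AddCommGroup (FT R H) := inferInstanceAs (AddCommGroup (Fr R ⊗[R] H))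
instance : Module R (FT R H) := inferInstanceAs (Module (Fr R) (Fr R ⊗[R] H))
instance [Module.Finite R H] : Module.Finite R (FT R H) := inferInstanceAs (Module.Finite (Fr R) (Fr R ⊗[R] H))

variable {R H} {m : Ideal R} {n : ℕ}

/-- Symmetric square -/
abbrev Qs (R H : Type) [CommRing R] [AddCommGroup H] [Module R H] : Type := (H ⊗[R] H) ⧸ LinearMap.range (Lam.κ R H)

/-- projection -/
abbrev Qs.pr (R H : Type) [CommRing R] [AddCommGroup H] [Module R H] : H ⊗[R] H →ₗ[R] Qs R H := Submodule.mkQ _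

theorem Qs.symm (x y : H) : Qs.pr R H (x ⊗ₜ y) = Qs.pr R H (y ⊗ₜ x) := by
  rw [← sub_eq_zero, ← map_sub, Submodule.mkQ_apply, Submodule.Quotient.mk_eq_zero]
  exact ⟨Lam.pr R H (x ⊗ₜ y), by rw [Lam.κ_pr, TensorProduct.comm_tmul]⟩

theorem two_smul_zero {M : Type} [AddCommGroup M] [Module R M] (x : M) : x + x = 0 := by
  rw [← two_smul R, CharTwo.two_eq_zero, zero_smul]

theorem Qs.sq_add (x y : H) : Qs.pr R H ((x + y) ⊗ₜ (x + y)) = Qs.pr R H (x ⊗ₜ x) + Qs.pr R H (y ⊗ₜ y) := by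
  rw [TensorProduct.add_tmul, TensorProduct.tmul_add, TensorProduct.tmul_add, map_add, map_add, map_add,
    Qs.symm y x]
  have := two_smul_zero (R := R) (Qs.pr R H (x ⊗ₜ y))
  rw [add_assoc, ← add_assoc (Qs.pr R H (x ⊗ₜ y)), this, zero_add]

variable (R H) in
/-- squares, additive version -/
def σ0 : Fr R ⊗[R] H →+ Qs R H :=
  TensorProduct.liftAddHom
    { toFun := fun a => 
        { toFun := fun x => (show R from a) • Qs.pr R H (x ⊗ₜ x)
          map_zero' := by rw [TensorProduct.tmul_zero, map_zero]; exact smul_zero (M := R) _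
          map_add' := fun x y => by rw [Qs.sq_add]; exact smul_add (M := R) _ _ _ }
      map_zero' := by ext x; exact zero_smul R _
      map_add' := fun a b => by ext x; exact add_smul (R := R) _ _ _ }
    (by
      intro r a x
      change (show R from r • a) • Qs.pr R H (x ⊗ₜ x) = (show R from a) • Qs.pr R H ((r • x) ⊗ₜ (r • x))
      rw [TensorProduct.smul_tmul_smul, map_smul, smul_smul]
      congr 1
      rw [Algebra.smul_def, Fr.algebraMap_eq]
      exact mul_comm _ _)

/-- pure tensor in the twist -/
def ft (r : R) (x : H) : FT R H := (show Fr R from r) ⊗ₜ[R] x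

theorem ft_ind {P : FT R H → Prop} (h0 : P 0) (h1 : ∀ r x, P (ft r x)) (h2 : ∀ a b, P a → P b → P (a + b)) (t : FT R H) : P t :=
  TensorProduct.induction_on (motive := P) t h0 h1 h2

theorem smul_ft (a r : R) (x : H) : a • ft r x = ft (a * r) x := rfl
theorem ft_add (r : R) (x y : H) : ft r (x + y) = ft r x + ft r y := TensorProduct.tmul_add (R := R) (show Fr R from r) x y
theorem add_ft (r r' : R) (x : H) : ft (r + r') x = ft r x + ft r' x := TensorProduct.add_tmul (R := R) (show Fr R from r) (show Fr R from r') x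
theorem ft_smul (r s : R) (x : H) : ft r (s • x) = ft (s * s * r) x := by
  unfold ft
  rw [← TensorProduct.smul_tmul, Algebra.smul_def, Fr.algebraMap_eq]; rfl

variable (R H) in
/-- squares -/
def σ : FT R H →ₗ[R] Qs R H where
  toFun := σ0 R H
  map_add' := map_add (σ0 R H)
  map_smul' r t := by
    have e0 : (σ0 R H) (0 : FT R H) = 0 := map_zero (σ0 R H)
    have ea : ∀ a b : FT R H, (σ0 R H) (a + b : FT R H) = σ0 R H a + σ0 R H b := map_add (σ0 R H)
    refine ft_ind (P := fun t => σ0 R H (r • t : FT R H) = r • σ0 R H t) ?_ ?_ ?_ t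
    · have : r • (0 : FT R H) = 0 := smul_zero r
      refine (congrArg (σ0 R H) this).trans ?_
      refine e0.trans ?_
      exact (smul_zero (A := Qs R H) r).symm.trans (congrArg (fun z : Qs R H => r • z) e0.symm)
    · intro s x
      exact mul_smul (α := R) r s (Qs.pr R H (x ⊗ₜ x))
    · intro a b ha hb
      have : r • (a + b : FT R H) = r • a + r • b := smul_add r a b
      refine (congrArg (σ0 R H) this).trans ?_
      refine (ea _ _).trans ?_
      refine (congrArg₂ (· + ·) ha hb).trans ?_
      exact (smul_add (A := Qs R H) r _ _).symm.trans (congrArg (fun z : Qs R H => r • z) (ea a b).symm)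

theorem σ_ft (r : R) (x : H) : σ R H (ft r x) = r • Qs.pr R H (x ⊗ₜ x) := rfl

/-- square of a functional -/
def χ (l : H →ₗ[R] R) : Qs R H →ₗ[R] R :=
  Submodule.liftQ _ (LinearMap.mul' R R ∘ₗ TensorProduct.map l l) (by
    rintro _ ⟨t, rfl⟩
    obtain ⟨t, rfl⟩ := Submodule.mkQ_surjective _ t
    rw [LinearMap.mem_ker, Lam.κ_pr]
    refine TensorProduct.induction_on t (by simp) ?_ (fun a b ha hb => by
      rw [map_add, add_sub_add_comm, map_add, ha, hb, add_zero])
    intro x y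
    simp [mul_comm])

theorem χ_pr (l : H →ₗ[R] R) (x y : H) : χ l (Qs.pr R H (x ⊗ₜ y)) = l x * l y := by
  change LinearMap.mul' R R (TensorProduct.map l l (x ⊗ₜ y)) = _
  simp

theorem σ_ker (hH : Loc m H (Fin 2 → R)) : LTo m (LinearMap.ker (σ R H)) := by
  intro p hp hpm
  obtain ⟨a, ha, u, v, h1, h2⟩ := hH p hp hpm
  refine ⟨a*a, fun hh => (hp.mem_or_mem hh).elim ha ha, ?_⟩
  have key : ∀ t : FT R H, (a*a) • t = (χ (LinearMap.proj 0 ∘ₗ u) (σ R H t)) • ft 1 (v (Pi.single 0 1)) +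
      (χ (LinearMap.proj 1 ∘ₗ u) (σ R H t)) • ft 1 (v (Pi.single 1 1)) := by
    intro t
    refine ft_ind (P := fun t => (a*a) • t = (χ (LinearMap.proj 0 ∘ₗ u) (σ R H t)) • ft 1 (v (Pi.single 0 1)) +
      (χ (LinearMap.proj 1 ∘ₗ u) (σ R H t)) • ft 1 (v (Pi.single 1 1))) (by simp) ?_ ?_ t
    · intro r x
      rw [smul_ft, ← ft_smul, ← h1, v_expand v (u x), ft_add, ft_smul, ft_smul, σ_ft, map_smul, map_smul, χ_pr, χ_pr,
        smul_ft, smul_ft]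
      simp only [smul_eq_mul, mul_one]
      congr 2 <;> exact mul_comm _ _
    · intro x y hx hy
      rw [smul_add, hx, hy]
      simp only [map_add, add_smul]
      abel
  rintro ⟨t, ht⟩
  apply Subtype.ext
  change (a*a) • t = 0
  rw [key, LinearMap.mem_ker.mp ht]
  simp

theorem κ_ker {R H : Type} [CommRing R] [AddCommGroup H] [Module R H] {m : Ideal R} (hH : Loc m H (Fin 2 → R)) : LTo m (LinearMap.ker (Lam.κ R H)) := by
  intro p hp hpm
  obtain ⟨a, ha, u, v, h1, h2⟩ := hH p hp hpm
  refine ⟨a*a, fun hh => (hp.mem_or_mem hh).elim ha ha, ?_⟩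
  have key : ∀ t : Lam R H, (a*a) • t = (LinearMap.mul' R R (TensorProduct.map (LinearMap.proj 0 ∘ₗ u) (LinearMap.proj 1 ∘ₗ u) (Lam.κ R H t))) • 
      (Lam.pr R H (v (Pi.single 0 1) ⊗ₜ v (Pi.single 1 1))) := by
    intro t
    obtain ⟨t, rfl⟩ := Submodule.mkQ_surjective _ t
    rw [Lam.κ_pr]
    refine TensorProduct.induction_on t (by simp) ?_ (fun a b ha hb => by
      rw [map_add, smul_add, ha, hb, map_add, add_sub_add_comm, map_add, map_add, add_smul])
    intro x y
    have e1 : (a * a) • Lam.pr R H (x ⊗ₜ y) = Lam.pr R H (v (u x) ⊗ₜ v (u y)) := by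
      rw [h1, h1, TensorProduct.smul_tmul_smul, map_smul]
    rw [e1, v_expand v (u x), v_expand v (u y)]
    simp only [TensorProduct.add_tmul, TensorProduct.tmul_add, TensorProduct.smul_tmul_smul, map_add, map_smul,
      Lam.self, Lam.anti (v (Pi.single 0 1)) (v (Pi.single 1 1))]
    simp [sub_smul]
    rw [mul_comm (u x 1)]
    abel
  rintro ⟨t, ht⟩
  apply Subtype.ext
  change (a*a) • t = 0
  rw [key, LinearMap.mem_ker.mp ht]
  simp

theorem Qs_le : LinearMap.range (Lam.κ R H) ≤ Submodule.span R (Set.range fun x : H => x ⊗ₜ[R] x) := by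
  rintro _ ⟨t, rfl⟩
  obtain ⟨t, rfl⟩ := Submodule.mkQ_surjective _ t
  rw [Lam.κ_pr]
  refine TensorProduct.induction_on t (by simp) ?_ (fun a b ha hb => by
      rw [map_add, add_sub_add_comm]; exact Submodule.add_mem _ ha hb)
  intro x y
  have : x ⊗ₜ[R] y - TensorProduct.comm R H H (x ⊗ₜ y) = (x + y) ⊗ₜ (x+y) - x ⊗ₜ x - y ⊗ₜ y - (y ⊗ₜ x + y ⊗ₜ x) := by
    rw [TensorProduct.comm_tmul, TensorProduct.add_tmul, TensorProduct.tmul_add, TensorProduct.tmul_add]; abel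
  rw [this, two_smul_zero (R := R), sub_zero]
  exact Submodule.sub_mem _ (Submodule.sub_mem _ (Submodule.subset_span ⟨_, rfl⟩) (Submodule.subset_span ⟨_, rfl⟩)) (Submodule.subset_span ⟨_, rfl⟩)

theorem ses_Qs : SES (LinearMap.range (σ R H)).subtype (Submodule.factor (Qs_le (R := R) (H := H))) := by
  refine ⟨Subtype.val_injective, ?_, ?_⟩
  · intro q
    constructor
    · intro hq
      obtain ⟨t, rfl⟩ := Submodule.mkQ_surjective _ q
      have ht : t ∈ Submodule.span R (Set.range fun x : H => x ⊗ₜ[R] x) :=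
        (Submodule.Quotient.mk_eq_zero _).mp hq
      have : Submodule.span R (Set.range fun x : H => x ⊗ₜ[R] x) ≤ (LinearMap.range (σ R H)).comap (Qs.pr R H) := by
        rw [Submodule.span_le]
        rintro _ ⟨x, rfl⟩
        exact ⟨ft 1 x, by rw [σ_ft, one_smul]⟩
      exact ⟨⟨_, this ht⟩, rfl⟩
    · rintro ⟨⟨_, t, rfl⟩, rfl⟩
      refine ft_ind (P := fun t => Submodule.factor (Qs_le (R := R) (H := H)) (σ R H t) = 0) (by simp) ?_ ?_ t
      · intro r x
        rw [σ_ft, map_smul]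
        have : Submodule.factor (Qs_le (R := R) (H := H)) (Qs.pr R H (x ⊗ₜ x)) = 0 := Lam.self x
        rw [this, smul_zero]
      · intro x y hx hy
        rw [map_add, map_add, hx, hy, add_zero]
  · intro w
    obtain ⟨t, rfl⟩ := Submodule.mkQ_surjective _ w
    exact ⟨Qs.pr R H t, rfl⟩

theorem ez_HH [IsNoetherianRing R] [IsDomain R] [UniqueFactorizationMonoid R] [HT m n] [Module.Finite R H] (hm0 : m ≠ ⊥)
    (hH : Loc m H (Fin 2 → R)) {j : ℕ} (hj : 1 ≤ j) (hi : j + 1 ≤ n) (hF : EZ R (FT R H) R j) : EZ R (H ⊗[R] H) R j := by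
  obtain ⟨i, rfl⟩ : ∃ i, j = i + 1 := ⟨j - 1, by omega⟩
  have hΛ : EZ R (Lam R H) R (i+1) := hH.lam.ez_one (n := n) hm0 hi
  have h1 : EZ R (LinearMap.range (Lam.κ R H)) R (i+1) :=
    (ses_ker_range (Lam.κ R H)).ez_right ((κ_ker hH).ez (n := n) R (by omega)) hΛ
  refine (ses_mkQ (LinearMap.range (Lam.κ R H))).ez_mid h1 ?_
  have h2 : EZ R (LinearMap.range (σ R H)) R (i+1) :=
    (ses_ker_range (σ R H)).ez_right ((σ_ker hH).ez (n := n) R (by omega)) hF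
  exact ses_Qs.ez_mid h2 hΛ

variable {X : Type} [AddCommGroup X] [Module R X] {c : ℕ} {G : GC R X (2*c)}

theorem GC.Data.ez_FT [IsNoetherianRing R] [hT : HT m n] [Module.Finite R X] [Module.Projective R X]
    (h : G.Data m c) (hc : 1 ≤ c) (hn : 4 * c ≤ n) : EZ R (FT R (G.H c)) R (2*c) := by
  let m' : Ideal (Fr R) := m
  have : HT m' n := hT
  have hD : (G.bc (Fr R)).Data m' c := by
    intro p hp hpm
    obtain ⟨a, ha, ⟨D⟩⟩ := h p hp hpm
    refine ⟨algebraMap R (Fr R) a, ?_, ⟨D.bc (Fr R)⟩⟩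
    rw [Fr.algebraMap_eq]
    exact fun hh => ((Ideal.IsPrime.mem_or_mem (I := p) hp hh)).elim ha ha
  have hφ : UI m' (GC.φ (G := G) (Fr R) c) := by
    apply UI.of_inv
    intro p hp hpm
    obtain ⟨a, ha, ⟨D⟩⟩ := h p hp hpm
    refine ⟨algebraMap R (Fr R) a, ?_, D.φ_inv (Fr R)⟩
    rw [Fr.algebraMap_eq]
    exact fun hh => ((Ideal.IsPrime.mem_or_mem (I := p) hp hh)).elim ha ha
  obtain ⟨c, rfl⟩ : ∃ c', c = c' + 1 := ⟨c - 1, by omega⟩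
  have e1 : EZ (Fr R) ((G.bc (Fr R)).Bd (c+1)) (Fr R) (2*c+1) :=
    hD.ez_Bd (n := n) (by omega) (c+1) (c+1) (2*c) le_rfl (by omega) (by omega)
  have e2 : EZ (Fr R) ((G.bc (Fr R)).Z (c+1)) (Fr R) (2*c+1+1) :=
    hD.ez_Z (n := n) (c+1) (2*c+1) le_rfl (by omega)
  have e3 : EZ (Fr R) ((G.bc (Fr R)).H (c+1)) (Fr R) (2*c+1+1) := ((G.bc (Fr R)).ses_BZH (c+1)).ez_right e1 e2
  have e4 : EZ (Fr R) (Fr R ⊗[R] G.H (c+1)) (Fr R) (2*c+1+1) := hφ.ez_left (n := n) (by omega) e3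
  exact e4

theorem GC.Data.ez2 [IsNoetherianRing R] [IsDomain R] [UniqueFactorizationMonoid R] [hT : HT m n] [Module.Finite R X] [Module.Projective R X]
    (h : G.Data m c) (hm0 : m ≠ ⊥) (hH : Loc m (G.H c) (Fin 2 → R)) (hc : 1 ≤ c) (hn : 4 * c ≤ n) : 
    EZ R (G.tens.H (2*c)) R (2*c) := by
  refine h.μ_UI.ez_right (n := n) (by omega) ?_
  have h2 := h.ez_FT (n := n) hc hn
  exact ez_HH (n := n) hm0 hH (by omega) (by omega) h2
end Fr
end EX
end

open CategoryTheory TensorProduct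
noncomputable section
namespace EX

section E
variable {R : Type} [CommRing R] {m : Ideal R} {n : ℕ}
variable {P X : Type} [AddCommGroup P] [Module R P] [AddCommGroup X] [Module R X]

/-- functional preserves I-multiples -/
theorem mem_of_smul_top (I : Ideal R) (l : X →ₗ[R] R) {x : X} (hx : x ∈ I • (⊤ : Submodule R X)) : l x ∈ I := by
  refine Submodule.smul_induction_on hx ?_ ?_
  · intro r hr y _
    rw [map_smul, smul_eq_mul]
    exact I.mul_mem_right _ hr
  · intro x y hx hy
    rw [map_add]; exact I.add_mem hx hy

variable (R P) in
theorem dual_basis [Module.Finite R P] [Module.Projective R P] : ∃ (c : ℕ) (p : Fin c → P) (l : Fin c → (P →ₗ[R] R)),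
    ∀ x, x = ∑ i, l i x • p i := by
  obtain ⟨c, f, g, hf, hg, hfg⟩ := Module.Finite.exists_comp_eq_id_of_projective R P
  refine ⟨c, fun i => f (Pi.single i 1), fun i => LinearMap.proj i ∘ₗ g, fun x => ?_⟩
  have h1 : f (g x) = x := LinearMap.congr_fun hfg x
  conv_lhs => rw [← h1]
  have h2 : g x = ∑ i, (g x i) • (Pi.single i 1 : Fin c → R) := by
    funext j
    simp [Finset.sum_apply, Pi.single_apply]
  conv_lhs => rw [h2]
  rw [map_sum]
  simp

theorem mem_smul_top_iff [Module.Finite R X] [Module.Projective R X] (I : Ideal R) (x : X)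
    (h : ∀ l : X →ₗ[R] R, l x ∈ I) : x ∈ I • (⊤ : Submodule R X) := by
  obtain ⟨c, p, l, hpl⟩ := dual_basis R X
  rw [hpl x]
  exact Submodule.sum_mem _ fun i _ => Submodule.smul_mem_smul (h _) trivial

theorem dual_mem_smul [Module.Finite R P] [Module.Projective R P] (I : Ideal R) (l : Module.Dual R P)
    (h : ∀ x, l x ∈ I) : l ∈ I • (⊤ : Submodule R (Module.Dual R P)) := by
  obtain ⟨c, p, q, hpq⟩ := dual_basis R P
  have : l = ∑ i, l (p i) • q i := by
    refine LinearMap.ext fun x => ?_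
    conv_lhs => rw [hpq x]
    simp [mul_comm]
  rw [this]
  exact Submodule.sum_mem _ fun i _ => Submodule.smul_mem_smul (h _) trivial

theorem lemE [hm : m.IsMaximal] [Module.Finite R P] [Module.Projective R P] [Module.Finite R X] [Module.Projective R X]
    (f : P →ₗ[R] X) (η : Module.Dual R P) (h : ∀ y, f y ∈ m • (⊤ : Submodule R X) → η y ∈ m) :
    η ∈ LinearMap.range f.dualMap ⊔ m • (⊤ : Submodule R (Module.Dual R P)) := by
  letI : Field (R ⧸ m) := Ideal.Quotient.field m
  let κ := R ⧸ m
  let fb : κ ⊗[R] P →ₗ[κ] κ ⊗[R] X := f.baseChange κ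
  let ηb : Module.Dual κ (κ ⊗[R] P) := LinearMap.liftBaseChange κ ((Algebra.linearMap R κ) ∘ₗ η)
  have hsurj : ∀ v : κ ⊗[R] P, ∃ x : P, v = 1 ⊗ₜ x := by
    intro v
    refine TensorProduct.induction_on v ⟨0, by simp⟩ ?_ ?_
    · intro a x
      obtain ⟨r, rfl⟩ := Ideal.Quotient.mk_surjective a
      refine ⟨r • x, ?_⟩
      rw [TensorProduct.tmul_smul, TensorProduct.smul_tmul', Algebra.smul_def, mul_one]; rfl
    · rintro _ _ ⟨x, rfl⟩ ⟨y, rfl⟩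
      exact ⟨x + y, (TensorProduct.tmul_add _ _ _).symm⟩
  have hη : ηb ∈ LinearMap.range fb.dualMap := by
    rw [LinearMap.range_dualMap_eq_dualAnnihilator_ker, Submodule.mem_dualAnnihilator]
    intro v hv
    obtain ⟨x, rfl⟩ := hsurj v
    have h1 : (1 : κ) ⊗ₜ[R] f x = 0 := hv
    have h2 : f x ∈ m • (⊤ : Submodule R X) := by
      have := congrArg (TensorProduct.quotTensorEquivQuotSMul X m) h1
      have e : TensorProduct.quotTensorEquivQuotSMul X m ((1 : κ) ⊗ₜ[R] f x) = Submodule.Quotient.mk (f x) := by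
        have := TensorProduct.quotTensorEquivQuotSMul_mk_tmul m (1:R) (f x)
        rw [one_smul] at this
        exact this
      rw [e, map_zero, Submodule.Quotient.mk_eq_zero] at this
      exact this
    have h3 : ηb (1 ⊗ₜ x) = Ideal.Quotient.mk m (η x) := by
      change LinearMap.liftBaseChange κ ((Algebra.linearMap R κ) ∘ₗ η) (1 ⊗ₜ x) = _
      rw [LinearMap.liftBaseChange_tmul, one_smul]; rfl
    rw [h3, Ideal.Quotient.eq_zero_iff_mem]
    exact h _ h2
  obtain ⟨ζ, hζ⟩ := hη
  obtain ⟨ζ', hζ'⟩ := Module.projective_lifting_property (Algebra.linearMap R κ) 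
    ((ζ.restrictScalars R) ∘ₗ TensorProduct.mk R κ X 1) Ideal.Quotient.mk_surjective
  have h4 : ∀ y, (η - f.dualMap ζ') y ∈ m := by
    intro y
    rw [← Ideal.Quotient.eq_zero_iff_mem, LinearMap.sub_apply, map_sub, sub_eq_zero]
    have h5 : (Ideal.Quotient.mk m) (ζ' (f y)) = ζ (1 ⊗ₜ f y) := LinearMap.congr_fun hζ' (f y)
    have h6 : ζ (1 ⊗ₜ f y) = ηb (1 ⊗ₜ y) := LinearMap.congr_fun hζ (1 ⊗ₜ y)
    have h3 : ηb (1 ⊗ₜ y) = Ideal.Quotient.mk m (η y) := by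
      change LinearMap.liftBaseChange κ ((Algebra.linearMap R κ) ∘ₗ η) (1 ⊗ₜ y) = _
      rw [LinearMap.liftBaseChange_tmul, one_smul]; rfl
    rw [← h3, ← h6, ← h5]; rfl
  have : η = f.dualMap ζ' + (η - f.dualMap ζ') := by abel
  rw [this]
  exact Submodule.add_mem_sup ⟨_, rfl⟩ (dual_mem_smul m _ h4)

/-- Nakayama for modules locally torsion away from m -/
theorem nak {N : Type} [AddCommGroup N] [Module R N] [Module.Finite R N] (B : Submodule R N)
    (hT : ∀ p : Ideal R, p.IsPrime → p ≠ m → ∃ a, a ∉ p ∧ ∀ x : N, a • x ∈ B) 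
    (h : ∀ x, x ∈ B ⊔ m • (⊤ : Submodule R N)) (hm : m.IsMaximal) : B = ⊤ := by
  have h1 : (⊤ : Submodule R (N ⧸ B)) ≤ m • ⊤ := by
    intro w _
    obtain ⟨x, rfl⟩ := B.mkQ_surjective w
    obtain ⟨b, hb, y, hy, rfl⟩ := Submodule.mem_sup.mp (h x)
    rw [map_add, (by simpa using hb : B.mkQ b = 0), zero_add]
    have : B.mkQ y ∈ (m • (⊤ : Submodule R N)).map B.mkQ := Submodule.mem_map_of_mem hy
    rw [Submodule.map_smul''] at this
    exact Submodule.smul_mono le_rfl le_top this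
  obtain ⟨r, hr1, hr2⟩ := Submodule.exists_sub_one_mem_and_smul_eq_zero_of_fg_of_le_smul m (⊤ : Submodule R (N ⧸ B))
    Module.Finite.fg_top h1
  have hr3 : ∀ x, r • x ∈ B := by
    intro x
    have := hr2 (B.mkQ x) trivial
    rw [← map_smul] at this
    rwa [Submodule.mkQ_apply, Submodule.Quotient.mk_eq_zero] at this
  let I : Ideal R := B.colon Set.univ
  have hI : ∀ a, a ∈ I ↔ ∀ x, a • x ∈ B := by
    intro a
    rw [Submodule.mem_colon]
    simp
  have hItop : I = ⊤ := by
    by_contra hne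
    obtain ⟨p, hp, hIp⟩ := Ideal.exists_le_maximal I hne
    by_cases hpm : p = m
    · have h2 : r ∈ m := hpm ▸ hIp ((hI r).mpr hr3)
      have : (1 : R) ∈ m := by
        have := m.sub_mem h2 hr1
        simpa using this
      exact hm.ne_top (m.eq_top_iff_one.mpr this)
    · obtain ⟨a, ha, ha'⟩ := hT p hp.isPrime hpm
      exact ha (hIp ((hI a).mpr ha'))
  rw [eq_top_iff]
  intro x _
  have := (hI 1).mp (hItop ▸ trivial) x
  rwa [one_smul] at this
end E

namespace GC
variable {R : Type} [CommRing R] {m : Ideal R} {n : ℕ}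
variable {X : Type} [AddCommGroup X] [Module R X] {k : ℕ} {G : GC R X (2*k)}

variable (G) in
/-- top differential -/
abbrev dtop : G.Xd (2*k) →ₗ[R] X := G.d ∘ₗ (G.Xd (2*k)).subtype

/-- extend a functional by zero -/
def extl (ξ : Module.Dual R (G.Xd (2*k))) : X →ₗ[R] R := ξ ∘ₗ (G.π (2*k)).rangeRestrict

theorem extl_π (ξ : Module.Dual R (G.Xd (2*k))) (x : X) : extl ξ (G.π (2*k) x) = extl ξ x := by
  change ξ _ = ξ _
  congr 1
  apply Subtype.ext
  change G.π _ (G.π _ x) = G.π _ x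
  rw [G.ππ, if_pos rfl]

theorem extl_apply (ξ : Module.Dual R (G.Xd (2*k))) (x : G.Xd (2*k)) : extl ξ x.1 = ξ x := by
  change ξ _ = ξ _
  congr 1
  apply Subtype.ext
  exact G.mem_Xd.mp x.2

theorem extl_d (ξ : Module.Dual R (G.Xd (2*k))) (x : X) : extl ξ (G.d x) = 0 := by
  rw [← extl_π, ← G.dπ, G.big _ (by omega), map_zero, map_zero]

theorem extl_sg (ξ : Module.Dual R (G.Xd (2*k))) (x : X) : extl ξ (G.sg x) = extl ξ x := by
  refine G.ext_π (f := extl ξ ∘ₗ G.sg) (g := extl ξ) ?_ x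
  intro p x hx
  rw [LinearMap.comp_apply, G.sg_hom hx]
  split_ifs with h
  · have : extl ξ x = 0 := by
      rw [← extl_π, G.π_ne (j := p) ?_ hx, map_zero]
      rintro rfl
      exact (Nat.not_odd_iff_even.mpr ⟨k, by ring⟩) h
    rw [map_neg, this, neg_zero]
  · rfl

theorem dtop_tors (h : G.Data m k) (hk : 1 ≤ k) : ∀ p : Ideal R, p.IsPrime → p ≠ m → ∃ a, a ∉ p ∧
    ∀ x : Module.Dual R (G.Xd (2*k)), a • x ∈ LinearMap.range (G.dtop).dualMap := by
  intro p hp hpm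
  obtain ⟨a, ha, ⟨D⟩⟩ := h p hp hpm
  refine ⟨a, ha, fun ξ => ⟨extl ξ ∘ₗ D.s, ?_⟩⟩
  refine LinearMap.ext fun x => ?_
  change extl ξ (D.s (G.d x.1)) = a • ξ x
  have h1 := D.hom x.1
  have hx := G.mem_Xd.mp x.2
  have h2 : D.s x.1 = 0 := by rw [← D.s_mem hx, G.big _ (by omega)]
  rw [h2, map_zero, zero_add, D.e_ne (by omega : 2 * k ≠ k) hx, sub_zero] at h1
  rw [h1, map_smul, extl_apply]

/-- product of functionals -/
def bil (ξ η : X →ₗ[R] R) : X ⊗[R] X →ₗ[R] R := LinearMap.mul' R R ∘ₗ TensorProduct.map ξ η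

theorem bil_tmul (ξ η : X →ₗ[R] R) (x y : X) : bil ξ η (x ⊗ₜ y) = ξ x * η y := by simp [bil]

theorem bil_π {p q : ℕ} {ξ η : X →ₗ[R] R} (hξ : ∀ x, ξ (G.π p x) = ξ x) (hη : ∀ x, η (G.π q x) = η x) {j : ℕ} (hj : p + q = j) (t : X ⊗[R] X) :
    bil ξ η (G.tens.π j t) = bil ξ η t := by
  refine G.ext_tens (f := bil ξ η ∘ₗ G.πT j) (g := bil ξ η) ?_ t
  intro p' q' x y hx hy
  rw [LinearMap.comp_apply, G.πT_tmul hx hy]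
  split_ifs with h
  · rfl
  · rw [map_zero, bil_tmul]
    by_cases hp : p = p'
    · rw [← hη, G.π_ne (j := q') (by omega) hy, map_zero, mul_zero]
    · rw [← hξ, G.π_ne hp hx, map_zero, zero_mul]

theorem dT_mem (I : Ideal R) {y y' : X} (hy : G.d y ∈ I • (⊤ : Submodule R X)) (hy' : G.d y' ∈ I • (⊤ : Submodule R X)) 
    (b : X ⊗[R] X →ₗ[R] R) : b (G.dT (y ⊗ₜ y')) ∈ I := by
  rw [dT_tmul, map_add]
  refine I.add_mem ?_ ?_
  · exact mem_of_smul_top I (b ∘ₗ (TensorProduct.mk R X X).flip y') hy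
  · exact mem_of_smul_top I (b ∘ₗ (TensorProduct.mk R X X) (G.sg y)) hy'

variable [IsNoetherianRing R] [IsDomain R] [UniqueFactorizationMonoid R] [hT : HT m n]
  [Module.Finite R X] [Module.Projective R X]

variable (G) in
/-- identity -/
def Hom.idH : G.tens.Hom where
  f := LinearMap.id
  fd := fun _ => rfl
  fπ := fun _ _ => rfl

theorem Hom.idH_fH (j : ℕ) : (Hom.idH G).fH j = LinearMap.id := by
  refine LinearMap.ext fun x => ?_
  obtain ⟨x, rfl⟩ := G.tens.cls_surj j x
  rfl

theorem Data.quad (h : G.Data m k) (hk : 1 ≤ k) (hn : 4 * k ≤ n) (f : G.tens.Hom)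
    (hf : ∀ y : EX R (G.tens.H (2*k)) R (2*k-2+2), pull (f.fH (2*k)) y = 0)
    (ξ η : Module.Dual R (G.Xd (2*k))) : ∃ b' : X ⊗[R] X →ₗ[R] R, ∀ t, bil (extl ξ) (extl η) (f.f t) = b' (G.dT t) := by
  have e : 4 * k = 2 * k + (2*k - 2) + 2 := by omega
  obtain ⟨b', _, hb'⟩ := h.tens.nat_ext (n := n) (by omega) f (i := 2*k-2) (by omega) hf (bil (extl ξ) (extl η))
    (by
      intro t
      exact bil_π (extl_π ξ) (extl_π η) (by omega) t)
    (by
      intro t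
      change (bil (extl ξ) (extl η)) (G.dT t) = 0
      refine TensorProduct.induction_on t (by simp) ?_ (fun a b ha hb => by rw [map_add, map_add, ha, hb, add_zero])
      intro x y
      rw [dT_tmul, map_add, bil_tmul, bil_tmul, extl_d, extl_d]; simp)
  exact ⟨b', hb'⟩

theorem Data.main1 (hm : m.IsMaximal) (h : G.Data m k) (hk : 1 ≤ k)
    (hE : ∀ (ξ : Module.Dual R (G.Xd (2*k))) (y : G.Xd (2*k)), G.d y ∈ m • (⊤ : Submodule R X) → ξ y ∈ m) :
    LinearMap.range (G.dtop).dualMap = ⊤ := by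
  haveI := hm
  exact nak _ (dtop_tors h hk) (fun ξ => lemE _ ξ (hE ξ)) hm

theorem Data.main (h : G.Data m k) (hm0 : m ≠ ⊥) (hH : Loc m (G.H k) (Fin 2 → R)) (hk : 1 ≤ k) (hn : 4 * k ≤ n) 
    (h2 : IsUnit (2:R) ∨ CharP R 2) : LinearMap.range (G.dtop).dualMap = ⊤ := by
  have hm := hT.max
  rcases h2 with h2 | h2
  swap
  · apply h.main1 hm hk
    intro ξ y hy
    have hf : ∀ y : EX R (G.tens.H (2*k)) R (2*k-2+2), pull ((Hom.idH G).fH (2*k)) y = 0 := by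
      have := h.ez2 (n := n) hm0 hH hk hn
      rw [Hom.idH_fH]
      intro y
      rw [pull_id]
      have e : 2*k-2+2 = 2*k := by omega
      revert y
      rw [e]
      exact this
    obtain ⟨b', hb'⟩ := h.quad hk hn (Hom.idH G) hf ξ ξ
    have := hb' (y.1 ⊗ₜ y.1)
    change bil (extl ξ) (extl ξ) (y.1 ⊗ₜ y.1) = _ at this
    rw [bil_tmul, extl_apply] at this
    have h3 := dT_mem m hy hy b'
    rw [← this] at h3
    exact (hm.isPrime.mem_or_mem h3).elim id id
  have hf : ∀ y : EX R (G.tens.H (2*k)) R (2*k-2+2), pull ((G.fτ (sgn R k)).fH (2*k)) y = 0 := by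
    intro y
    exact h.skew (n := n) hm0 hH (i := 2*k-2+1) (by omega) y
  have hτ : ∀ (x y : G.Xd (2*k)), G.τ (x.1 ⊗ₜ y.1) = y.1 ⊗ₜ x.1 := by
    intro x y
    rw [G.τ_tmul (G.mem_Xd.mp x.2) (G.mem_Xd.mp y.2), if_neg]
    rintro ⟨h, -⟩
    exact (Nat.not_odd_iff_even.mpr ⟨k, by ring⟩) h
  have key : ∀ (ξ η : Module.Dual R (G.Xd (2*k))) (x y : G.Xd (2*k)), G.d x ∈ m • (⊤ : Submodule R X) →
      G.d y ∈ m • (⊤ : Submodule R X) → ξ x * η y - sgn R k * (ξ y * η x) ∈ m := by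
    intro ξ η x y hx hy
    obtain ⟨b', hb'⟩ := h.quad hk hn (G.fτ (sgn R k)) hf ξ η
    have h3 := hb' (x.1 ⊗ₜ y.1)
    change bil (extl ξ) (extl η) ((LinearMap.id - sgn R k • G.τ : X ⊗[R] X →ₗ[R] X ⊗[R] X) (x.1 ⊗ₜ y.1)) = _ at h3
    rw [LinearMap.sub_apply, LinearMap.smul_apply, hτ, LinearMap.id_apply, map_sub, map_smul, bil_tmul, bil_tmul,
      extl_apply, extl_apply, extl_apply, extl_apply, smul_eq_mul] at h3
    rw [h3]
    exact dT_mem m hx hy b'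
  by_cases hodd : Odd k
  · apply h.main1 hm hk
    intro ξ y hy
    have h3 := key ξ ξ y y hy hy
    rw [sgn, if_pos hodd] at h3
    have e : ξ y * ξ y - -1 * (ξ y * ξ y) = 2 * (ξ y * ξ y) := by ring
    rw [e] at h3
    rcases hm.isPrime.mem_or_mem h3 with h4 | h4
    · exact absurd (Ideal.eq_top_of_isUnit_mem _ h4 h2) hm.ne_top
    · exact (hm.isPrime.mem_or_mem h4).elim id id
  have hsgn : sgn R k = 1 := by rw [sgn, if_neg hodd]
  have hk2 : 2 ≤ k := by
    rcases Nat.not_odd_iff_even.mp hodd with ⟨r, hr⟩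
    omega
  by_cases hE : ∀ (ξ : Module.Dual R (G.Xd (2*k))) (y : G.Xd (2*k)), G.d y ∈ m • (⊤ : Submodule R X) → ξ y ∈ m
  · exact h.main1 hm hk hE
  push Not at hE
  obtain ⟨ξ, y0, hy0, hξ0⟩ := hE
  -- A = R ξ + D
  have hA : LinearMap.range (G.dtop).dualMap ⊔ Submodule.span R {ξ} = ⊤ := by
    refine nak (m := m) _ ?_ ?_ hm
    · intro p hp hpm
      obtain ⟨a, ha, ha'⟩ := dtop_tors h hk p hp hpm
      exact ⟨a, ha, fun x => Submodule.mem_sup_left (ha' x)⟩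
    · intro η
      obtain ⟨r, hr⟩ : ∃ r, 1 - r * ξ y0 ∈ m := by
        obtain ⟨r, hr⟩ := hm.exists_inv hξ0
        obtain ⟨i, hi, e⟩ := hr
        exact ⟨r, by rw [← e]; simpa using hi⟩
      have h3 := lemE (m := m) (G.dtop) (ξ y0 • η - η y0 • ξ) (by
        intro y hy
        have h4 := key ξ η y0 y hy0 hy
        rw [hsgn, one_mul] at h4
        change ξ y0 * η y - η y0 * ξ y ∈ m
        rw [mul_comm (η y0)]
        exact h4)
      have e : η = (1 - r * ξ y0) • η + (r • (ξ y0 • η - η y0 • ξ) + (r * η y0) • ξ) := by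
        refine LinearMap.ext fun x => ?_
        change η x = (1 - r * ξ y0) * η x + (r * (ξ y0 * η x - η y0 * ξ x) + (r * η y0) * ξ x)
        ring
      rw [e]
      refine Submodule.add_mem _ (Submodule.mem_sup_right (Submodule.smul_mem_smul hr trivial)) (Submodule.add_mem _ (Submodule.smul_mem _ _ ?_) ?_)
      · obtain ⟨b, hb, c, hc, hbc⟩ := Submodule.mem_sup.mp h3
        rw [← hbc]
        exact Submodule.add_mem_sup (Submodule.mem_sup_left hb) hc
      · exact Submodule.mem_sup_left (Submodule.mem_sup_right (Submodule.smul_mem _ _ (Submodule.mem_span_singleton_self _)))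
  let I : Ideal R := (LinearMap.range (G.dtop).dualMap).comap (LinearMap.toSpanSingleton R _ ξ)
  have hI : ∀ a, a ∈ I ↔ a • ξ ∈ LinearMap.range (G.dtop).dualMap := fun a => Iff.rfl
  -- splitting
  obtain ⟨yl, hyl1, hyl2⟩ : ∃ y : G.Xd (2*k), (∀ η : X →ₗ[R] R, η (G.d y) ∈ I) ∧ 1 - ξ y ∈ I := by
    let q : (R × Module.Dual R X) →ₗ[R] Module.Dual R (G.Xd (2*k)) :=
      (LinearMap.toSpanSingleton R _ ξ).coprod (G.dtop).dualMap
    have hq : Function.Surjective q := by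
      rw [← LinearMap.range_eq_top]
      rw [LinearMap.range_coprod, LinearMap.range_toSpanSingleton, sup_comm]
      exact hA
    obtain ⟨s, hs⟩ := Module.projective_lifting_property q LinearMap.id hq
    have hs' : ∀ α, (s α).1 • ξ + (G.dtop).dualMap (s α).2 = α := fun α => LinearMap.congr_fun hs α
    obtain ⟨y, hy⟩ := (Module.bijective_dual_eval R (G.Xd (2*k))).2 (LinearMap.fst _ _ _ ∘ₗ s)
    have hy' : ∀ α : Module.Dual R (G.Xd (2*k)), α y = (s α).1 := fun α => LinearMap.congr_fun hy α
    refine ⟨y, fun η => ?_, ?_⟩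
    · have h3 := hy' ((G.dtop).dualMap η)
      change η (G.d y) = _ at h3
      rw [h3, hI]
      have h4 := hs' ((G.dtop).dualMap η)
      rw [← eq_sub_iff_add_eq] at h4
      rw [h4]
      exact Submodule.sub_mem _ ⟨_, rfl⟩ ⟨_, rfl⟩
    · rw [hI, hy']
      refine ⟨(s ξ).2, LinearMap.ext fun x => ?_⟩
      have h4 := LinearMap.congr_fun (hs' ξ) x
      change (s ξ).1 * ξ x + (s ξ).2 (G.dtop x) = ξ x at h4
      change (s ξ).2 (G.dtop x) = (1 - (s ξ).1) * ξ x
      linear_combination h4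
  have hyl3 : G.d yl ∈ I • (⊤ : Submodule R X) := mem_smul_top_iff I _ hyl1
  have hf' : ∀ y : EX R (G.tens.H (2*k)) R (2*k-3+2), pull ((G.fτ (sgn R k)).fH (2*k)) y = 0 := by
    intro y
    exact h.skew (n := n) hm0 hH (i := 2*k-3+1) (by omega) y
  have hII : I ≤ I * I := by
    intro a ha
    obtain ⟨η0, hη0⟩ := (hI a).mp ha
    let η : X →ₗ[R] R := η0 ∘ₗ G.π (2*k-1)
    have hηπ : ∀ x, η (G.π (2*k-1) x) = η x := by
      intro x
      change η0 (G.π _ (G.π _ x)) = η0 (G.π _ x)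
      rw [G.ππ, if_pos rfl]
    have hηd : ∀ x, η (G.d x) = a * extl ξ x := by
      intro x
      change η0 (G.π (2*k-1) (G.d x)) = _
      have e : 2 * k - 1 + 1 = 2 * k := by omega
      rw [← G.dπ, e]
      have := LinearMap.congr_fun hη0 ((G.π (2*k)).rangeRestrict x)
      exact this
    let z : X ⊗[R] X →ₗ[R] R := bil η (extl ξ) - bil (extl ξ) η
    have hz : ∀ x y, z (x ⊗ₜ y) = η x * extl ξ y - extl ξ x * η y := by
      intro x y
      change bil η (extl ξ) (x ⊗ₜ y) - bil (extl ξ) η (x ⊗ₜ y) = _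
      rw [bil_tmul, bil_tmul]
    obtain ⟨b', -, hb'⟩ := h.tens.nat_ext (n := n) (by omega) (G.fτ (sgn R k)) (i := 2*k-3) (by omega) hf' z
      (by
        intro t
        change bil η (extl ξ) _ - bil (extl ξ) η _ = bil η (extl ξ) _ - bil (extl ξ) η _
        rw [bil_π hηπ (extl_π ξ) (by omega) t, bil_π (extl_π ξ) hηπ (by omega) t])
      (by
        intro t
        change z (G.dT t) = 0
        refine TensorProduct.induction_on t (by simp) ?_ (fun a b ha hb => by rw [map_add, map_add, ha, hb, add_zero])
        intro x y
        rw [dT_tmul, map_add, hz, hz, hηd, hηd, extl_d, extl_d, extl_sg]; ring)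
    have h3 := hb' (yl.1 ⊗ₜ G.d yl.1)
    have hyp := G.mem_Xd.mp yl.2
    have hdyp : G.π (2*k-1) (G.d yl.1) = G.d yl.1 := by
      have e : 2 * k - 1 + 1 = 2 * k := by omega
      rw [← G.dπ, e, hyp]
    have hη1 : η yl.1 = 0 := by
      rw [← hηπ, G.π_ne (j := 2*k) (by omega) hyp, map_zero]
    change z ((LinearMap.id - sgn R k • G.τ : X ⊗[R] X →ₗ[R] X ⊗[R] X) (yl.1 ⊗ₜ G.d yl.1)) = b' (G.dT _) at h3
    have hfe : (LinearMap.id - sgn R k • G.τ : X ⊗[R] X →ₗ[R] X ⊗[R] X) (yl.1 ⊗ₜ G.d yl.1) =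
        yl.1 ⊗ₜ G.d yl.1 - sgn R k • (G.d yl.1 ⊗ₜ yl.1) := by
      rw [LinearMap.sub_apply, LinearMap.smul_apply, G.τ_tmul hyp hdyp, if_neg, LinearMap.id_apply]
      rintro ⟨h, -⟩
      exact (Nat.not_odd_iff_even.mpr ⟨k, by ring⟩) h
    rw [hfe, map_sub, map_smul,
      hz, hz, extl_d, hηd, hη1, hsgn, dT_tmul, G.dd, extl_apply, TensorProduct.tmul_zero, add_zero] at h3
    have h4 : b' (G.d yl.1 ⊗ₜ G.d yl.1) ∈ I * I := by
      have : G.d yl.1 ⊗ₜ[R] G.d yl.1 ∈ (I * I) • (⊤ : Submodule R (X ⊗[R] X)) := by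
        rw [← smul_eq_mul, Submodule.smul_assoc]
        refine Submodule.smul_induction_on (p := fun w => w ⊗ₜ[R] G.d yl.1 ∈ _) hyl3 ?_ ?_
        · intro r hr x _
          rw [← TensorProduct.smul_tmul']
          refine Submodule.smul_mem_smul hr ?_
          refine Submodule.smul_induction_on (p := fun w => x ⊗ₜ[R] w ∈ _) hyl3 ?_ ?_
          · intro r hr y _
            rw [TensorProduct.tmul_smul]
            exact Submodule.smul_mem_smul hr trivial
          · intro y y' h1 h2
            rw [TensorProduct.tmul_add]; exact Submodule.add_mem _ h1 h2
        · intro y y' h1 h2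
          rw [TensorProduct.add_tmul]; exact Submodule.add_mem _ h1 h2
      exact mem_of_smul_top _ b' this
    rw [← h3] at h4
    obtain ⟨w, hw⟩ := h2.exists_left_inv
    have hi : a * (1 - ξ yl) ∈ I * I := Ideal.mul_mem_mul ha hyl2
    have e : a = -w * (0 * 0 - ξ yl * (a * ξ yl) - (1:R) • (a * ξ yl * ξ yl - 0 * 0)) + (1 + ξ yl) * (a * (1 - ξ yl)) := by
      simp only [one_smul]
      linear_combination (- a * ξ yl * ξ yl) * hw
    rw [e]
    refine Ideal.add_mem _ (Ideal.mul_mem_left _ _ ?_) (Ideal.mul_mem_left _ _ hi)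
    exact h4
  have hidem : IsIdempotentElem I := le_antisymm Ideal.mul_le_right hII
  rcases (Ideal.isIdempotentElem_iff_eq_bot_or_top I (IsNoetherian.noetherian I)).mp hidem with h3 | h3
  · exfalso
    obtain ⟨a, ha, ha'⟩ := dtop_tors h hk ⊥ Ideal.isPrime_bot hm0.symm
    have : a ∈ I := (hI a).mpr (ha' ξ)
    rw [h3] at this
    exact ha this
  · rw [← hA, eq_comm, sup_eq_left, Submodule.span_singleton_le_iff_mem]
    have : (1:R) ∈ I := h3 ▸ trivial
    have := (hI 1).mp this
    rwa [one_smul] at this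

end GC
end EX
end

open CategoryTheory TensorProduct
noncomputable section
namespace EX
namespace GC
variable {R : Type} [CommRing R] {m : Ideal R} {n : ℕ}
variable {X : Type} [AddCommGroup X] [Module R X] {L : ℕ} {G : GC R X L} {c : ℕ}

variable (G) in
/-- maps out of homology -/
def liftH {N : Type} [AddCommGroup N] [Module R N] (j : ℕ) (f : G.Z j →ₗ[R] N) (hf : ∀ z : G.Z j, z.1 ∈ G.Bd j → f z = 0) :
    G.H j →ₗ[R] N := ((G.Bd j).comap (G.Z j).subtype).liftQ f (fun z hz => hf z hz)

theorem liftH_cls {N : Type} [AddCommGroup N] [Module R N] (j : ℕ) (f : G.Z j →ₗ[R] N) (hf : ∀ z : G.Z j, z.1 ∈ G.Bd j → f z = 0)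
    (z : G.Z j) : G.liftH j f hf (G.cls j z) = f z := rfl

/-- partial contraction up to degree j -/
structure PHD (G : GC R X L) (c : ℕ) (j : ℕ) (a : R) where
  s : X →ₗ[R] X
  e : X →ₗ[R] X
  sπ : ∀ i x, s (G.π i x) = G.π (i+1) (s x)
  hom : ∀ i < j, ∀ x, G.π i x = x → G.d (s x) + s (G.d x) = a • x - e x
  eπ : ∀ x, e (G.π c x) = e x
  πe : ∀ x, G.π c (e x) = e x
  de : ∀ x, G.d (e x) = 0
  ed : ∀ x, e (G.d x) = 0
  s0 : ∀ i, j ≤ i → ∀ x, G.π i x = x → s x = 0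
  e0 : ∀ i, j ≤ i → ∀ x, G.π i x = x → e x = 0

theorem PHD.step [Module.Projective R X] {j : ℕ} {a : R} (D : G.PHD c j a) (b : R)
    (hb : j ≠ c → ∀ w : G.H j, b • w = 0)
    (hc : j = c → ∃ (F : Type) (_ : AddCommGroup F) (_ : Module R F) (_ : Module.Projective R F)
      (u : G.H j →ₗ[R] F) (v : F →ₗ[R] G.H j), ∀ x, v (u x) = b • x) : Nonempty (G.PHD c (j+1) (a * b)) := by
  have hφ : ∀ x, (a • LinearMap.id - D.s ∘ₗ G.d : X →ₗ[R] X) (G.π j x) ∈ G.Z j := by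
    intro x
    have hy : G.π j (G.π j x) = G.π j x := by rw [G.ππ, if_pos rfl]
    change a • (G.π j x) - D.s (G.d (G.π j x)) ∈ G.Z j
    generalize G.π j x = y at hy
    rw [mem_Z]
    cases j with
    | zero =>
      have hd : G.d y = 0 := by rw [← hy, G.dπ0]
      rw [hd, map_zero, sub_zero, map_smul, map_smul, hy, hd, smul_zero]
      exact ⟨rfl, rfl⟩
    | succ i =>
      have hdy := G.d_mem hy
      constructor
      · rw [map_sub, map_smul, hy, ← D.sπ, hdy]
      · have := D.hom i (by omega) _ hdy
        rw [G.dd, map_zero, add_zero, D.ed, sub_zero] at this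
        rw [map_sub, map_smul, this, sub_self]
  let φ : X →ₗ[R] G.Z j := ((a • LinearMap.id - D.s ∘ₗ G.d : X →ₗ[R] X) ∘ₗ G.π j).codRestrict (G.Z j) hφ
  have hφv : ∀ x, (φ x).1 = a • (G.π j x) - D.s (G.d (G.π j x)) := fun x => rfl
  have hφd : ∀ x, G.cls j (φ (G.d x)) = 0 := by
    intro x
    rw [cls_eq_zero, hφv, ← G.dπ, G.dd, map_zero, sub_zero, ← map_smul]
    refine G.mem_Bd.mpr ⟨_, ?_, rfl⟩
    rw [map_smul, G.ππ, if_pos rfl]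
  have hφπ : ∀ x, φ (G.π j x) = φ x := by
    intro x
    apply Subtype.ext
    rw [hφv, hφv, G.ππ, if_pos rfl]
  obtain ⟨g, hg1, hg2, hg3, hg4⟩ : ∃ g : X →ₗ[R] G.Z j, (∀ x, g (G.d x) = 0) ∧ (∀ x, g (G.π j x) = g x) ∧
      (j ≠ c → g = 0) ∧ ∀ x, (b • φ x - g x).1 ∈ G.Bd j := by
    by_cases hjc : j = c
    · obtain ⟨F, _, _, _, u, v, huv⟩ := hc hjc
      obtain ⟨v', hv'⟩ := Module.projective_lifting_property (G.cls j) v (G.cls_surj j)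
      refine ⟨v' ∘ₗ u ∘ₗ G.cls j ∘ₗ φ, ?_, ?_, fun h => absurd hjc h, ?_⟩
      · intro x
        change v' (u (G.cls j (φ (G.d x)))) = 0
        rw [hφd, map_zero, map_zero]
      · intro x
        change v' (u (G.cls j (φ (G.π j x)))) = v' (u (G.cls j (φ x)))
        rw [hφπ]
      · intro x
        rw [← cls_eq_zero, map_sub, map_smul]
        have := LinearMap.congr_fun hv' (u (G.cls j (φ x)))
        change G.cls j (v' (u (G.cls j (φ x)))) = _ at this
        change _ - G.cls j (v' (u (G.cls j (φ x)))) = 0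
        rw [this, huv, sub_self]
    · refine ⟨0, fun _ => rfl, fun _ => rfl, fun _ => rfl, fun x => ?_⟩
      rw [← cls_eq_zero, map_sub, map_smul, hb hjc]
      simp
  let ψ : X →ₗ[R] G.Bd j := ((G.Z j).subtype ∘ₗ (b • φ - g)).codRestrict (G.Bd j) hg4
  have hψ : ∀ x, (ψ x).1 = b • (φ x).1 - (g x).1 := fun x => rfl
  obtain ⟨s', hs'⟩ := Module.projective_lifting_property (G.dB j) ψ (G.ses_ZXB j).surj
  have hs'' : ∀ x, G.d (s' x).1 = b • (φ x).1 - (g x).1 := fun x => by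
    rw [← hψ, ← hs']; rfl
  let t : X →ₗ[R] X := (G.Xd (j+1)).subtype ∘ₗ s' ∘ₗ G.π j
  have ht : ∀ x, t x = (s' (G.π j x)).1 := fun x => rfl
  have ht0 : ∀ i x, i ≠ j → G.π i x = x → t x = 0 := by
    intro i x hij hx
    rw [ht, G.π_ne (Ne.symm hij) hx, map_zero]; rfl
  have htπ : ∀ x, G.π (j+1) (t x) = t x := fun x => G.mem_Xd.mp (s' (G.π j x)).2
  have htd : ∀ i x, i ≠ j + 1 → G.π i x = x → t (G.d x) = 0 := by
    intro i x hij hx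
    rw [ht, ← G.dπ, G.π_ne (Ne.symm hij) hx, map_zero, map_zero]; rfl
  have hgi : ∀ i x, i ≠ j → G.π i x = x → g x = 0 := by
    intro i x hij hx
    rw [← hg2, G.π_ne (Ne.symm hij) hx, map_zero]
  have hgc : ∀ x, G.π c (g x).1 = (g x).1 := by
    intro x
    by_cases hjc : j = c
    · rw [← hjc]; exact (G.mem_Z.mp (g x).2).1
    · rw [hg3 hjc]; simp
  refine ⟨⟨b • D.s + t, b • D.e + (G.Z j).subtype ∘ₗ g, ?_, ?_, ?_, ?_, ?_, ?_, ?_, ?_⟩⟩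
  · intro i x
    change b • D.s (G.π i x) + t (G.π i x) = G.π (i+1) (b • D.s x + t x)
    rw [map_add, map_smul, D.sπ]
    congr 1
    by_cases hij : i = j
    · subst hij
      rw [htπ, ht, ht, G.ππ, if_pos rfl]
    · rw [ht0 i _ hij (by rw [G.ππ, if_pos rfl]), G.π_ne (by omega) (htπ x)]
  · intro i hi x hx
    change G.d (b • D.s x + t x) + (b • D.s (G.d x) + t (G.d x)) = (a * b) • x - (b • D.e x + (g x).1)
    rw [htd i x (by omega) hx, add_zero]
    by_cases hij : i = j
    · subst hij
      rw [D.s0 i le_rfl x hx, smul_zero, zero_add, D.e0 i le_rfl x hx, smul_zero, zero_add]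
      rw [ht, hx, hs'', hφv, hx, smul_sub, smul_smul, mul_comm b a]
      abel
    · rw [ht0 i x hij hx, add_zero, hgi i x hij hx, map_smul, ← smul_add, D.hom i (by omega) x hx, smul_sub, smul_smul,
        mul_comm b a]
      simp
  · intro x
    change b • D.e (G.π c x) + (g (G.π c x)).1 = b • D.e x + (g x).1
    rw [D.eπ]
    by_cases hjc : j = c
    · have e : G.π c = G.π j := by rw [hjc]
      rw [e, hg2]
    · rw [hg3 hjc]; rfl
  · intro x
    change G.π c (b • D.e x + (g x).1) = b • D.e x + (g x).1
    rw [map_add, map_smul, D.πe, hgc]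
  · intro x
    change G.d (b • D.e x + (g x).1) = 0
    rw [map_add, map_smul, D.de, (G.mem_Z.mp (g x).2).2, smul_zero, zero_add]
  · intro x
    change b • D.e (G.d x) + (g (G.d x)).1 = 0
    rw [D.ed, hg1]; simp
  · intro i hi x hx
    change b • D.s x + t x = 0
    rw [D.s0 i (by omega) x hx, ht0 i x (by omega) hx]; simp
  · intro i hi x hx
    change b • D.e x + (g x).1 = 0
    rw [D.e0 i (by omega) x hx, hgi i x (by omega) hx]; simp

theorem Data.mk' [Module.Projective R X] (h1 : ∀ j, j ≠ c → LTo m (G.H j)) (h2 : Loc m (G.H c) (Fin 2 → R)) : G.Data m c := by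
  intro p hp hpm
  have key : ∀ j, ∃ a, a ∉ p ∧ Nonempty (G.PHD c j a) := by
    intro j
    induction j with
    | zero =>
      refine ⟨1, fun h => hp.ne_top ((Ideal.eq_top_iff_one p).mpr h), ⟨⟨0, 0, ?_, ?_, ?_, ?_, ?_, ?_, ?_, ?_⟩⟩⟩
      all_goals first | (intro i hi; omega) | simp
    | succ j ih =>
      obtain ⟨a, ha, ⟨D⟩⟩ := ih
      by_cases hjc : j = c
      · obtain ⟨b, hb, u, v, huv, -⟩ := h2 p hp hpm
        subst hjc
        exact ⟨a * b, fun h => (hp.mem_or_mem h).elim ha hb, D.step b (fun h => absurd rfl h)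
          (fun _ => ⟨_, _, _, inferInstance, u, v, huv⟩)⟩
      · obtain ⟨b, hb, hb'⟩ := h1 j hjc p hp hpm
        exact ⟨a * b, fun h => (hp.mem_or_mem h).elim ha hb, D.step b (fun _ => hb') (fun h => absurd h hjc)⟩
  obtain ⟨a, ha, ⟨D⟩⟩ := key (L+1)
  refine ⟨a, ha, ⟨⟨D.s, D.e, D.sπ, ?_, D.eπ, D.πe, D.de, D.ed⟩⟩⟩
  refine G.ext_π (f := G.d ∘ₗ D.s + D.s ∘ₗ G.d) (g := a • LinearMap.id - D.e) ?_
  intro i x hx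
  by_cases hi : i < L + 1
  · exact D.hom i hi x hx
  · have : x = 0 := by rw [← hx, G.big i (by omega)]
    rw [this, map_zero, map_zero]

variable (G) in
/-- the dual complex -/
def dual : GC R (Module.Dual R X) L where
  d := G.d.dualMap
  π i := if i ≤ L then (G.π (L - i)).dualMap else 0
  dd ξ := by
    refine LinearMap.ext fun x => ?_
    change ξ (G.d (G.d x)) = 0
    rw [G.dd, map_zero]
  ππ i j ξ := by
    by_cases hi : i ≤ L
    · by_cases hj : j ≤ L
      · rw [if_pos hi, if_pos hj]
        refine LinearMap.ext fun x => ?_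
        change ξ (G.π (L - j) (G.π (L - i) x)) = _
        rw [G.ππ]
        by_cases hij : i = j
        · subst hij
          rw [if_pos rfl, if_pos rfl]; rfl
        · rw [if_neg (by omega), if_neg hij, map_zero]; rfl
      · rw [if_neg hj, if_neg (show ¬ i = j by omega)]; simp
    · rw [if_neg hi]; simp
  sum ξ := by
    refine LinearMap.ext fun x => ?_
    rw [LinearMap.sum_apply]
    have : ∀ i ∈ Finset.range (L+1), ((if i ≤ L then (G.π (L - i)).dualMap else 0 : Module.Dual R X →ₗ[R] Module.Dual R X) ξ) x = ξ (G.π (L + 1 - 1 - i) x) := by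
      intro i hi
      rw [if_pos (by simp at hi; omega)]; rfl
    rw [Finset.sum_congr rfl this, Finset.sum_range_reflect (fun i => ξ (G.π i x)) (L+1), ← map_sum, G.sum]
  dπ i ξ := by
    refine LinearMap.ext fun x => ?_
    by_cases hi : i + 1 ≤ L
    · rw [if_pos hi, if_pos (by omega)]
      change ξ (G.π (L - (i+1)) (G.d x)) = ξ (G.d (G.π (L - i) x))
      rw [← G.dπ, show L - (i+1) + 1 = L - i by omega]
    · rw [if_neg hi]
      by_cases hi' : i ≤ L
      · rw [if_pos hi']
        change 0 = ξ (G.d (G.π (L - i) x))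
        rw [show L - i = 0 by omega, G.dπ0, map_zero]
      · rw [if_neg hi']; rfl
  dπ0 ξ := by
    refine LinearMap.ext fun x => ?_
    rw [if_pos (Nat.zero_le _)]
    change ξ (G.π (L - 0) (G.d x)) = 0
    rw [← G.dπ, G.big _ (by omega), map_zero, map_zero]

theorem dual_π {i j : ℕ} (h : i + j = L) (ξ : Module.Dual R X) (x : X) : G.dual.π i ξ x = ξ (G.π j x) := by
  change (if i ≤ L then (G.π (L - i)).dualMap else 0 : Module.Dual R X →ₗ[R] Module.Dual R X) ξ x = _
  rw [if_pos (by omega), show L - i = j by omega]; rfl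

theorem dual_big {i : ℕ} (h : L < i) (ξ : Module.Dual R X) : G.dual.π i ξ = 0 := by
  exact G.dual.big i h ξ

theorem dual_d (ξ : Module.Dual R X) (x : X) : G.dual.d ξ x = ξ (G.d x) := rfl

theorem HD.πs {a : R} (D : G.HD c a) (x : X) : G.π 0 (D.s x) = 0 := by
  refine G.ext_π (f := G.π 0 ∘ₗ D.s) (g := 0) ?_ x
  intro p x hx
  change G.π 0 (D.s x) = 0
  rw [← D.s_mem hx, G.ππ, if_neg (by omega)]

/-- dual contraction -/
def HD.dual {a : R} (D : G.HD c a) {c' : ℕ} (hc : c' + c = L) : G.dual.HD c' a where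
  s := D.s.dualMap
  e := D.e.dualMap
  sπ i ξ := by
    refine LinearMap.ext fun x => ?_
    change G.dual.π i ξ (D.s x) = _
    rcases lt_trichotomy i L with hi | hi | hi
    · rw [dual_π (j := L - i) (by omega), dual_π (j := L - (i+1)) (by omega)]
      change _ = ξ (D.s (G.π _ x))
      rw [D.sπ, show L - (i+1) + 1 = L - i by omega]
    · rw [dual_π (j := 0) (by omega), dual_big (by omega), D.πs, map_zero]; rfl
    · rw [dual_big (by omega), dual_big (by omega)]; rfl
  hom ξ := by
    refine LinearMap.ext fun x => ?_
    change ξ (D.s (G.d x)) + ξ (G.d (D.s x)) = a • ξ x - ξ (D.e x)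
    rw [← map_add, add_comm, D.hom, map_sub, map_smul]
  eπ ξ := by
    refine LinearMap.ext fun x => ?_
    change G.dual.π c' ξ (D.e x) = ξ (D.e x)
    rw [dual_π hc, D.πe]
  πe ξ := by
    refine LinearMap.ext fun x => ?_
    rw [dual_π hc]
    change ξ (D.e _) = ξ (D.e x)
    rw [D.eπ]
  de ξ := by
    refine LinearMap.ext fun x => ?_
    change ξ (D.e (G.d x)) = 0
    rw [D.ed, map_zero]
  ed ξ := by
    refine LinearMap.ext fun x => ?_
    change ξ (G.d (D.e x)) = 0
    rw [D.de, map_zero]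

theorem Data.dual (h : G.Data m c) {c' : ℕ} (hc : c' + c = L) : G.dual.Data m c' := by
  intro p hp hpm
  obtain ⟨a, ha, ⟨D⟩⟩ := h p hp hpm
  exact ⟨a, ha, ⟨D.dual hc⟩⟩

variable (G) in
/-- restriction of dual cycles -/
def res0 {c' : ℕ} : G.dual.Z c' →ₗ[R] Module.Dual R (G.H c) where
  toFun ξ := ((G.Bd c).comap (G.Z c).subtype).liftQ (ξ.1 ∘ₗ (G.Z c).subtype) (by
    intro x hx
    obtain ⟨y, hy, hyx⟩ := G.mem_Bd.mp hx
    change ξ.1 x.1 = 0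
    have := LinearMap.congr_fun (G.dual.mem_Z.mp ξ.2).2 y
    change ξ.1 (G.d y) = 0 at this
    rw [hyx] at this
    exact this)
  map_add' ξ η := by
    refine LinearMap.ext fun x => ?_
    obtain ⟨x, rfl⟩ := G.cls_surj c x
    rfl
  map_smul' r ξ := by
    refine LinearMap.ext fun x => ?_
    obtain ⟨x, rfl⟩ := G.cls_surj c x
    rfl

theorem res0_apply {c' : ℕ} (ξ : G.dual.Z c') (z : G.Z c) : G.res0 ξ (G.cls c z) = ξ.1 z.1 := rfl

theorem res0_zero {c' : ℕ} (ξ : G.dual.Z c') (hξ : ξ.1 ∈ G.dual.Bd c') : G.res0 (c := c) ξ = 0 := by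
  obtain ⟨η, hη, hηξ⟩ := G.dual.mem_Bd.mp hξ
  refine LinearMap.ext fun x => ?_
  obtain ⟨x, rfl⟩ := G.cls_surj c x
  rw [res0_apply, ← hηξ, dual_d, (G.mem_Z.mp x.2).2, map_zero]; rfl

variable (G) in
/-- restriction of dual homology -/
def res {c' : ℕ} : G.dual.H c' →ₗ[R] Module.Dual R (G.H c) :=
  G.dual.liftH c' (G.res0 (c := c)) res0_zero

theorem res_cls {c' : ℕ} (ξ : G.dual.Z c') (z : G.Z c) : G.res (G.dual.cls c' ξ) (G.cls c z) = ξ.1 z.1 := by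
  rw [res, liftH_cls, res0_apply]

theorem HD.res_inv {a : R} (D : G.HD c a) {c' : ℕ} (hc : c' + c = L) : ∃ t : Module.Dual R (G.H c) →ₗ[R] G.dual.H c',
    (∀ x, t (G.res x) = a • x) ∧ ∀ y, G.res (t y) = a • y := by
  let t0 : Module.Dual R (G.H c) →ₗ[R] G.dual.Z c' := (D.eb.dualMap).codRestrict (G.dual.Z c') (by
    intro ψ
    rw [mem_Z]
    constructor
    · refine LinearMap.ext fun x => ?_
      rw [dual_π hc]
      change ψ (D.eb _) = ψ (D.eb x)
      congr 1
      rw [HD.eb_apply, HD.eb_apply]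
      congr 1
      exact Subtype.ext (D.eπ x)
    · refine LinearMap.ext fun x => ?_
      change ψ (D.eb (G.d x)) = 0
      rw [D.eb_d, map_zero])
  have ht0 : ∀ ψ x, (t0 ψ).1 x = ψ (D.eb x) := fun ψ x => rfl
  refine ⟨G.dual.cls c' ∘ₗ t0, ?_, ?_⟩
  · intro w
    obtain ⟨ξ, rfl⟩ := G.dual.cls_surj c' w
    rw [LinearMap.comp_apply, ← map_smul, ← sub_eq_zero, ← map_sub, cls_eq_zero, ← Submodule.neg_mem_iff]
    obtain ⟨h1, h2⟩ := G.dual.mem_Z.mp ξ.2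
    refine G.dual.mem_Bd_of (y := ξ.1 ∘ₗ D.s) ?_ ?_
    · rw [map_neg]
      congr 1
      exact (G.dual.mem_Z.mp (Subtype.property _)).1
    · refine LinearMap.ext fun x => ?_
      change ξ.1 (D.s (G.d x)) = - (ξ.1 (D.e x) - a • ξ.1 x)
      have h3 := congrArg ξ.1 (D.hom x)
      have h4 : ξ.1 (G.d (D.s x)) = 0 := LinearMap.congr_fun h2 _
      rw [map_add, h4, zero_add, map_sub, map_smul] at h3
      rw [h3]; abel
  · intro ψ
    refine LinearMap.ext fun x => ?_
    obtain ⟨z, rfl⟩ := G.cls_surj c x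
    rw [LinearMap.comp_apply, res_cls, ht0, D.eb_Z, map_smul]; rfl

theorem Data.dual_Loc (h : G.Data m c) (hH : Loc m (G.H c) (Fin 2 → R)) {c' : ℕ} (hc : c' + c = L) :
    Loc m (G.dual.H c') (Fin 2 → R) := by
  intro p hp hpm
  obtain ⟨a, ha, ⟨D⟩⟩ := h p hp hpm
  obtain ⟨b, hb, u, v, huv, hvu⟩ := hH p hp hpm
  obtain ⟨t, ht1, ht2⟩ := D.res_inv hc
  let E : Module.Dual R (Fin 2 → R) ≃ₗ[R] (Fin 2 → R) := (Pi.basisFun R (Fin 2)).toDualEquiv.symm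
  refine ⟨a * b, fun h => (hp.mem_or_mem h).elim ha hb, E.toLinearMap ∘ₗ v.dualMap ∘ₗ G.res,
    t ∘ₗ u.dualMap ∘ₗ E.symm.toLinearMap, ?_, ?_⟩
  · intro x
    change t (u.dualMap (E.symm (E (v.dualMap (G.res x))))) = _
    rw [E.symm_apply_apply]
    have : u.dualMap (v.dualMap (G.res x)) = b • G.res x := by
      refine LinearMap.ext fun y => ?_
      change G.res x (v (u y)) = _
      rw [huv, map_smul]; rfl
    rw [this, map_smul, ht1, smul_smul, mul_comm]
  · intro y
    change E (v.dualMap (G.res (t (u.dualMap (E.symm y))))) = _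
    rw [ht2, map_smul]
    have : v.dualMap (u.dualMap (E.symm y)) = b • E.symm y := by
      refine LinearMap.ext fun z => ?_
      change E.symm y (u (v z)) = _
      rw [hvu, map_smul]; rfl
    rw [this, map_smul, map_smul, E.apply_symm_apply, smul_smul]

end GC
end EX
end

open CategoryTheory TensorProduct
noncomputable section
namespace EX
namespace GC
variable {R : Type} [CommRing R] {m : Ideal R} {n : ℕ}
variable {X : Type} [AddCommGroup X] [Module R X] {k : ℕ} {G : GC R X (2*k)}
variable [IsNoetherianRing R] [IsDomain R] [UniqueFactorizationMonoid R] [hT : HT m n]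
  [Module.Finite R X] [Module.Projective R X]

theorem Data.split (h : G.Data m k) (hm0 : m ≠ ⊥) (hH : Loc m (G.H k) (Fin 2 → R)) (hk : 1 ≤ k) (hn : 4 * k ≤ n) 
    (h2 : IsUnit (2:R) ∨ CharP R 2) (ξ : X →ₗ[R] R) : ∃ η : X →ₗ[R] R, ∀ x, G.π (2*k) x = x → η (G.d x) = ξ x := by
  have h1 := h.main (n := n) hm0 hH hk hn h2
  have h3 : ξ ∘ₗ (G.Xd (2*k)).subtype ∈ LinearMap.range (G.dtop).dualMap := by rw [h1]; trivial
  obtain ⟨η, hη⟩ := h3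
  exact ⟨η, fun x hx => LinearMap.congr_fun hη ⟨x, G.mem_Xd.mpr hx⟩⟩

theorem Data.bot (h : G.Data m k) (hm0 : m ≠ ⊥) (hH : Loc m (G.H k) (Fin 2 → R)) (hk : 1 ≤ k) (hn : 4 * k ≤ n) 
    (h2 : IsUnit (2:R) ∨ CharP R 2) : G.Bd 0 = G.Xd 0 := by
  have hD := h.dual (c' := k) (by omega)
  have hL := h.dual_Loc hH (c' := k) (by omega)
  apply le_antisymm ((G.Bd_le_Z 0).trans (G.Z_le_Xd 0))
  intro x hx
  obtain ⟨η, hη⟩ := hD.split (n := n) hm0 hL hk hn h2 (Module.Dual.eval R X x)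
  obtain ⟨y, rfl⟩ := (Module.bijective_dual_eval R X).2 η
  have hx' := G.mem_Xd.mp hx
  refine G.mem_Bd_of (y := G.π 1 y) hx' ?_
  rw [G.dπ 0]
  apply (Module.bijective_dual_eval R X).1
  refine LinearMap.ext fun ζ => ?_
  have h3 := hη (ζ ∘ₗ G.π 0) (by
    refine LinearMap.ext fun z => ?_
    rw [dual_π (j := 0) (by omega)]
    change ζ (G.π 0 (G.π 0 z)) = ζ (G.π 0 z)
    rw [G.ππ, if_pos rfl])
  change ζ (G.π 0 (G.d y)) = ζ (G.π 0 x) at h3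
  rw [hx'] at h3
  exact h3

end GC
end EX
end

open CategoryTheory TensorProduct
noncomputable section
namespace EX
variable {R : Type} [CommRing R]

theorem pd_of_ses {A B C : Type} [AddCommGroup A] [Module R A] [AddCommGroup B] [Module R B] [AddCommGroup C] [Module R C]
    {f : A →ₗ[R] B} {g : B →ₗ[R] C} (h : SES f g) [Module.Projective R B] (i : ℕ) :
    HasProjectiveDimensionLT (ModuleCat.of R C) (i+2) ↔ HasProjectiveDimensionLT (ModuleCat.of R A) (i+1) := by
  have hB : Projective (ModuleCat.of R B) := (IsProjective.iff_projective B).mp inferInstance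
  exact h.short.hasProjectiveDimensionLT_X₃_iff i hB

theorem proj_of_pd {A : Type} [AddCommGroup A] [Module R A] (h : HasProjectiveDimensionLT (ModuleCat.of R A) 1) :
    Module.Projective R A :=
  (IsProjective.iff_projective A).mpr (projective_iff_hasProjectiveDimensionLT_one.mpr h)

theorem pd_of_proj {A : Type} [AddCommGroup A] [Module R A] (h : Module.Projective R A) :
    HasProjectiveDimensionLT (ModuleCat.of R A) 1 :=
  projective_iff_hasProjectiveDimensionLT_one.mp ((IsProjective.iff_projective A).mp h)

section
variable (T : ℕ → Type) [∀ i, AddCommGroup (T i)] [∀ i, Module R (T i)] 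
  (d : ∀ i, T (i+1) →ₗ[R] T i) {A : Type} [AddCommGroup A] [Module R A] (f : T 0 →ₗ[R] A)
/-- cycles -/
def zc : ∀ i, Submodule R (T i)
  | 0 => LinearMap.ker f
  | (i+1) => LinearMap.ker (d i)

/-- conclusion of the replacement lemma -/
def Repl (L : ℕ) : Prop :=
  ∃ (X : Type) (_ : AddCommGroup X) (_ : Module R X) (_ : Module.Finite R X) (_ : Module.Projective R X)
    (G : GC R X L) (ε : X →ₗ[R] A), Function.Surjective ε ∧ (∀ x, ε (G.π 0 x) = ε x) ∧
    (∀ x, x ∈ G.Bd 0 ↔ G.π 0 x = x ∧ ∃ y, f y = ε x) ∧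
    (∀ i, ∃ θ : G.Z (i+1) →ₗ[R] T i, LinearMap.range θ = zc T d f i ∧
      ∀ z, (∃ y, d i y = θ z) ↔ z.1 ∈ G.Bd (i+1)) ∧
    (L = 0 → Function.Injective ε) ∧
    (1 ≤ L → (∀ ξ : X →ₗ[R] R, ∃ η : X →ₗ[R] R, ∀ x, G.π L x = x → η (G.d x) = ξ x) →
      HasProjectiveDimensionLT (ModuleCat.of R A) L)
end

/-- concentrated in degree zero -/
def gc0 (A : Type) [AddCommGroup A] [Module R A] : GC R A 0 where
  d := 0
  π i := if i = 0 then LinearMap.id else 0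
  dd x := rfl
  ππ i j x := by
    by_cases hi : i = 0 <;> by_cases hj : j = 0 <;> simp [hi, hj]
    · intro h; exact (hj h.symm).elim
  sum x := by simp
  dπ i x := by simp
  dπ0 x := rfl

/-- extend a complex by one step -/
def gcS {P X' : Type} [AddCommGroup P] [Module R P] [AddCommGroup X'] [Module R X'] {L : ℕ} (G : GC R X' L)
    (σ : X' →ₗ[R] P) (hσ : ∀ x, σ (G.π 0 x) = σ x) (hσd : ∀ x, σ (G.d x) = 0) : GC R (P × X') (L+1) where
  d := LinearMap.prod (σ ∘ₗ LinearMap.snd R P X') (G.d ∘ₗ LinearMap.snd R P X')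
  π i := match i with
    | 0 => LinearMap.prod (LinearMap.fst R P X') 0
    | (i+1) => LinearMap.prod 0 (G.π i ∘ₗ LinearMap.snd R P X')
  dd x := Prod.ext (hσd _) (G.dd _)
  ππ i j x := by
    rcases i with _ | i <;> rcases j with _ | j
    · rfl
    · rfl
    · exact Prod.ext rfl (map_zero (G.π i))
    · have := G.ππ i j x.2
      by_cases h : i = j
      · subst h
        rw [if_pos rfl] at this ⊢
        exact Prod.ext rfl this
      · rw [if_neg h] at this
        rw [if_neg (by omega)]
        exact Prod.ext rfl this
  sum x := by
    rw [Finset.sum_range_succ']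
    have h1 : ∑ i ∈ Finset.range (L+1), ((LinearMap.prod 0 (G.π i ∘ₗ LinearMap.snd R P X')) x : P × X') = (0, x.2) := by
      refine Prod.ext ?_ ?_
      · rw [Prod.fst_sum]; exact Finset.sum_eq_zero fun _ _ => rfl
      · rw [Prod.snd_sum]; exact G.sum x.2
    refine (congrArg₂ (· + ·) h1 rfl).trans ?_
    exact Prod.ext (zero_add _) (add_zero _)
  dπ i x := by
    rcases i with _ | i
    · refine Prod.ext (hσ _) ?_
      exact (G.dπ0 _)
    · refine Prod.ext ?_ (G.dπ i _)
      change σ (G.π (i+1) x.2) = 0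
      rw [← hσ, G.ππ, if_neg (by omega), map_zero]
  dπ0 x := Prod.ext (map_zero σ) (map_zero G.d)

theorem replacement [IsNoetherianRing R] (L : ℕ) : ∀ (T : ℕ → Type) [∀ i, AddCommGroup (T i)] [∀ i, Module R (T i)] 
    [∀ i, Module.Finite R (T i)] [∀ i, Module.Projective R (T i)]
    (d : ∀ i, T (i+1) →ₗ[R] T i) (hdd : ∀ i x, d i (d (i+1) x) = 0)
    (A : Type) [AddCommGroup A] [Module R A] [Module.Finite R A] (f : T 0 →ₗ[R] A) (hf : ∀ x, f (d 0 x) = 0)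
    (hpd : HasProjectiveDimensionLT (ModuleCat.of R A) (L+1)) (hT : ∀ i, L ≤ i → Subsingleton (T i)), 
    Repl T d f L := by
  induction L with
  | zero =>
    intro T _ _ _ _ d hdd A _ _ _ f hf hpd hT
    have hA := proj_of_pd hpd
    refine ⟨A, inferInstance, inferInstance, inferInstance, hA, gc0 A, LinearMap.id, fun x => ⟨x, rfl⟩, 
      fun x => rfl, ?_, ?_, fun _ => fun x y h => h, fun h => absurd h (by omega)⟩
    · intro x
      rw [GC.mem_Bd]
      constructor
      · rintro ⟨y, -, rfl⟩
        exact ⟨rfl, 0, map_zero _⟩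
      · rintro ⟨-, y, hy⟩
        refine ⟨0, map_zero _, ?_⟩
        have := hT 0 le_rfl
        rw [Subsingleton.elim y 0, map_zero] at hy
        rw [map_zero]; exact hy
    · intro i
      have := hT i (Nat.zero_le _)
      refine ⟨0, Subsingleton.elim _ _, fun z => ⟨fun _ => ?_, fun _ => ⟨0, Subsingleton.elim _ _⟩⟩⟩
      have h0 : z.1 = 0 := by
        have := ((gc0 (R := R) A).mem_Z.mp z.2).1
        exact this.symm
      rw [h0]
      exact Submodule.zero_mem _
  | succ L ih =>
    intro T _ _ _ _ d hdd A _ _ _ f hf hpd hT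
    obtain ⟨c, ρ, hρ⟩ := Module.Finite.exists_fin' R A
    let P := Fin c → R
    let g : (T 0 × P) →ₗ[R] A := f.coprod (-ρ)
    have hg : Function.Surjective g := fun a => by
      obtain ⟨p, hp⟩ := hρ (-a)
      exact ⟨(0, p), by change f 0 + -ρ p = a; rw [hp, map_zero]; simp⟩
    let W := LinearMap.ker g
    have hW : ∀ w : W, f w.1.1 = ρ w.1.2 := fun w => by
      have : f w.1.1 + -ρ w.1.2 = 0 := w.2
      rwa [← sub_eq_add_neg, sub_eq_zero] at this
    have hW' : ∀ y p, f y = ρ p → ((y, p) : T 0 × P) ∈ W := fun y p h => by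
      change f y + -ρ p = 0
      rw [h]; simp
    have hS : SES W.subtype g := ses_ker g hg
    have hWpd := (pd_of_ses hS L).mp hpd
    let f' : T 1 →ₗ[R] W := LinearMap.codRestrict W (LinearMap.prod (d 0) 0) fun x => hW' _ _ (by rw [hf]; exact (map_zero ρ).symm)
    obtain ⟨X', _, _, _, _, G, ε, hε, hε0, hB, hZ, hinj, htop⟩ := ih (fun i => T (i+1)) (fun i => d (i+1)) (fun i x => hdd (i+1) x) W f'
      (fun x => Subtype.ext (Prod.ext (hdd 0 x) rfl)) hWpd (fun i hi => hT (i+1) (by omega))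
    let σ : X' →ₗ[R] P := LinearMap.snd R (T 0) P ∘ₗ W.subtype ∘ₗ ε
    have hσ : ∀ x, σ (G.π 0 x) = σ x := fun x => by
      change (ε (G.π 0 x)).1.2 = (ε x).1.2
      rw [hε0]
    have hσd : ∀ x, σ (G.d x) = 0 := fun x => by
      rw [← hσ]
      obtain ⟨-, y, hy⟩ := (hB (G.π 0 (G.d x))).mp (by
        refine G.mem_Bd_of (y := G.π 1 x) (by rw [G.ππ, if_pos rfl]) (G.dπ 0 x))
      change (ε (G.π 0 (G.d x))).1.2 = 0
      rw [← hy]; rfl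
    let G' := gcS G σ hσ hσd
    refine ⟨P × X', inferInstance, inferInstance, inferInstance, inferInstance, G', ρ ∘ₗ LinearMap.fst R P X', ?_, fun x => rfl, ?_, ?_, fun h => absurd h (by omega), ?_⟩
    · intro a
      obtain ⟨p, hp⟩ := hρ a
      exact ⟨(p, 0), hp⟩
    · intro x
      rw [GC.mem_Bd]
      constructor
      · rintro ⟨y, hy, rfl⟩
        refine ⟨?_, (ε y.2).1.1, hW _⟩
        refine Prod.ext rfl ?_
        have h2 : G.π 0 y.2 = y.2 := congrArg Prod.snd hy
        change 0 = G.d y.2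
        rw [← h2, G.dπ0]
      · rintro ⟨hx, y, hy⟩
        obtain ⟨z, hz⟩ := hε ⟨(y, x.1), hW' _ _ hy⟩
        refine ⟨(0, G.π 0 z), Prod.ext rfl ?_, ?_⟩
        · change G.π 0 (G.π 0 z) = G.π 0 z
          rw [G.ππ, if_pos rfl]
        · refine Prod.ext ?_ ?_
          · change σ (G.π 0 z) = x.1
            rw [hσ]
            change (ε z).1.2 = _
            rw [hz]
          · change G.d (G.π 0 z) = x.2
            rw [G.dπ0]
            exact congrArg Prod.snd hx
    · have hBd : ∀ i (z : P × X'), z.1 = 0 → (z.2 ∈ G.Bd i ↔ z ∈ G'.Bd (i+1)) := by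
        intro i z hz1
        rw [GC.mem_Bd, GC.mem_Bd]
        constructor
        · rintro ⟨y, hy, hyz⟩
          refine ⟨(0, y), Prod.ext rfl hy, Prod.ext ?_ hyz⟩
          change σ y = z.1
          rw [← hy, ← hσ, G.ππ, if_neg (by omega), map_zero, hz1]
        · rintro ⟨y, hy, rfl⟩
          exact ⟨y.2, congrArg Prod.snd hy, rfl⟩
      have hZ1 : ∀ i (z : G'.Z (i+1)), z.1.1 = 0 ∧ G.π i z.1.2 = z.1.2 ∧ σ z.1.2 = 0 ∧ G.d z.1.2 = 0 := by
        intro i z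
        obtain ⟨h1, h2⟩ := G'.mem_Z.mp z.2
        exact ⟨(congrArg Prod.fst h1).symm, congrArg Prod.snd h1, congrArg Prod.fst h2, congrArg Prod.snd h2⟩
      intro i
      rcases i with _ | i
      · refine ⟨LinearMap.fst R (T 0) P ∘ₗ W.subtype ∘ₗ ε ∘ₗ LinearMap.snd R P X' ∘ₗ (G'.Z 1).subtype, ?_, ?_⟩
        · ext y
          constructor
          · rintro ⟨z, rfl⟩
            obtain ⟨h1, h2, h3, h4⟩ := hZ1 0 z
            have h5 := hW (ε z.1.2)
            have h6 : (ε z.1.2).1.2 = 0 := h3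
            rw [h6, map_zero] at h5
            exact h5
          · intro hy
            have hy' : f y = 0 := hy
            obtain ⟨x, hx⟩ := hε ⟨(y, 0), hW' _ _ (by rw [hy', map_zero])⟩
            have h7 : ((0, G.π 0 x) : P × X') ∈ G'.Z 1 := by
              rw [GC.mem_Z]
              refine ⟨Prod.ext rfl ?_, Prod.ext ?_ (G.dπ0 x)⟩
              · change G.π 0 (G.π 0 x) = G.π 0 x
                rw [G.ππ, if_pos rfl]
              · change σ (G.π 0 x) = 0
                rw [hσ]
                change (ε x).1.2 = 0
                rw [hx]
            refine ⟨⟨_, h7⟩, ?_⟩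
            change (ε (G.π 0 x)).1.1 = y
            rw [hε0, hx]
        · intro z
          obtain ⟨h1, h2, h3, h4⟩ := hZ1 0 z
          rw [← hBd 0 z.1 h1, hB]
          constructor
          · rintro ⟨y, hy⟩
            refine ⟨h2, y, Subtype.ext (Prod.ext hy ?_)⟩
            exact h3.symm
          · rintro ⟨-, y, hy⟩
            exact ⟨y, congrArg (fun w : W => w.1.1) hy⟩
      · obtain ⟨θ, hθ, hθ2⟩ := hZ i
        let r : G'.Z (i+2) →ₗ[R] G.Z (i+1) := LinearMap.codRestrict (G.Z (i+1)) (LinearMap.snd R P X' ∘ₗ (G'.Z (i+2)).subtype)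
          fun z => by
            obtain ⟨h1, h2, h3, h4⟩ := hZ1 (i+1) z
            rw [GC.mem_Z]
            exact ⟨h2, h4⟩
        have hr : Function.Surjective r := by
          intro z
          obtain ⟨h2, h4⟩ := G.mem_Z.mp z.2
          refine ⟨⟨(0, z.1), ?_⟩, rfl⟩
          rw [GC.mem_Z]
          refine ⟨Prod.ext rfl h2, Prod.ext ?_ h4⟩
          change σ z.1 = 0
          rw [← h2, ← hσ, G.ππ, if_neg (by omega), map_zero]
        refine ⟨θ ∘ₗ r, ?_, ?_⟩
        · rw [LinearMap.range_comp_of_range_eq_top _ (LinearMap.range_eq_top.mpr hr), hθ]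
          rcases i with _ | i
          · ext y
            constructor
            · intro hy
              exact congrArg (fun w : W => w.1.1) (show f' y = 0 from hy)
            · intro hy
              exact Subtype.ext (Prod.ext hy rfl)
          · rfl
        · intro z
          rw [← hBd (i+1) z.1 (hZ1 (i+1) z).1]
          exact hθ2 (r z)
    · intro _ hξ
      rcases L with _ | L
      · have hi := hinj rfl
        obtain ⟨b, p, l, hpl⟩ := dual_basis R X'
        choose η hη using fun j => hξ (l j ∘ₗ LinearMap.snd R P X')
        have hπ : ∀ x, G.π 0 x = x := fun x => by
          have := G.sum x
          rwa [Finset.sum_range_one] at this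
        have hd0 : ∀ x, G.d x = 0 := fun x => by rw [← hπ x, G.dπ0]
        have hη2 : ∀ j x, η j (σ x, 0) = l j x := fun j x => by
          have h9 : ((σ x, 0) : P × X') = G'.d (0, x) := Prod.ext rfl (hd0 x).symm
          rw [h9]
          exact hη j (0, x) (Prod.ext rfl (hπ x))
        let s : P →ₗ[R] X' := ∑ j, (η j ∘ₗ LinearMap.inl R P X').smulRight (p j)
        have hs : ∀ x, s (σ x) = x := fun x => by
          conv_rhs => rw [hpl x]
          rw [LinearMap.sum_apply]
          refine Finset.sum_congr rfl fun j _ => ?_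
          change η j (σ x, 0) • p j = _
          rw [hη2]
        obtain ⟨l, hl⟩ := ((hS.exact.split_tfae hS.inj hS.surj).out 1 0 rfl rfl).mp
          ⟨ε ∘ₗ s ∘ₗ LinearMap.snd R (T 0) P, LinearMap.ext fun w => by
            obtain ⟨x, rfl⟩ := hε w
            exact congrArg ε (hs x)⟩
        exact pd_of_proj (Module.Projective.of_split l g hl)
      · refine (pd_of_ses hS L).mpr (htop (by omega) fun ξ => ?_)
        obtain ⟨η, hη⟩ := hξ (ξ ∘ₗ LinearMap.snd R P X')
        refine ⟨η ∘ₗ LinearMap.inr R P X', fun x hx => ?_⟩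
        refine Eq.trans ?_ (hη (0, x) (Prod.ext rfl hx))
        refine congrArg η (Prod.ext ?_ rfl)
        change 0 = σ x
        rw [← hx, ← hσ, G.ππ, if_neg (by omega), map_zero]
end EX
end

open CategoryTheory TensorProduct
noncomputable section
namespace EX
variable {R : Type} [CommRing R] {m : Ideal R} {n : ℕ}

theorem Loc.of_equiv {A B F : Type} [AddCommGroup A] [Module R A] [AddCommGroup B] [Module R B] [AddCommGroup F] [Module R F]
    (h : Loc m A F) (e : B ≃ₗ[R] A) : Loc m B F := by
  intro p hp hpm
  obtain ⟨a, ha, u, v, h1, h2⟩ := h p hp hpm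
  refine ⟨a, ha, u ∘ₗ e.toLinearMap, e.symm.toLinearMap ∘ₗ v, fun x => ?_, fun y => ?_⟩
  · change e.symm (v (u (e x))) = _
    rw [h1, map_smul, e.symm_apply_apply]
  · change u (e (e.symm (v y))) = _
    rw [e.apply_symm_apply, h2]

section
variable (C : ℕ → Type) [∀ i, AddCommGroup (C i)] [∀ i, Module R (C i)] (δ : ∀ i, C i →ₗ[R] C (i+1))

/-- differential between arbitrary degrees -/
def dd (a b : ℕ) : C a →ₗ[R] C b := if h : b = a + 1 then (by rw [h]; exact δ a) else 0

theorem dd_self (a : ℕ) : dd C δ a (a+1) = δ a := by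
  simp [dd]

theorem dd_ne (a b : ℕ) (h : b ≠ a+1) : dd C δ a b = 0 := by
  simp [dd, h]

variable (hδ : ∀ i x, δ (i+1) (δ i x) = 0)

theorem dd_dd (hδ : ∀ i x, δ (i+1) (δ i x) = 0) (a b c : ℕ) (x : C a) : dd C δ b c (dd C δ a b x) = 0 := by
  by_cases h : b = a+1
  · by_cases h' : c = b+1
    · subst h' h
      rw [dd_self, dd_self, hδ]
    · rw [dd_ne C δ b c h']; rfl
  · rw [dd_ne C δ a b h, LinearMap.zero_apply, map_zero]

theorem dd_eq_zero (a b : ℕ) (h : b = a+1) (x : C a) : dd C δ a b x = 0 ↔ δ a x = 0 := by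
  subst h; rw [dd_self]

theorem loc_step [IsNoetherianRing R] [IsDomain R] [UniqueFactorizationMonoid R] [hT : HT m n]
    [∀ i, Module.Finite R (C i)] [∀ i, Module.Projective R (C i)]
    (hδ : ∀ i x, δ (i+1) (δ i x) = 0) (hC0 : Subsingleton (C 0)) (k : ℕ) (hk : 1 ≤ k) (hn : 4 * k ≤ n) 
    (hm0 : m ≠ ⊥) (h2 : IsUnit (2:R) ∨ CharP R 2)
    (hC : ∀ a, 1 ≤ a → ∀ p : Ideal R, p.IsPrime → p ≠ m → ∃ r, r ∉ p ∧ ∀ x : C (a+1), δ (a+1) x = 0 → ∃ y, δ a y = r • x)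
    (hL : Loc m (LinearMap.ker (δ 1)) (Fin 2 → R))
    (hpd : HasProjectiveDimensionLT (ModuleCat.of R (LinearMap.ker (δ (k+1)))) (2*k+1)) :
    (∀ x : C (k+1), δ (k+1) x = 0 → ∃ y, δ k y = x) ∧
    HasProjectiveDimensionLT (ModuleCat.of R (LinearMap.ker (δ (k+1)))) (2*k) := by
  let f : C (k - 0) →ₗ[R] LinearMap.ker (δ (k+1)) := LinearMap.codRestrict _ (δ k) (fun x => hδ k x)
  let T : ℕ → Type := fun i => C (k - i)
  let d : ∀ i, T (i+1) →ₗ[R] T i := fun i => dd C δ (k-(i+1)) (k-i)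
  have hf : ∀ x : T 1, f (d 0 x) = 0 := fun x => by
    refine Subtype.ext ?_
    have := dd_dd C δ hδ (k-(0+1)) k (k+1) x
    rw [dd_self] at this
    exact this
  have hTs : ∀ i, k ≤ i → Subsingleton (T i) := fun i hi => by
    have : k - i = 0 := by omega
    change Subsingleton (C (k-i))
    rw [this]; exact hC0
  obtain ⟨X, _, _, _, _, G, ε, hε, hε0, hB, hZ, -, htop⟩ := replacement (R := R) (2*k) T d (fun i x => dd_dd C δ hδ _ _ _ x) _ f hf hpd
    (fun i hi => hTs i (by omega))
  have hzc : ∀ i, i < k → ∀ x : T i, x ∈ zc T d f i ↔ δ (k-i) x = 0 := by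
    intro i hi x
    rcases i with _ | i
    · exact ⟨fun h => congrArg Subtype.val (show f x = 0 from h), fun h => Subtype.ext h⟩
    · exact dd_eq_zero C δ (k-(i+1)) (k-i) (by omega) x
  have hC' : ∀ a b, b = a+1 → 1 ≤ a → ∀ p : Ideal R, p.IsPrime → p ≠ m → ∃ r, r ∉ p ∧ ∀ x : C b, δ b x = 0 → ∃ y, dd C δ a b y = r • x := by
    intro a b hb ha
    subst hb
    rw [dd_self]
    exact hC a ha
  have hH : ∀ i, (∀ p : Ideal R, p.IsPrime → p ≠ m → ∃ r, r ∉ p ∧ ∀ x : T i, x ∈ zc T d f i → ∃ y, d i y = r • x) → LTo m (G.H (i+1)) := by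
    intro i hi p hp hpm
    obtain ⟨r, hr, h⟩ := hi p hp hpm
    refine ⟨r, hr, fun w => ?_⟩
    obtain ⟨z, rfl⟩ := G.cls_surj _ w
    obtain ⟨θ, hθ, hθ2⟩ := hZ i
    rw [← map_smul, G.cls_eq_zero, ← hθ2, map_smul]
    exact h _ (hθ ▸ ⟨z, rfl⟩)
  have hnot : ∀ p : Ideal R, p.IsPrime → (1 : R) ∉ p := fun p hp h => hp.ne_top ((Ideal.eq_top_iff_one p).mpr h)
  have hall : ∀ j, j ≠ k → LTo m (G.H j) := by
    intro j hj
    rcases j with _ | i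
    · intro p hp hpm
      obtain ⟨r, hr, h⟩ := hC k hk p hp hpm
      refine ⟨r, hr, fun w => ?_⟩
      obtain ⟨z, rfl⟩ := G.cls_surj _ w
      obtain ⟨y, hy⟩ := h (ε z.1).1 (ε z.1).2
      rw [← map_smul, G.cls_eq_zero, hB]
      refine ⟨(G.mem_Z.mp (r • z).2).1, y, Subtype.ext ?_⟩
      refine hy.trans ?_
      change _ = (ε (r • z.1)).1
      rw [map_smul]; rfl
    · apply hH
      intro p hp hpm
      by_cases hik : i < k
      · obtain ⟨r, hr, h⟩ := hC' (k-(i+1)) (k-i) (by omega) (by omega) p hp hpm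
        exact ⟨r, hr, fun x hx => h x ((hzc i hik x).mp hx)⟩
      · have := hTs i (by omega)
        exact ⟨1, hnot p hp, fun x hx => ⟨0, Subsingleton.elim _ _⟩⟩
  have hHk : Loc m (G.H k) (Fin 2 → R) := by
    obtain ⟨k', rfl⟩ : ∃ k', k = k'+1 := ⟨k-1, by omega⟩
    obtain ⟨θ, hθ, hθ2⟩ := hZ k'
    have hsub : Subsingleton (T (k'+1)) := hTs _ le_rfl
    have hθ0 : ∀ z, θ z = 0 ↔ z.1 ∈ G.Bd (k'+1) := by
      intro z
      rw [← hθ2]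
      constructor
      · intro h; exact ⟨0, by rw [h, map_zero]⟩
      · rintro ⟨y, hy⟩
        rw [← hy, Subsingleton.elim y 0, map_zero]
    have hLb : ∀ b, b = 1 → Loc m (LinearMap.ker (δ b)) (Fin 2 → R) := by
      rintro b rfl; exact hL
    have hL2 := hLb (k'+1-k') (by omega)
    have hker : LinearMap.ker θ = (G.Bd (k'+1)).comap (G.Z (k'+1)).subtype := by
      ext z; exact hθ0 z
    have hran : LinearMap.range θ = LinearMap.ker (δ (k'+1-k')) := by
      rw [hθ]; ext x; exact hzc k' (by omega) x
    exact hL2.of_equiv ((Submodule.quotEquivOfEq _ _ hker.symm).trans (θ.quotKerEquivRange.trans (LinearEquiv.ofEq _ _ hran)))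
  have hD := GC.Data.mk' hall hHk
  have hbot := hD.bot (n := n) hm0 hHk hk hn h2
  refine ⟨fun x hx => ?_, htop (by omega) fun ξ => hD.split (n := n) hm0 hHk hk hn h2 ξ⟩
  obtain ⟨z, hz⟩ := hε ⟨x, hx⟩
  have h5 : G.π 0 z ∈ G.Bd 0 := by rw [hbot]; exact ⟨z, rfl⟩
  obtain ⟨-, y, hy⟩ := (hB _).mp h5
  rw [hε0, hz] at hy
  exact ⟨y, congrArg Subtype.val hy⟩
end
end EX
end

open CategoryTheory TensorProduct
noncomputable section
namespace EX
variable {R : Type} [CommRing R] {m : Ideal R} {n : ℕ}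

theorem dual_fin (V : Type) [AddCommGroup V] [Module R V] [IsNoetherianRing R] [Module.Finite R V] : Module.Finite R (V →ₗ[R] R) :=
  inferInstance

/-- a map to a finite free module through which functionals extend -/
def Co (V : ModuleCat.{0} R) : Σ c : ℕ, (V →ₗ[R] (Fin c → R)) :=
  @Classical.epsilon _ ⟨⟨0, 0⟩⟩ (fun p => ∀ φ : V →ₗ[R] R, ∃ ψ : (Fin p.1 → R) →ₗ[R] R, ∀ x, ψ (p.2 x) = φ x)

theorem Co_spec [IsNoetherianRing R] (V : ModuleCat.{0} R) [Module.Finite R V] (φ : V →ₗ[R] R) :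
    ∃ ψ : (Fin (Co V).1 → R) →ₗ[R] R, ∀ x, ψ ((Co V).2 x) = φ x := by
  have : ∃ p : Σ c : ℕ, (V →ₗ[R] (Fin c → R)), ∀ φ : V →ₗ[R] R, ∃ ψ : (Fin p.1 → R) →ₗ[R] R, ∀ x, ψ (p.2 x) = φ x := by
    have := dual_fin (R := R) V
    obtain ⟨c, s, hs⟩ := Module.Finite.exists_fin (R := R) (M := V →ₗ[R] R)
    refine ⟨⟨c, LinearMap.pi s⟩, fun φ => ?_⟩
    have : φ ∈ Submodule.span R (Set.range s) := by rw [hs]; trivial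
    obtain ⟨a, rfl⟩ := (Submodule.mem_span_range_iff_exists_fun R).mp this
    refine ⟨∑ i, a i • LinearMap.proj i, fun x => ?_⟩
    rw [LinearMap.sum_apply, LinearMap.sum_apply]
    rfl
  exact Classical.epsilon_spec this φ

variable (M : ModuleCat.{0} R)
/-- successive cosyzygies -/
def VV : ℕ → ModuleCat.{0} R
  | 0 => M
  | (i+1) => ModuleCat.of R ((Fin (Co (VV i)).1 → R) ⧸ LinearMap.range (Co (VV i)).2)

abbrev DD (i : ℕ) : Type := Fin (Co (VV M i)).1 → R
/-- the map -/
def io (i : ℕ) : VV M i →ₗ[R] DD M i := (Co (VV M i)).2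
/-- quotient -/
def qq (i : ℕ) : DD M i →ₗ[R] VV M (i+1) := (LinearMap.range (Co (VV M i)).2).mkQ

theorem qq_surj (i : ℕ) : Function.Surjective (qq M i) := Submodule.mkQ_surjective _

theorem qq_zero (i : ℕ) (x : DD M i) : qq M i x = 0 ↔ ∃ v, io M i v = x := by
  change (LinearMap.range (Co (VV M i)).2).mkQ x = 0 ↔ _
  rw [Submodule.mkQ_apply, Submodule.Quotient.mk_eq_zero]; rfl

theorem VV_fin [hM : Module.Finite R M] (i : ℕ) : Module.Finite R (VV M i) := by
  rcases i with _ | i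
  · exact hM
  · exact Module.Finite.of_surjective (qq M i) (qq_surj M i)

/-- locally projective away from `m` -/
def LP (m : Ideal R) (V : Type) [AddCommGroup V] [Module R V] : Prop := ∀ p : Ideal R, p.IsPrime → p ≠ m → ∃ a, a ∉ p ∧
  ∃ (c : ℕ) (u : V →ₗ[R] (Fin c → R)) (v : (Fin c → R) →ₗ[R] V), ∀ x, v (u x) = a • x

theorem io_ext [IsNoetherianRing R] [Module.Finite R M] (i c : ℕ) (u : VV M i →ₗ[R] (Fin c → R)) :
    ∃ w : DD M i →ₗ[R] (Fin c → R), ∀ x, w (io M i x) = u x := by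
  have := VV_fin M i
  choose ψ hψ using fun j => Co_spec (VV M i) (LinearMap.proj j ∘ₗ u)
  exact ⟨LinearMap.pi ψ, fun x => funext fun j => hψ j x⟩

theorem VV_LP [IsNoetherianRing R] [Module.Finite R M] (h : LP m M) (i : ℕ) : LP m (VV M i) := by
  induction i with
  | zero => exact h
  | succ i ih =>
    intro p hp hpm
    obtain ⟨a, ha, c, u, v, huv⟩ := ih p hp hpm
    obtain ⟨w, hw⟩ := io_ext M i c u
    let e : DD M i →ₗ[R] DD M i := a • LinearMap.id - io M i ∘ₗ v ∘ₗ w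
    refine ⟨a, ha, _, (LinearMap.range (Co (VV M i)).2).liftQ e ?_, qq M i, ?_⟩
    · rintro x ⟨y, rfl⟩
      change a • io M i y - io M i (v (w (io M i y))) = 0
      rw [hw, huv, map_smul, sub_self]
    · intro x
      obtain ⟨y, rfl⟩ := qq_surj M i x
      change qq M i (a • y - io M i (v (w y))) = _
      rw [map_sub, map_smul, (qq_zero M i (io M i (v (w y)))).mpr ⟨_, rfl⟩, sub_zero]

theorem K_LTo [IsNoetherianRing R] [Module.Finite R M] (h : LP m M) (i : ℕ) : LTo m (LinearMap.ker (io M i)) := by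
  intro p hp hpm
  obtain ⟨a, ha, c, u, v, huv⟩ := VV_LP M h i p hp hpm
  obtain ⟨w, hw⟩ := io_ext M i c u
  refine ⟨a, ha, fun x => Subtype.ext ?_⟩
  change a • x.1 = 0
  have hx : io M i x.1 = 0 := x.2
  rw [← huv, ← hw, hx, map_zero, map_zero]

/-- vanishing of the kernel -/
def KZ (i : ℕ) : Prop := ∀ x, io M i x = 0 → x = 0

theorem KZ.ses {i : ℕ} (h : KZ M i) : SES (io M i) (qq M i) :=
  ⟨(injective_iff_map_eq_zero _).mpr h, fun x => qq_zero M i x, qq_surj M i⟩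

theorem ses_range (i : ℕ) : SES (LinearMap.range (io M i)).subtype (qq M i) :=
  ⟨Subtype.val_injective, fun x => (qq_zero M i x).trans ⟨fun ⟨v, hv⟩ => ⟨⟨x, v, hv⟩, rfl⟩, fun ⟨y, hy⟩ => by
    obtain ⟨v, hv⟩ := y.2; exact ⟨v, hv.trans hy⟩⟩, qq_surj M i⟩

theorem pd_chain (j r : ℕ) (t : ℕ) (h : ∀ i, j ≤ i → i < j+t → KZ M i) 
    (hp : HasProjectiveDimensionLT (VV M (j+t)) (r+1+t)) : HasProjectiveDimensionLT (VV M j) (r+1) := by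
  induction t with
  | zero => exact hp
  | succ t ih =>
    refine ih (fun i h1 h2 => h i h1 (by omega)) ?_
    have := (pd_of_ses (h (j+t) (by omega) (by omega)).ses (r+t)).mp (by
      have e : r+1+(t+1) = r+t+2 := by omega
      rw [e] at hp; exact hp)
    have e : r+1+t = r+t+1 := by omega
    rw [e]; exact this

theorem ez_pd [IsNoetherianRing R] [HT m n] (r : ℕ) {W : Type} [AddCommGroup W] [Module R W] [Module.Finite R W] (hW : LTo m W) :
    ∀ (Z : Type) [AddCommGroup Z] [Module R Z] [Module.Finite R Z] (i : ℕ),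
    HasProjectiveDimensionLT (ModuleCat.of R Z) (r+1) → i + r ≤ n → EZ R W Z i := by
  induction r with
  | zero =>
    intro Z _ _ _ i hZ hi
    have := proj_of_pd hZ
    exact hW.ez (n := n) Z hi
  | succ r ih =>
    intro Z _ _ _ i hZ hi
    obtain ⟨c, f, hf⟩ := Module.Finite.exists_fin' R Z
    have hS := ses_ker f hf
    exact hS.ezc_right (hW.ez (n := n) _ (by omega)) (ih _ (i+1) ((pd_of_ses hS r).mp hZ) (by omega))

theorem ez_chain [IsNoetherianRing R] [HT m n] {W : Type} [AddCommGroup W] [Module R W] [Module.Finite R W] (hW : LTo m W)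
    (j t : ℕ) : ∀ s, (∀ i, j ≤ i → i < j+t → KZ M i) → s + t ≤ n → EZ R W (VV M j) (s+t) → EZ R W (VV M (j+t)) s := by
  induction t with
  | zero => intro s _ _ h; exact h
  | succ t ih =>
    intro s h hs hE
    have := ih (s+1) (fun i h1 h2 => h i h1 (by omega)) (by omega) (by
      have e : s + (t+1) = s+1+t := by omega
      rw [e] at hE; exact hE)
    exact (h (j+t) (by omega) (by omega)).ses.ezc_right (hW.ez (n := n) _ (by omega)) this

/-- shifted coresolution -/
def CC : ℕ → Type
  | 0 => PUnit
  | (i+1) => DD M i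
instance CC_acg : ∀ i, AddCommGroup (CC M i)
  | 0 => inferInstanceAs (AddCommGroup PUnit)
  | (i+1) => inferInstanceAs (AddCommGroup (DD M i))
instance CC_mod : ∀ i, Module R (CC M i)
  | 0 => inferInstanceAs (Module R PUnit)
  | (i+1) => inferInstanceAs (Module R (DD M i))
instance CC_fin : ∀ i, Module.Finite R (CC M i)
  | 0 => inferInstanceAs (Module.Finite R PUnit)
  | (i+1) => inferInstanceAs (Module.Finite R (DD M i))
instance CC_proj : ∀ i, Module.Projective R (CC M i)
  | 0 => inferInstanceAs (Module.Projective R PUnit)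
  | (i+1) => inferInstanceAs (Module.Projective R (DD M i))

/-- differential -/
def CCd : ∀ i, CC M i →ₗ[R] CC M (i+1)
  | 0 => (0 : PUnit →ₗ[R] DD M 0)
  | (i+1) => (io M (i+1) ∘ₗ qq M i : DD M i →ₗ[R] DD M (i+1))

theorem CCd_CCd : ∀ i x, CCd M (i+1) (CCd M i x) = 0 := by
  intro i x
  rcases i with _ | i
  · exact map_zero _
  · change io M (i+2) (qq M (i+1) (io M (i+1) (qq M i x))) = 0
    rw [(qq_zero M (i+1) (io M (i+1) (qq M i x))).mpr ⟨_, rfl⟩, map_zero]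

/-- `Q k` -/
def QK (n : ℕ) (k : ℕ) : Prop := ∀ j, k + 2 ≤ j → j + k ≤ n → KZ M j

variable [IsNoetherianRing R] [IsDomain R] [UniqueFactorizationMonoid R] [hT : HT m n] [Module.Finite R M]

theorem Q_step (hm0 : m ≠ ⊥) (h2 : IsUnit (2:R) ∨ CharP R 2) (hgl : ∀ V : ModuleCat.{0} R, HasProjectiveDimensionLT V (n+2))
    (hL : Loc m M (Fin 2 → R)) (h0 : KZ M 0) (h1 : KZ M 1) (k : ℕ) (hn : 4 * (k+1) ≤ n) (hQ : QK M n (k+1)) : QK M n k := by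
  have hLP : LP m M := fun p hp hpm => by
    obtain ⟨a, ha, u, v, h1, -⟩ := hL p hp hpm
    exact ⟨a, ha, 2, u, v, h1⟩
  have hK := K_LTo M hLP
  -- projective dimension of the cycles
  obtain ⟨t, ht⟩ : ∃ t, k + 3 + t = n - k := ⟨n - k - (k+3), by omega⟩
  have hKZ : ∀ i, k+3 ≤ i → i < k+3+t → KZ M i := fun i h1 h2 => hQ i (by omega) (by omega)
  have hpd1 : HasProjectiveDimensionLT (VV M (k+3)) (2*k+4+1) := by
    apply pd_chain M (k+3) (2*k+4) t hKZ
    have e : 2*k+4+1+t = n+2 := by omega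
    rw [e]; exact hgl _
  have hpd2 := (pd_of_ses (ses_range M (k+2)) (2*k+3)).mp hpd1
  let g : CC M (k+2) →ₗ[R] LinearMap.range (io M (k+2)) :=
    ((io M (k+2)).rangeRestrict ∘ₗ qq M (k+1) : DD M (k+1) →ₗ[R] LinearMap.range (io M (k+2)))
  have hsZ' : SES (LinearMap.ker (CCd M (k+2))).subtype g := by
    refine ⟨Subtype.val_injective, fun x => ?_, ?_⟩
    · constructor
      · intro h
        exact ⟨⟨x, congrArg Subtype.val h⟩, rfl⟩
      · rintro ⟨y, rfl⟩
        exact Subtype.ext y.2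
    · rintro ⟨_, v, rfl⟩
      obtain ⟨y, rfl⟩ := qq_surj M (k+1) v
      exact ⟨y, rfl⟩
  have hpd3 : HasProjectiveDimensionLT (ModuleCat.of R (LinearMap.ker (CCd M (k+2)))) (2*(k+1)+1) := 
    (pd_of_ses hsZ' (2*k+2)).mp hpd2
  obtain ⟨hb, hc⟩ := loc_step (m := m) (n := n) (CC M) (CCd M) (CCd_CCd M) (inferInstanceAs (Subsingleton PUnit)) (k+1) (by omega) hn hm0 h2 (by
    intro a ha p hp hpm
    obtain ⟨a, rfl⟩ : ∃ a', a = a'+1 := ⟨a-1, by omega⟩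
    obtain ⟨r, hr, hr2⟩ := hK (a+2) p hp hpm
    refine ⟨r, hr, fun (x : DD M (a+1)) hx => ?_⟩
    have h5 := congrArg Subtype.val (hr2 ⟨qq M (a+1) x, hx⟩)
    have h6 : qq M (a+1) (r • x) = 0 := by rw [map_smul]; exact h5
    obtain ⟨v, hv⟩ := (qq_zero M (a+1) _).mp h6
    obtain ⟨y, rfl⟩ := qq_surj M a v
    exact ⟨y, hv⟩) (by
    let i0 : VV M 0 →ₗ[R] CC M 1 := io M 0
    let φ : VV M 0 →ₗ[R] LinearMap.ker (CCd M 1) := LinearMap.codRestrict _ i0 fun x => by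
      change io M 1 (qq M 0 (io M 0 x)) = 0
      rw [(qq_zero M 0 (io M 0 x)).mpr ⟨_, rfl⟩, map_zero]
    have hφ : Function.Bijective φ := by
      refine ⟨(injective_iff_map_eq_zero _).mpr fun x hx => h0 x (congrArg Subtype.val hx), fun x => ?_⟩
      obtain ⟨v, hv⟩ := (qq_zero M 0 x.1).mp (h1 _ x.2)
      exact ⟨v, Subtype.ext hv⟩
    exact Loc.of_equiv (A := VV M 0) hL (LinearEquiv.ofBijective φ hφ).symm) hpd3
  have hnew1 : KZ M (k+2) := by
    intro v hv
    obtain ⟨x, rfl⟩ := qq_surj M (k+1) v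
    obtain ⟨y, rfl⟩ := hb x hv
    exact (qq_zero M (k+1) _).mpr ⟨_, rfl⟩
  have hnew2 : KZ M (n - k) := by
    intro x hx
    have hW := hK (n-k)
    have : Module.Finite R (VV M (n-k)) := VV_fin M _
    have e1 : EZ R (LinearMap.ker (io M (n-k))) (LinearMap.ker (CCd M (k+2))) (n - 2*k - 1) := 
      ez_pd (n := n) (2*k+1) hW _ _ hc (by omega)
    have e2 : EZ R (LinearMap.ker (io M (n-k))) (LinearMap.range (io M (k+2))) (n - 2*k - 2) :=
      hsZ'.ezc_right (hW.ez (n := n) _ (by omega)) (by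
        have : n - 2*k - 2 + 1 = n - 2*k-1 := by omega
        rw [this]; exact e1)
    have e3 : EZ R (LinearMap.ker (io M (n-k))) (VV M (k+3)) (n - 2*k - 3) :=
      (ses_range M (k+2)).ezc_right (hW.ez (n := n) _ (by omega)) (by
        have : n - 2*k - 3 + 1 = n - 2*k-2 := by omega
        rw [this]; exact e2)
    have e4 := ez_chain (n := n) M hW (k+3) t 0 hKZ (by omega) (by
      have : 0 + t = n - 2*k - 3 := by omega
      rw [this]; exact e3)
    rw [ht] at e4
    exact LinearMap.congr_fun (hom_zero_of_ez e4 (LinearMap.ker (io M (n-k))).subtype) ⟨x, hx⟩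
  intro j hj1 hj2
  by_cases h3 : j = k+2
  · rw [h3]; exact hnew1
  by_cases h4 : j = n-k
  · rw [h4]; exact hnew2
  exact hQ j (by omega) (by omega)

theorem final_proj (hm0 : m ≠ ⊥) (h2 : IsUnit (2:R) ∨ CharP R 2) (hgl : ∀ V : ModuleCat.{0} R, HasProjectiveDimensionLT V (n+2))
    (hL : Loc m M (Fin 2 → R)) (h0 : KZ M 0) (h1 : KZ M 1) (k : ℕ) (hn : 4 * k ≤ n) (hQ : QK M n k) : Module.Projective R M := by
  have hQ0 : QK M n 0 := by
    induction k with
    | zero => exact hQ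
    | succ k ih => exact ih (by omega) (Q_step (m := m) M hm0 h2 hgl hL h0 h1 k hn hQ)
  have := pd_chain M 0 0 (n+1) (fun i _ hi => by
    rcases i with _ | _ | i
    · exact h0
    · exact h1
    · exact hQ0 _ (by omega) (by omega)) (by
      have e : 0 + 1 + (n+1) = n+2 := by omega
      rw [e]; exact hgl _)
  exact proj_of_pd (A := M) this
end EX
end

open CategoryTheory TensorProduct
noncomputable section
namespace EX
variable {R : Type} [CommRing R] {m : Ideal R} {n : ℕ}

theorem pull_zero_hom {A B N : Type} [AddCommGroup A] [Module R A] [AddCommGroup B] [Module R B] [AddCommGroup N] [Module R N]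
    (u : A →ₗ[R] B) (x : EX R B N 0) (h : ∀ v : B →ₗ[R] N, v ∘ₗ u = 0) : pull u x = 0 := by
  obtain ⟨f, rfl⟩ := (Abelian.Ext.mk₀_bijective _ _).2 x
  have : pull u (Abelian.Ext.mk₀ f) = Abelian.Ext.mk₀ (ModuleCat.ofHom u ≫ f) := by
    simp [pull]
  rw [this]
  have h2 : ModuleCat.ofHom u ≫ f = 0 := by
    apply ModuleCat.hom_ext
    exact h f.hom
  rw [h2, Abelian.Ext.mk₀_zero]

theorem pull_through {A N K : Type} [AddCommGroup A] [Module R A] [AddCommGroup N] [Module R N] [AddCommGroup K] [Module R K]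
    (S : Submodule R N) (β : A →ₗ[R] N) (hβ : ∀ a, β a ∈ S) {q : ℕ} (y : EX R N K q) (h : pull S.subtype y = 0) : pull β y = 0 := by
  have : β = S.subtype ∘ₗ β.codRestrict S hβ := rfl
  rw [this, ← pull_pull, h, pull_zero]

theorem tor_step [IsNoetherianRing R] {K F N : Type} [AddCommGroup K] [Module R K] [AddCommGroup F] [Module R F] [AddCommGroup N] [Module R N] 
    [Module.Finite R F] [Module.Projective R F] (q : ℕ) (g : F →ₗ[R] N) (hg : Function.Surjective g)
    (ih : ∀ y : EX R (LinearMap.ker g) K q, ∃ s, pull (m ^ s • (⊤ : Submodule R (LinearMap.ker g))).subtype y = 0) (y : EX R N K (q+1)) :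
    ∃ s, pull (m ^ s • (⊤ : Submodule R N)).subtype y = 0 := by
  have hS := ses_ker g hg
  obtain ⟨y', hy'⟩ := ct3 hS y (ez_proj (R := R) (N := K) F q _)
  obtain ⟨s0, hs0⟩ := ih y'
  obtain ⟨k, hk⟩ := Ideal.exists_pow_inf_eq_pow_smul m (LinearMap.ker g)
  refine ⟨s0 + k, ?_⟩
  let F' : Submodule R F := m ^ (s0 + k) • ⊤
  let N' : Submodule R N := m ^ (s0 + k) • ⊤
  have hmap : F'.map g = N' := by
    change Submodule.map g (m ^ (s0+k) • ⊤) = _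
    rw [Submodule.map_smul'', Submodule.map_top, LinearMap.range_eq_top.mpr hg]
  let g' : F' →ₗ[R] N' := g.restrict (fun x hx => by rw [← hmap]; exact ⟨x, hx, rfl⟩)
  have hg' : Function.Surjective g' := by
    rintro ⟨z, hz⟩
    rw [← hmap] at hz
    obtain ⟨x, hx, rfl⟩ := hz
    exact ⟨⟨x, hx⟩, rfl⟩
  have hS' := ses_ker g' hg'
  have hle : ∀ x : LinearMap.ker g', ∃ h : x.1.1 ∈ LinearMap.ker g, (⟨x.1.1, h⟩ : LinearMap.ker g) ∈ m ^ s0 • (⊤ : Submodule R (LinearMap.ker g)) := by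
    intro x
    have h1 : g x.1.1 = 0 := congrArg Subtype.val x.2
    refine ⟨h1, ?_⟩
    have h2 : x.1.1 ∈ m ^ (s0+k) • (⊤ : Submodule R F) ⊓ LinearMap.ker g := ⟨x.1.2, h1⟩
    rw [hk (s0+k) (by omega), Nat.add_sub_cancel] at h2
    have h3 : x.1.1 ∈ m ^ s0 • LinearMap.ker g := Submodule.smul_mono le_rfl inf_le_right h2
    have h4 : (m ^ s0 • (⊤ : Submodule R (LinearMap.ker g))).map (LinearMap.ker g).subtype = m ^ s0 • LinearMap.ker g := by
      rw [Submodule.map_smul'', Submodule.map_top, Submodule.range_subtype]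
    rw [← h4] at h3
    obtain ⟨z, hz, hz2⟩ := h3
    have : z = ⟨x.1.1, h1⟩ := Subtype.ext hz2
    rwa [← this]
  let α : LinearMap.ker g' →ₗ[R] LinearMap.ker g :=
    { toFun := fun x => ⟨x.1.1, (hle x).1⟩, map_add' := fun _ _ => rfl, map_smul' := fun _ _ => rfl }
  have h7 : pull α y' = 0 := pull_through (m ^ s0 • (⊤ : Submodule R (LinearMap.ker g))) α (fun x => (hle x).2) y' hs0
  have h8 := delta_nat hS' hS α F'.subtype N'.subtype rfl rfl y'
  rw [h7, delta_zero, hy'] at h8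
  exact h8.symm

theorem tor_die [IsNoetherianRing R] {K : Type} [AddCommGroup K] [Module R K] (c : ℕ) (hc : ∀ a ∈ m ^ c, ∀ w : K, a • w = 0) (q : ℕ) :
    ∀ (N : Type) [AddCommGroup N] [Module R N] [Module.Finite R N] (y : EX R N K q), 
      ∃ s, pull (m ^ s • (⊤ : Submodule R N)).subtype y = 0 := by
  induction q with
  | zero =>
    intro N _ _ _ y
    refine ⟨c, pull_zero_hom _ _ fun v => LinearMap.ext fun x => ?_⟩
    have h1 : ∀ z ∈ m ^ c • (⊤ : Submodule R N), v z = 0 := by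
      intro z hz
      refine Submodule.smul_induction_on hz (fun a ha w _ => ?_) (fun a b ha hb => ?_)
      · rw [map_smul, hc a ha]
      · rw [map_add, ha, hb, add_zero]
    exact h1 x.1 x.2
  | succ q ih =>
    intro N _ _ _ y
    obtain ⟨r, g, hg⟩ := Module.Finite.exists_fin' R N
    exact tor_step q g hg (ih _) y

/-- restriction -/
def fac (m : Ideal R) {s t : ℕ} (h : t ≤ s) : (R ⧸ m ^ s) →ₗ[R] (R ⧸ m ^ t) :=
  Submodule.mapQ (m^s) (m^t) LinearMap.id (fun x hx => Ideal.pow_le_pow_right h hx)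

theorem fac_fac {s t r : ℕ} (h : t ≤ s) (h' : s ≤ r) : fac m h ∘ₗ fac m h' = fac m (h.trans h') := by
  refine LinearMap.ext fun x => ?_
  obtain ⟨x, rfl⟩ := Submodule.mkQ_surjective _ x
  rfl

/-- vanishing of the local cohomology, elementary form -/
def LCV (m : Ideal R) (j : ℕ) (V : Type) [AddCommGroup V] [Module R V] : Prop :=
  ∀ t, ∀ x : EX R (R ⧸ m ^ t) V j, ∃ (s : ℕ) (h : t ≤ s), pull (fac m h) x = 0

theorem LTo.lcv [IsNoetherianRing R] {K : Type} [AddCommGroup K] [Module R K] [Module.Finite R K] (hK : LTo m K) (q : ℕ) : LCV m (q+1) K := by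
  intro t x
  obtain ⟨c, hc⟩ := hK.pow
  have hS := ses_mkQ (R := R) (m^t)
  obtain ⟨y, hy⟩ := ct3 hS x (ez_proj (R := R) (N := K) R q _)
  obtain ⟨s, hs⟩ := tor_die c hc q _ y
  refine ⟨s + t, by omega, ?_⟩
  have hle : ∀ x : (m ^ (s+t) : Ideal R), ∃ h : x.1 ∈ m ^ t, (⟨x.1, h⟩ : (m^t : Ideal R)) ∈ m ^ s • (⊤ : Submodule R (m^t : Ideal R)) := by
    intro x
    refine ⟨Ideal.pow_le_pow_right (by omega) x.2, ?_⟩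
    have h4 : (m ^ s • (⊤ : Submodule R (m^t : Ideal R))).map (Submodule.subtype (m^t : Ideal R)) = m ^ s • (m ^ t : Ideal R) := by
      rw [Submodule.map_smul'', Submodule.map_top, Submodule.range_subtype]
    have h3 : x.1 ∈ m ^ s • (m ^ t : Ideal R) := by
      have h5 : m ^ (s+t) = m ^ s • (m ^ t : Ideal R) := pow_add m s t
      exact h5.le x.2
    rw [← h4] at h3
    obtain ⟨z, hz, hz2⟩ := h3
    have : z = ⟨x.1, Ideal.pow_le_pow_right (by omega) x.2⟩ := Subtype.ext hz2
    rwa [← this]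
  let α : (m ^ (s+t) : Ideal R) →ₗ[R] (m ^ t : Ideal R) :=
    { toFun := fun x => ⟨x.1, (hle x).1⟩, map_add' := fun _ _ => rfl, map_smul' := fun _ _ => rfl }
  have h7 : pull α y = 0 := pull_through _ α (fun x => (hle x).2) y hs
  have h8 := delta_nat (ses_mkQ (R := R) (m^(s+t))) hS α LinearMap.id
    (fac m (by omega : t ≤ s+t)) rfl rfl y
  rw [h7, delta_zero, hy] at h8
  exact h8.symm

variable (M : ModuleCat.{0} R)
theorem lcv_step [IsNoetherianRing R] [hT : HT m n] [Module.Finite R M] (hLP : LP m M) (i j : ℕ) (hj : j ≤ n) (h : LCV m (j+1) (VV M i)) :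
    LCV m j (VV M (i+1)) := by
  intro t x
  have := VV_fin M i
  have hS1 := ses_ker_range (io M i)
  have hS2 := ses_range M i
  obtain ⟨s1, h1, e1⟩ := (K_LTo M hLP i).lcv (j+1) t (cdelta hS1 (cdelta hS2 x))
  rw [pull_cdelta] at e1
  obtain ⟨y, hy⟩ := cv3 hS1 _ e1
  obtain ⟨s2, h2, e2⟩ := h s1 y
  refine ⟨s2, h1.trans h2, ?_⟩
  have e3 : cdelta hS2 (pull (fac m (h1.trans h2)) x) = 0 := by
    rw [← pull_cdelta, ← fac_fac h1 h2, ← pull_pull, ← hy, pull_push, e2, push_zero]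
  obtain ⟨z, hz⟩ := cv3 hS2 _ e3
  have hW : LTo m (R ⧸ m ^ s2) := LTo.of_pow s2 (fun a ha w => by
    obtain ⟨w, rfl⟩ := Submodule.mkQ_surjective _ w
    rw [← map_smul, Submodule.mkQ_apply, Submodule.Quotient.mk_eq_zero]
    exact Ideal.mul_mem_right _ _ ha) hT.max
  rw [← hz, hW.ez (n := n) (DD M i) hj z, push_zero]

theorem lcv_kz [IsNoetherianRing R] [Module.Finite R M] (hLP : LP m M) (i : ℕ) (h : LCV m 0 (VV M i)) : KZ M i := by
  intro x hx
  have := VV_fin M i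
  obtain ⟨c, hc⟩ := (K_LTo M hLP i).pow
  let u : (R ⧸ m ^ c) →ₗ[R] VV M i := Submodule.liftQ (m^c) (LinearMap.toSpanSingleton R _ x) (fun a ha => 
    congrArg Subtype.val (hc a ha ⟨x, hx⟩))
  obtain ⟨s, hs, e⟩ := h c (Abelian.Ext.mk₀ (ModuleCat.ofHom u))
  have h2 : pull (fac m hs) (Abelian.Ext.mk₀ (ModuleCat.ofHom u)) = Abelian.Ext.mk₀ (ModuleCat.ofHom (u ∘ₗ fac m hs)) := by
    simp [pull]
  rw [h2, ← Abelian.Ext.mk₀_zero] at e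
  have h3 := (Abelian.Ext.mk₀_bijective _ _).1 e
  have h4 : u (fac m hs (Submodule.mkQ _ 1)) = 0 := congrArg (fun f => f.hom (Submodule.mkQ _ 1)) h3
  have h5 : (1:R) • x = 0 := h4
  rwa [one_smul] at h5

theorem lcv_main [IsNoetherianRing R] [hT : HT m n] [Module.Finite R M] (hLP : LP m M) (j : ℕ) (hj : j ≤ n + 1) (h : LCV m j M) : KZ M j := by
  have : ∀ i, i ≤ j → LCV m (j-i) (VV M i) := by
    intro i
    induction i with
    | zero => intro _; exact h
    | succ i ih =>
      intro hi
      apply lcv_step (n := n) M hLP i _ (by omega)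
      have := ih (by omega)
      have e : j - (i+1) + 1 = j - i := by omega
      rw [e]; exact this
  apply lcv_kz M hLP
  have := this j le_rfl
  rwa [Nat.sub_self] at this
end EX
end

open CategoryTheory TensorProduct
noncomputable section
namespace EX
open Limits Opposite

section A
variable {R : Type} [CommRing R] (m : Ideal R) (j : ℕ) (V : ModuleCat.{0} R)

/-- the old Ext -/
abbrev OE (X V : ModuleCat.{0} R) (j : ℕ) : ModuleCat.{0} R := ((_root_.Ext R (ModuleCat.{0} R) j).obj (op X)).obj V

/-- functoriality of the old Ext -/
abbrev oeMap {X' X : ModuleCat.{0} R} (g : X' ⟶ X) (V : ModuleCat.{0} R) (j : ℕ) : OE X V j ⟶ OE X' V j :=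
  ((_root_.Ext R (ModuleCat.{0} R) j).map g.op).app V

theorem lc_old (h : Subsingleton ((localCohomology m j).obj V)) (t : ℕ)
    (e : OE (ModuleCat.of R (R ⧸ m ^ t)) V j) :
    ∃ s, ∃ h : t ≤ s, oeMap (ModuleCat.ofHom (fac m h)) V j e = 0 := by
  let D := localCohomology.diagram (localCohomology.idealPowersDiagram m) j
  have : HasColimit D := localCohomology.hasColimitDiagram _ _
  let hD := isColimitOfPreserves ((evaluation _ _).obj V) (colimit.isColimit D)
  let x : (D ⋙ (evaluation _ _).obj V).obj (op (op t)) := e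
  have := Concrete.isColimit_exists_of_rep_eq (D ⋙ (evaluation _ _).obj V) hD (i := op (op t)) (j := op (op t)) x 0 (h.elim _ _)
  obtain ⟨k, f, g, hfg⟩ := this
  refine ⟨k.unop.unop, f.unop.unop.le, ?_⟩
  rw [map_zero] at hfg
  exact hfg
end A

section B
variable {R : Type} [CommRing R]

theorem op_cocycle (K : ChainComplex (ModuleCat.{0} R)ᵒᵖ ℕ) (n : ℕ) (f : ((K.X n).unop : ModuleCat.{0} R))
    (hf : (K.d (n+1) n).unop f = 0) : ∃ z : ((K.opcycles n).unop : ModuleCat.{0} R), (K.pOpcycles n).unop z = f := by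
  let S : ShortComplex (ModuleCat.{0} R)ᵒᵖ := ShortComplex.mk (K.d (n+1) n) (K.pOpcycles n) (by simp)
  have hS : S.Exact := ShortComplex.exact_of_g_is_cokernel _ (K.opcyclesIsCokernel (n+1) n (by simp))
  exact (ShortComplex.moduleCat_exact_iff _).1 hS.unop f hf

theorem op_zero (K : ChainComplex (ModuleCat.{0} R)ᵒᵖ ℕ) (n : ℕ) (z : ((K.opcycles n).unop : ModuleCat.{0} R))
    (hz : (K.homologyι n).unop z = 0) :
    ∃ y : ((K.X ((ComplexShape.down ℕ).next n)).unop : ModuleCat.{0} R), (K.d n ((ComplexShape.down ℕ).next n)).unop y = (K.pOpcycles n).unop z := by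
  let S : ShortComplex (ModuleCat.{0} R)ᵒᵖ := ShortComplex.mk (K.homologyι n) (K.fromOpcycles n ((ComplexShape.down ℕ).next n)) (by simp)
  have hS : S.Exact := ShortComplex.exact_of_f_is_kernel _ (K.homologyIsKernel n _ rfl)
  obtain ⟨y, hy⟩ := (ShortComplex.moduleCat_exact_iff _).1 hS.unop z hz
  refine ⟨y, ?_⟩
  rw [← hy, ← K.p_fromOpcycles]
  rfl

theorem old_bridge {X Y : ModuleCat.{0} R} (P : ProjectiveResolution X) (n : ℕ) (f : P.complex.X n ⟶ Y)
    (hf : P.complex.d (n+1) n ≫ f = 0) :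
    ∃ e : OE X Y n, ∀ (X' : ModuleCat.{0} R) (g : X' ⟶ X) (P' : ProjectiveResolution X') (φ : P'.complex ⟶ P.complex)
      (_ : φ.f 0 ≫ P.π.f 0 = P'.π.f 0 ≫ g), oeMap g Y n e = 0 →
      ∃ y : P'.complex.X ((ComplexShape.down ℕ).next n) ⟶ Y, P'.complex.d n _ ≫ y = φ.f n ≫ f := by
  let F : ModuleCat.{0} R ⥤ (ModuleCat.{0} R)ᵒᵖ := ((linearYoneda R (ModuleCat.{0} R)).obj Y).rightOp
  let K := (F.mapHomologicalComplex (ComplexShape.down ℕ)).obj P.complex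
  obtain ⟨z, hz⟩ := op_cocycle K n f hf
  let e0 := (K.homologyι n).unop z
  refine ⟨(P.isoLeftDerivedObj F n).hom.unop e0, ?_⟩
  intro X' g P' φ hφ he
  let K' := (F.mapHomologicalComplex (ComplexShape.down ℕ)).obj P'.complex
  let ψ : K' ⟶ K := (F.mapHomologicalComplex (ComplexShape.down ℕ)).map φ
  have h1 := ProjectiveResolution.isoLeftDerivedObj_hom_naturality g P' P φ hφ F n
  have h2 : (P'.isoLeftDerivedObj F n).hom.unop ((HomologicalComplex.homologyMap ψ n).unop e0) = 0 := by
    have h3 := congrArg Quiver.Hom.unop h1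
    have h4 := ConcreteCategory.congr_hom h3 e0
    exact h4.symm.trans he
  have h5 : (HomologicalComplex.homologyMap ψ n).unop e0 = 0 := by
    have h6 := ConcreteCategory.congr_hom (congrArg Quiver.Hom.unop (P'.isoLeftDerivedObj F n).inv_hom_id) ((HomologicalComplex.homologyMap ψ n).unop e0)
    refine h6.symm.trans ?_
    change (P'.isoLeftDerivedObj F n).inv.unop ((P'.isoLeftDerivedObj F n).hom.unop _) = 0
    rw [h2, map_zero]
  have h7 : (K'.homologyι n).unop ((HomologicalComplex.opcyclesMap ψ n).unop z) = 0 := by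
    have h8 := ConcreteCategory.congr_hom (congrArg Quiver.Hom.unop (HomologicalComplex.homologyι_naturality ψ n)) z
    exact h8.symm.trans h5
  obtain ⟨y, hy⟩ := op_zero K' n _ h7
  refine ⟨y, ?_⟩
  have h9 := ConcreteCategory.congr_hom (congrArg Quiver.Hom.unop (HomologicalComplex.p_opcyclesMap ψ n)) z
  refine Eq.trans hy (Eq.trans h9 ?_)
  change (ψ.f n).unop ((K.pOpcycles n).unop z) = _
  rw [hz]
  rfl

theorem lcv_of_lc (m : Ideal R) (j : ℕ) (V : ModuleCat.{0} R) (h : Subsingleton ((localCohomology m j).obj V)) : LCV m j V := by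
  intro t x
  let P := projectiveResolution (ModuleCat.of R (R ⧸ m ^ t))
  obtain ⟨f, hf, rfl⟩ := P.extMk_surjective x (j+1) rfl
  obtain ⟨e, he⟩ := old_bridge P j f hf
  obtain ⟨s, hts, hs⟩ := lc_old m j V h t e
  refine ⟨s, hts, ?_⟩
  let g := ModuleCat.ofHom (fac m hts)
  let P' := projectiveResolution (ModuleCat.of R (R ⧸ m ^ s))
  let φ := ProjectiveResolution.lift g P' P
  have hφ : φ.f 0 ≫ P.π.f 0 = P'.π.f 0 ≫ g := ProjectiveResolution.lift_commutes_zero _ _ _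
  obtain ⟨y, hy⟩ := he _ g P' φ hφ hs
  let Φ : ProjectiveResolution.Hom P' P g := ⟨φ, hφ⟩
  change (Abelian.Ext.mk₀ g).comp (P.extMk f (j+1) rfl hf) (zero_add j) = 0
  rw [P.mk₀_comp_extMk f (j+1) rfl hf Φ]
  cases j with
  | zero =>
    have h0 : Φ.hom.f 0 ≫ f = 0 := by
      refine hy.symm.trans ?_
      have : P'.complex.d 0 ((ComplexShape.down ℕ).next 0) = 0 := P'.complex.shape _ _ (by simp)
      rw [this, zero_comp]
    simp only [h0, ProjectiveResolution.extMk_zero]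
  | succ p =>
    rw [P'.extMk_eq_zero_iff _ _ _ _ p rfl]
    have : ∀ q, q = p → (∃ y : P'.complex.X q ⟶ V, P'.complex.d (p+1) q ≫ y = φ.f (p+1) ≫ f) → ∃ y : P'.complex.X p ⟶ V, P'.complex.d (p+1) p ≫ y = φ.f (p+1) ≫ f := by
      rintro q rfl h; exact h
    exact this _ (by simp) ⟨y, hy⟩

end B
end EX
end

open CategoryTheory TensorProduct
noncomputable section
namespace FIN

theorem mem_irrel (K : Type) [Field K] (n : ℕ) (x : PolyS K n) : x ∈ irrel K n ↔ MvPolynomial.constantCoeff x = 0 := by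
  have h := MvPolynomial.mem_ideal_span_X_image (x := x) (s := Set.univ)
  rw [Set.image_univ] at h
  rw [irrel, h, MvPolynomial.constantCoeff_eq]
  constructor
  · intro h
    by_contra h0
    obtain ⟨i, _, hi⟩ := h 0 (MvPolynomial.mem_support_iff.mpr h0)
    exact hi rfl
  · intro h m hm
    by_contra hc
    push Not at hc
    have : m = 0 := Finsupp.ext fun i => hc i trivial
    rw [this, MvPolynomial.mem_support_iff] at hm
    exact hm h

theorem irrel_max (K : Type) [Field K] (n : ℕ) : (irrel K n).IsMaximal := by
  have : irrel K n = RingHom.ker (MvPolynomial.constantCoeff : PolyS K n →+* K) := by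
    ext x
    rw [mem_irrel, RingHom.mem_ker]
  rw [this]
  exact RingHom.ker_isMaximal_of_surjective _ (fun a => ⟨MvPolynomial.C a, by simp⟩)

theorem X_mem (K : Type) [Field K] (n : ℕ) (i : Fin (n+1)) : (MvPolynomial.X i : PolyS K n) ∈ irrel K n :=
  Ideal.subset_span ⟨i, rfl⟩

theorem irrel_ne_bot (K : Type) [Field K] (n : ℕ) : irrel K n ≠ ⊥ := by
  intro h
  have := X_mem K n 0
  rw [h, Ideal.mem_bot] at this
  exact MvPolynomial.X_ne_zero _ this

theorem two_or (K : Type) [Field K] (n : ℕ) : IsUnit (2 : PolyS K n) ∨ CharP (PolyS K n) 2 := by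
  by_cases h : (2 : K) = 0
  · right
    have : CharP K 2 := CharTwo.of_one_ne_zero_of_two_eq_zero one_ne_zero h
    infer_instance
  · left
    have := (IsUnit.mk0 (2:K) h).map (MvPolynomial.C : K →+* PolyS K n)
    rwa [map_ofNat] at this

theorem reg (K : Type) [Field K] (n : ℕ) : RingTheory.Sequence.IsRegular (PolyS K n) (List.ofFn (fun i : Fin (n+1) => (MvPolynomial.X i : PolyS K n))) := by
  have hmax := irrel_max K n
  refine ⟨⟨?_⟩, ?_⟩
  · intro i hi
    have hi' : i < n+1 := by simpa using hi
    have hof : (Ideal.ofList ((List.ofFn (fun i : Fin (n+1) => (MvPolynomial.X i : PolyS K n))).take i)) = 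
        Ideal.span (Set.image MvPolynomial.X {j : Fin (n+1) | j.1 < i} : Set (PolyS K n)) := by
      rw [Ideal.ofList]
      congr 1
      ext x
      simp only [Set.mem_setOf_eq, Set.mem_image, List.mem_take_iff_getElem]
      constructor
      · rintro ⟨j, hj, rfl⟩
        simp at hj
        exact ⟨⟨j, by omega⟩, by simp; omega, by rw [List.getElem_ofFn]⟩
      · rintro ⟨j, hj, rfl⟩
        exact ⟨j.1, by simp; omega, by rw [List.getElem_ofFn]⟩
    rw [hof]
    have e : ∀ x : PolyS K n, x ∈ (Ideal.span (Set.image MvPolynomial.X {j : Fin (n+1) | j.1 < i} : Set (PolyS K n)) • (⊤ : Submodule (PolyS K n) (PolyS K n))) ↔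
        x ∈ Ideal.span (Set.image MvPolynomial.X {j : Fin (n+1) | j.1 < i} : Set (PolyS K n)) := by
      intro x
      simp
    rw [isSMulRegular_iff_right_eq_zero_of_smul]
    intro x hx
    obtain ⟨x, rfl⟩ := Submodule.Quotient.mk_surjective _ x
    rw [← Submodule.Quotient.mk_smul, Submodule.Quotient.mk_eq_zero, e, MvPolynomial.mem_ideal_span_X_image] at hx
    rw [Submodule.Quotient.mk_eq_zero, e, MvPolynomial.mem_ideal_span_X_image]
    intro d hd
    obtain ⟨j, hj, hj2⟩ := hx (Finsupp.single ⟨i, hi'⟩ 1 + d) (by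
      rw [MvPolynomial.mem_support_iff] at hd ⊢
      simp only [List.getElem_ofFn, smul_eq_mul]
      rwa [MvPolynomial.coeff_X_mul])
    refine ⟨j, hj, ?_⟩
    have hne : (⟨i, hi'⟩ : Fin (n+1)) ≠ j := by
      rintro rfl
      exact lt_irrefl i hj
    rwa [Finsupp.add_apply, Finsupp.single_eq_of_ne' hne, zero_add] at hj2
  · intro h
    have h1 : (1 : PolyS K n) ∈ irrel K n := by
      have : Ideal.ofList (List.ofFn (fun i : Fin (n+1) => (MvPolynomial.X i : PolyS K n))) • (⊤ : Submodule (PolyS K n) (PolyS K n)) ≤ irrel K n := by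
        rw [Submodule.smul_le]
        intro r hr x _
        refine Ideal.mul_mem_right _ _ ?_
        refine (Ideal.span_le.mpr ?_ : Ideal.ofList _ ≤ _) hr
        intro y hy
        simp only [Set.mem_setOf_eq, List.mem_ofFn] at hy
        obtain ⟨j, rfl⟩ := hy
        exact X_mem K n j
      apply this
      rw [← h]
      trivial
    exact hmax.ne_top ((Ideal.eq_top_iff_one _).mpr h1)

theorem ht (K : Type) [Field K] (n : ℕ) : EX.HT (irrel K n) n where
  max := irrel_max K n
  ext W _ _ _ hW i hi := by
    have hmax := irrel_max K n
    obtain ⟨c, hc⟩ := hW.pow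
    have hs : Module.support (PolyS K n) (ModuleCat.of (PolyS K n) W) ⊆ PrimeSpectrum.zeroLocus (irrel K n) := by
      intro p hp
      have h1 : Module.annihilator (PolyS K n) W ≤ p.asIdeal := Module.mem_support_iff_of_finite.mp hp
      have h2 : irrel K n ^ c ≤ p.asIdeal := fun a ha => h1 (Module.mem_annihilator.mpr (hc a ha))
      exact p.2.le_of_pow_le h2
    have := ModuleCat.subsingleton_ext_of_exists_isRegular (irrel K n) (ModuleCat.of _ W) hs (ModuleCat.of _ (PolyS K n)) (by
      rw [lt_top_iff_ne_top]
      intro h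
      apply hmax.ne_top
      simpa using h) _ (by
        intro r hr
        simp only [List.mem_ofFn] at hr
        obtain ⟨j, rfl⟩ := hr
        exact X_mem K n j) (reg K n) i (by simp; omega)
    intro x
    exact this.elim _ _

theorem loc_gen {R : Type} [CommRing R] [IsNoetherianRing R] (m : Ideal R) (E F : Type) [AddCommGroup E] [Module R E] [Module.Finite R E] [AddCommGroup F] [Module R F] [Module.Finite R F] 
    (p : Ideal R) [p.IsPrime] (e : LocalizedModule p.primeCompl E ≃ₗ[R] LocalizedModule p.primeCompl F) :
    ∃ a, a ∉ p ∧ ∃ (u : E →ₗ[R] F) (v : F →ₗ[R] E), (∀ x, v (u x) = a • x) ∧ ∀ y, u (v y) = a • y := by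
  have : Module.FinitePresentation R E := Module.finitePresentation_of_finite R E
  have : Module.FinitePresentation R F := Module.finitePresentation_of_finite R F
  let f := LocalizedModule.mkLinearMap p.primeCompl E
  let g := LocalizedModule.mkLinearMap p.primeCompl F
  obtain ⟨u, s, hu⟩ := Module.FinitePresentation.exists_lift_of_isLocalizedModule p.primeCompl g (e.toLinearMap ∘ₗ f)
  obtain ⟨v, t, hv⟩ := Module.FinitePresentation.exists_lift_of_isLocalizedModule p.primeCompl f (e.symm.toLinearMap ∘ₗ g)
  have hu' : ∀ x, g (u x) = (s : R) • e (f x) := fun x => LinearMap.congr_fun hu x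
  have hv' : ∀ x, f (v x) = (t : R) • e.symm (g x) := fun x => LinearMap.congr_fun hv x
  obtain ⟨c, hc⟩ := Module.Finite.exists_smul_of_comp_eq_of_isLocalizedModule p.primeCompl f (v ∘ₗ u) (((t : R) * s) • LinearMap.id) (by
    refine LinearMap.ext fun x => ?_
    change f (v (u x)) = f (((t:R) * s) • x)
    rw [hv', hu', map_smul, map_smul, LinearEquiv.symm_apply_apply, smul_smul])
  obtain ⟨d, hd⟩ := Module.Finite.exists_smul_of_comp_eq_of_isLocalizedModule p.primeCompl g (u ∘ₗ v) (((t : R) * s) • LinearMap.id) (by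
    refine LinearMap.ext fun x => ?_
    change g (u (v x)) = g (((t:R) * s) • x)
    rw [hu', hv', map_smul, map_smul, LinearEquiv.apply_symm_apply, smul_smul, mul_comm])
  have hc' : ∀ x, (c : R) • v (u x) = (c:R) • ((t:R) * s) • x := fun x => LinearMap.congr_fun hc x
  have hd' : ∀ x, (d : R) • u (v x) = (d:R) • ((t:R) * s) • x := fun x => LinearMap.congr_fun hd x
  refine ⟨((c * d * (t * s) : p.primeCompl) : R), (c * d * (t * s) : p.primeCompl).2, ((c : R) * d) • u, v, fun x => ?_, fun y => ?_⟩
  · rw [LinearMap.smul_apply, map_smul, mul_comm, mul_smul, hc', smul_smul, smul_smul]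
    congr 1
    push_cast
    ring
  · rw [LinearMap.smul_apply, mul_smul, hd', smul_smul, smul_smul]
    congr 1
    try (push_cast; ring)

theorem loc_rank {R : Type} [CommRing R] [IsNoetherianRing R] (E : Type) [AddCommGroup E] [Module R E] [Module.Finite R E]
    (p : Ideal R) [p.IsPrime] (h1 : Module.Free (Localization.AtPrime p) (LocalizedModule p.primeCompl E))
    (h2 : Module.rank (Localization.AtPrime p) (LocalizedModule p.primeCompl E) = 2) :
    Nonempty (LocalizedModule p.primeCompl E ≃ₗ[R] LocalizedModule p.primeCompl (Fin 2 → R)) := by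
  let f := LocalizedModule.mkLinearMap p.primeCompl (Fin 2 → R)
  have h3 : Module.finrank (Localization.AtPrime p) (LocalizedModule p.primeCompl E) = 2 := by
    rw [Module.finrank, h2]; simp
  have : Module.Finite (Localization.AtPrime p) (LocalizedModule p.primeCompl E) := Module.Finite.of_isLocalizedModule p.primeCompl (LocalizedModule.mkLinearMap p.primeCompl E)
  let b := Module.finBasisOfFinrankEq (Localization.AtPrime p) (LocalizedModule p.primeCompl E) h3
  let e1 : LocalizedModule p.primeCompl E ≃ₗ[R] (Fin 2 → Localization.AtPrime p) := b.equivFun.restrictScalars R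
  let g : (Fin 2 → R) →ₗ[R] (Fin 2 → Localization.AtPrime p) := LinearMap.pi fun i => (Algebra.linearMap R (Localization.AtPrime p)) ∘ₗ LinearMap.proj i
  have : IsLocalizedModule p.primeCompl g := IsLocalizedModule.pi _ _
  exact ⟨e1.trans (IsLocalizedModule.linearEquiv p.primeCompl g f)⟩

theorem main (K : Type) [Field K] (n k : ℕ) (hk : 1 < k) (hn : 4 * k ≤ n)
    (E : Type) [AddCommGroup E] [Module (PolyS K n) E]
    (hE : IsRankTwoBundleModule K n E)
    (hvan : ∀ i : ℕ, 1 ≤ i → i ≤ n - 1 → i ≠ 1 → i ≠ k → i ≠ n - k → i ≠ n - 1 →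
      Subsingleton (Hstar K n i E)) :
    Module.Free (PolyS K n) E := by
  have hT := ht K n
  have := hE.finite
  have hL : EX.Loc (irrel K n) E (Fin 2 → PolyS K n) := by
    intro p hp hpm
    obtain ⟨e⟩ := loc_rank E p (hE.locFree ⟨p, hp⟩ hpm) (hE.rank2 ⟨p, hp⟩ hpm)
    exact loc_gen (irrel K n) E _ p e
  have hLP : EX.LP (irrel K n) E := by
    intro p hp hpm
    obtain ⟨a, ha, u, v, h, _⟩ := hL p hp hpm
    exact ⟨a, ha, 2, u, v, h⟩
  have hKZ : ∀ j ≤ n + 1, Subsingleton ((localCohomology (irrel K n) j).obj (ModuleCat.of (PolyS K n) E)) → EX.KZ (ModuleCat.of (PolyS K n) E) j := by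
    intro j hj h
    exact EX.lcv_main (m := irrel K n) (n := n) (ModuleCat.of (PolyS K n) E) hLP j hj (EX.lcv_of_lc _ _ _ h)
  have hP : Module.Projective (PolyS K n) E := by
    refine EX.final_proj (m := irrel K n) (n := n) (ModuleCat.of (PolyS K n) E) (irrel_ne_bot K n) (two_or K n)
      (fun V => GD.pdlt_mv K (n+1) V) hL (hKZ 0 (by omega) hE.h0) (hKZ 1 (by omega) hE.h1) k hn ?_
    intro j hj1 hj2
    obtain ⟨i, rfl⟩ : ∃ i, j = i + 1 := ⟨j - 1, by omega⟩
    exact hKZ (i+1) (by omega) (hvan i (by omega) (by omega) (by omega) (by omega) (by omega) (by omega))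
  obtain ⟨a, ha, u, v, _, h⟩ := hL ⊥ Ideal.isPrime_bot (irrel_ne_bot K n).symm
  refine QS.projective_free K (n+1) E v ?_
  rw [injective_iff_map_eq_zero]
  intro y hy
  have h1 := h y
  rw [hy, map_zero] at h1
  exact (smul_eq_zero.mp h1.symm).resolve_left ha
end FIN
end

/-- main nonexistence theorem.  Let `n ≥ 4k` with `k > 1`.  Any
rank two bundle `E` on `ℙⁿ` whose only (possibly) nonzero intermediate cohomology
modules are `H¹_*(E)`, `H^k_*(E)`, `H^{n-k}_*(E)` and `H^{n-1}_*(E)` must split;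
in particular there is no indecomposable such bundle. -/
theorem no_isolated_cohomology_bundle
    (K : Type) [Field K] (n k : ℕ) (hk : 1 < k) (hn : 4 * k ≤ n)
    (E : Type) [AddCommGroup E] [Module (PolyS K n) E]
    (hE : IsRankTwoBundleModule K n E)
    (hvan : ∀ i : ℕ, 1 ≤ i → i ≤ n - 1 → i ≠ 1 → i ≠ k → i ≠ n - k → i ≠ n - 1 →
      Subsingleton (Hstar K n i E)) :
    Module.Free (PolyS K n) E :=
  FIN.main K n k hk hn E hE hvan
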